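/- Let n ∈ ℕ, s ∈ (1, n+1)\ℕ, let A be a Young function with ∫_0 (t/A(t))^{(s−1)/(n+1−s)} dt < ∞, and let φ be an admissible function. Then V^{s,A}_{d,1}(ℝⁿ) → V𝓛^{φ}(ℝⁿ) uniformly if and only if there exists c > 0 with ψ_{s,A}(r) ≤ c φ(r) for all r > 0 and lim_{r→0⁺} ψ_{s,A}(r)/φ(r) = 0. -/

import Mathlib

open MeasureTheory Metric Set Filter
open scoped ENNReal Topology

noncomputable section

/-- Euclidean space `ℝⁿ`. -/
abbrev Euc (n : ℕ) := EuclideanSpace ℝ (Fin n)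

/-- A Young function: convex, left-continuous, vanishing at `0`,
non-constant on `(0,∞)`, with values in `[0,∞]`. -/
def IsYoung (A : ℝ → ℝ≥0∞) : Prop :=
  A 0 = 0 ∧
  (∀ x y t : ℝ, 0 ≤ x → 0 ≤ y → 0 ≤ t → t ≤ 1 →
      A (t * x + (1 - t) * y) ≤ ENNReal.ofReal t * A x + ENNReal.ofReal (1 - t) * A y) ∧
  (∀ t : ℝ, 0 < t → ContinuousWithinAt A (Set.Iic t) t) ∧
  (∃ t₁ t₂ : ℝ, 0 < t₁ ∧ 0 < t₂ ∧ A t₁ ≠ A t₂)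

/-- The right-continuous generalized inverse of a monotone function `A : [0,∞) → [0,∞]`. -/
def rcInv (A : ℝ → ℝ≥0∞) (v : ℝ≥0∞) : ℝ :=
  sInf {τ : ℝ | 0 ≤ τ ∧ v < A τ}

/-- The Young conjugate `Ã(t) = sup {τ t - A(τ) : τ ≥ 0}`. -/
def youngConj (A : ℝ → ℝ≥0∞) (t : ℝ) : ℝ≥0∞ :=
  ⨆ (τ : ℝ) (_ : 0 ≤ τ), ENNReal.ofReal (τ * t) - A τ

/-- The functional `J_{σ,A}(v)` for a vector-valued `v`, with the Euclidean norm. -/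
def Jfun (n : ℕ) (σ : ℝ) (A : ℝ → ℝ≥0∞) {ι : Type} [Fintype ι]
    (v : Euc n → ι → ℝ) : ℝ≥0∞ :=
  ∫⁻ x : Euc n, ∫⁻ y : Euc n,
    A (Real.sqrt (∑ i, (v x i - v y i) ^ 2) / ‖x - y‖ ^ σ) /
      ENNReal.ofReal (‖x - y‖ ^ (n : ℝ))

/-- The fractional Orlicz–Sobolev seminorm `|v|_{σ,A,ℝⁿ}` (vector-valued version). -/
def fracSem (n : ℕ) (σ : ℝ) (A : ℝ → ℝ≥0∞) {ι : Type} [Fintype ι]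
    (v : Euc n → ι → ℝ) : ℝ≥0∞ :=
  sInf (ENNReal.ofReal '' {lam : ℝ | 0 < lam ∧ Jfun n σ A (fun x i => v x i / lam) ≤ 1})

/-- The fractional Orlicz–Sobolev seminorm `|u|_{σ,A,ℝⁿ}` of a scalar function. -/
def fracSemS (n : ℕ) (σ : ℝ) (A : ℝ → ℝ≥0∞) (u : Euc n → ℝ) : ℝ≥0∞ :=
  fracSem n σ A (fun x (_ : Fin 1) => u x)

/-- The normalized mean oscillation `φ(|B|^{1/n})⁻¹ ⨍_B |u - u_B|` over the ball `B = B(x,r)`. -/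
def oscQuot (n : ℕ) (φ : ℝ → ℝ) (u : Euc n → ℝ) (x : Euc n) (r : ℝ) : ℝ :=
  (φ ((volume (ball x r)).toReal ^ ((n : ℝ)⁻¹)))⁻¹ *
    ⨍ y in ball x r, |u y - ⨍ z in ball x r, u z|

/-- The Campanato seminorm `|u|_{𝓛^φ(ℝⁿ)}`. -/
def campSem (n : ℕ) (φ : ℝ → ℝ) (u : Euc n → ℝ) : ℝ≥0∞ :=
  ⨆ (x : Euc n) (r : ℝ) (_ : 0 < r), ENNReal.ofReal (oscQuot n φ u x r)

/-- The Campanato quantity restricted to balls of measure at most `r`. -/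
def campSemSmall (n : ℕ) (φ : ℝ → ℝ) (u : Euc n → ℝ) (r : ℝ) : ℝ≥0∞ :=
  ⨆ (x : Euc n) (ρ : ℝ) (_ : 0 < ρ) (_ : volume (ball x ρ) ≤ ENNReal.ofReal r),
    ENNReal.ofReal (oscQuot n φ u x ρ)

/-- `φ : (0,∞) → (0,∞)` is admissible: positive and bounded below away from zero on `[a,∞)`. -/
def Admissible (φ : ℝ → ℝ) : Prop :=
  (∀ r : ℝ, 0 < r → 0 < φ r) ∧
  ∀ a : ℝ, 0 < a → ∃ ε : ℝ, 0 < ε ∧ ∀ r : ℝ, a ≤ r → ε ≤ φ r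

/-- `φ_{s,A}(r) = r^s A⁻¹(r^{-n})`. -/
def phiSA (n : ℕ) (s : ℝ) (A : ℝ → ℝ≥0∞) (r : ℝ) : ℝ :=
  r ^ s * rcInv A (ENNReal.ofReal (r ^ (-(n : ℝ))))

/-- `u` is `m`-times weakly differentiable, with iterated weak partial
derivatives recorded by `D`. -/
def HasWeakDerivs (n m : ℕ) (u : Euc n → ℝ)
    (D : (h : ℕ) → Euc n → (Fin h → Fin n) → ℝ) : Prop :=
  (∀ x d, D 0 x d = u x) ∧
  ∀ h : ℕ, h ≤ m → ∀ dirs : Fin h → Fin n,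
    LocallyIntegrable (fun x => D h x dirs) volume ∧
    ∀ φ : Euc n → ℝ, ContDiff ℝ (⊤ : ℕ∞) φ → HasCompactSupport φ →
      ∫ x : Euc n, u x *
          iteratedFDeriv ℝ h φ x (fun i => EuclideanSpace.single (dirs i) (1 : ℝ)) =
        (-1 : ℝ) ^ h * ∫ x : Euc n, D h x dirs * φ x

/-- The Euclidean length `|∇^h u|(x)` of the `h`-th order weak gradient. -/
def gradLen (n : ℕ) (D : (h : ℕ) → Euc n → (Fin h → Fin n) → ℝ) (h : ℕ) (x : Euc n) : ℝ :=
  Real.sqrt (∑ d : Fin h → Fin n, (D h x d) ^ 2)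

/-- The derivatives of orders `k, …, m` decay near infinity:
`|{|∇^h u| > t}| < ∞` for every `t > 0`. -/
def DecayFrom (n k m : ℕ) (D : (h : ℕ) → Euc n → (Fin h → Fin n) → ℝ) : Prop :=
  ∀ h : ℕ, k ≤ h → h ≤ m → ∀ t : ℝ, 0 < t →
    volume {x : Euc n | t < gradLen n D h x} < ⊤

/-- The Young function `F_k(t) = t^{n/(n-s+k+1)} ∫_0^t Ã(τ) τ^{-1-n/(n-s+k+1)} dτ`. -/
def Fk (n : ℕ) (s : ℝ) (k : ℕ) (A : ℝ → ℝ≥0∞) (t : ℝ) : ℝ≥0∞ :=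
  ENNReal.ofReal (t ^ ((n : ℝ) / ((n : ℝ) - s + (k : ℝ) + 1))) *
    ∫⁻ τ in Set.Ioc (0 : ℝ) t,
      youngConj A τ * ENNReal.ofReal (τ ^ (-1 - (n : ℝ) / ((n : ℝ) - s + (k : ℝ) + 1)))

/-- `ψ^k_{s,A}(r) = 1 / (r^{n-s+k} F_k⁻¹(r^{-n}))`. -/
def psiK (n : ℕ) (s : ℝ) (k : ℕ) (A : ℝ → ℝ≥0∞) (r : ℝ) : ℝ :=
  (r ^ ((n : ℝ) - s + (k : ℝ)) * rcInv (Fk n s k A) (ENNReal.ofReal (r ^ (-(n : ℝ)))))⁻¹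

/-- `ψ^{[s]}_{s,A}(r) = r^{{s}} A⁻¹(r^{-n})`. -/
def psiTop (n : ℕ) (s : ℝ) (A : ℝ → ℝ≥0∞) (r : ℝ) : ℝ :=
  r ^ (s - (⌊s⌋₊ : ℝ)) * rcInv A (ENNReal.ofReal (r ^ (-(n : ℝ))))

/-- Convergence near zero of `∫_0 (t/A(t))^{(s-(k+1))/(n-(s-(k+1)))} dt`. -/
def IntCondK (n : ℕ) (s : ℝ) (k : ℕ) (A : ℝ → ℝ≥0∞) : Prop :=
  ∃ ε : ℝ, 0 < ε ∧
    ∫⁻ t in Set.Ioc (0 : ℝ) ε,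
      (ENNReal.ofReal t / A t) ^ ((s - (k : ℝ) - 1) / ((n : ℝ) - (s - (k : ℝ) - 1))) < ⊤

/-- `P` is the projection polynomial `P^k_B[u]`: it has degree at most `k` and its
derivatives up to order `k` match, in the mean over `B`, the weak derivatives `D` of `u`. -/
def IsCampPoly (n k : ℕ) (D : (h : ℕ) → Euc n → (Fin h → Fin n) → ℝ)
    (B : Set (Euc n)) (P : MvPolynomial (Fin n) ℝ) : Prop :=
  P.totalDegree ≤ k ∧
  ∀ h : ℕ, h ≤ k → ∀ dirs : Fin h → Fin n,
    ∫ x in B, D h x dirs =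
      ∫ x in B,
        iteratedFDeriv ℝ h (fun y : Euc n => MvPolynomial.eval (fun i => y i) P) x
          (fun i => EuclideanSpace.single (dirs i) (1 : ℝ))

/-- The normalized oscillation of order `k` over the ball `B(x,r)`. -/
def oscQuotK (n k : ℕ) (φ : ℝ → ℝ) (u : Euc n → ℝ)
    (D : (h : ℕ) → Euc n → (Fin h → Fin n) → ℝ) (x : Euc n) (r : ℝ) : ℝ≥0∞ :=
  ⨅ (P : MvPolynomial (Fin n) ℝ) (_ : IsCampPoly n k D (ball x r) P),
    ENNReal.ofReal
      ((φ ((volume (ball x r)).toReal ^ ((n : ℝ)⁻¹)) *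
          (volume (ball x r)).toReal ^ ((k : ℝ) / (n : ℝ)))⁻¹ *
        ⨍ y in ball x r, |u y - MvPolynomial.eval (fun i => y i) P|)

/-- The `k`-th order Campanato seminorm `|u|_{𝓛^{k,φ}(ℝⁿ)}`. -/
def campSemK (n k : ℕ) (φ : ℝ → ℝ) (u : Euc n → ℝ)
    (D : (h : ℕ) → Euc n → (Fin h → Fin n) → ℝ) : ℝ≥0∞ :=
  ⨆ (x : Euc n) (r : ℝ) (_ : 0 < r), oscQuotK n k φ u D x r

/-- The `k`-th order Campanato quantity restricted to balls of measure at most `r`. -/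
def campSemKSmall (n k : ℕ) (φ : ℝ → ℝ) (u : Euc n → ℝ)
    (D : (h : ℕ) → Euc n → (Fin h → Fin n) → ℝ) (r : ℝ) : ℝ≥0∞ :=
  ⨆ (x : Euc n) (ρ : ℝ) (_ : 0 < ρ) (_ : volume (ball x ρ) ≤ ENNReal.ofReal r),
    oscQuotK n k φ u D x ρ

/-- The Luxemburg norm `‖f‖_{L^A(μ)}`. -/
def luxNorm {α : Type*} [MeasurableSpace α] (A : ℝ → ℝ≥0∞) (μ : Measure α)
    (f : α → ℝ) : ℝ≥0∞ :=
  sInf (ENNReal.ofReal '' {lam : ℝ | 0 < lam ∧ ∫⁻ x, A (|f x| / lam) ∂μ ≤ 1})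

/-- Iterated integral `∫_r^∞ ∫_{r_1}^∞ ⋯ g`. -/
def iterInt : ℕ → (ℝ → ℝ) → (ℝ → ℝ)
  | 0, g => g
  | j + 1, g => fun r => ∫ t in Set.Ioi r, iterInt j g t

end

/-! ### Young functions -/

lemma IsYoung.mul_le {A : ℝ → ℝ≥0∞} (hA : IsYoung A) {θ t : ℝ} (h0 : 0 ≤ θ) (h1 : θ ≤ 1)
    (ht : 0 ≤ t) : A (θ * t) ≤ ENNReal.ofReal θ * A t := by
  simpa [hA.1] using hA.2.1 t 0 θ ht le_rfl h0 h1

lemma IsYoung.mono {A : ℝ → ℝ≥0∞} (hA : IsYoung A) {a b : ℝ} (h0 : 0 ≤ a) (hab : a ≤ b) :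
    A a ≤ A b := by
  rcases eq_or_lt_of_le (h0.trans hab) with hb | hb
  · have : a = b := by linarith
    rw [this]
  · have h1 : a / b ≤ 1 := (div_le_one hb).2 hab
    calc A a = A (a / b * b) := by rw [div_mul_cancel₀ _ hb.ne']
      _ ≤ ENNReal.ofReal (a / b) * A b := hA.mul_le (by positivity) h1 hb.le
      _ ≤ 1 * A b := by gcongr; simpa using h1
      _ = A b := one_mul _

lemma IsYoung.exists_pos_ne_top {A : ℝ → ℝ≥0∞} (hA : IsYoung A) : ∃ t, 0 < t ∧ A t ≠ ⊤ := by
  obtain ⟨t₁, t₂, h₁, h₂, hne⟩ := hA.2.2.2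
  by_contra! h
  exact hne ((h t₁ h₁).trans (h t₂ h₂).symm)

lemma IsYoung.sum_le {A : ℝ → ℝ≥0∞} (hA : IsYoung A) {ι : Type*} (J : Finset ι) (a : ι → ℝ)
    (ha : ∀ i, 0 ≤ a i) (w : ι → ℝ) (hw : ∀ i, 0 ≤ w i) (hsum : ∑ i ∈ J, w i ≤ 1) :
    A (∑ i ∈ J, w i * a i) ≤ ∑ i ∈ J, ENNReal.ofReal (w i) * A (a i) := by
  classical
  induction J using Finset.induction_on generalizing w with
  | empty => simp [hA.1]
  | insert k J hk ih =>
    rw [Finset.sum_insert hk] at hsum ⊢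
    rw [Finset.sum_insert hk]
    have hS : 0 ≤ ∑ i ∈ J, w i := Finset.sum_nonneg fun i _ => hw i
    rcases eq_or_lt_of_le (show w k ≤ 1 by linarith) with h1 | h1
    · have hz : ∀ i ∈ J, w i = 0 :=
        (Finset.sum_eq_zero_iff_of_nonneg fun i _ => hw i).1 (by linarith)
      rw [Finset.sum_congr rfl fun i hi => by rw [hz i hi, zero_mul], h1]
      simp
    · have hpos : 0 < 1 - w k := by linarith
      have hw' : ∀ i, 0 ≤ w i / (1 - w k) := fun i => div_nonneg (hw i) hpos.le
      have key := ih (fun i => w i / (1 - w k)) hw' (by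
        rw [← Finset.sum_div, div_le_one hpos]; linarith)
      have hsplit : ∑ i ∈ J, w i * a i = (1 - w k) * ∑ i ∈ J, w i / (1 - w k) * a i := by
        rw [Finset.mul_sum]
        refine Finset.sum_congr rfl fun i _ => ?_
        field_simp
      rw [hsplit]
      refine (hA.2.1 (a k) _ (w k) (ha k)
        (Finset.sum_nonneg fun i _ => mul_nonneg (hw' i) (ha i)) (hw k) h1.le).trans ?_
      gcongr
      refine (mul_le_mul_right key _).trans (le_of_eq ?_)
      rw [Finset.mul_sum]
      refine Finset.sum_congr rfl fun i _ => ?_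
      rw [← mul_assoc, ← ENNReal.ofReal_mul hpos.le, mul_div_cancel₀ _ hpos.ne']

lemma youngConj_mono (A : ℝ → ℝ≥0∞) : Monotone (youngConj A) := by
  intro s t h
  refine iSup₂_mono fun τ hτ => ?_
  gcongr

lemma ofReal_mul_le_add_youngConj (A : ℝ → ℝ≥0∞) {τ : ℝ} (hτ : 0 ≤ τ) (t : ℝ) :
    ENNReal.ofReal (τ * t) ≤ A τ + youngConj A t := by
  rw [add_comm]
  exact tsub_le_iff_right.1 (le_iSup₂_of_le (f := fun (τ : ℝ) (_ : 0 ≤ τ) =>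
    ENNReal.ofReal (τ * t) - A τ) τ hτ le_rfl)

/-! ### The function `F` and dyadic sums -/

/-- The function `t ^ α ∫₀ᵗ Ã(τ) τ ^ (-1 - α) dτ`. -/
noncomputable def youngF (α : ℝ) (A : ℝ → ℝ≥0∞) (t : ℝ) : ℝ≥0∞ :=
  ENNReal.ofReal (t ^ α) *
    ∫⁻ τ in Set.Ioc (0 : ℝ) t, youngConj A τ * ENNReal.ofReal (τ ^ (-1 - α))

lemma youngF_mono {α : ℝ} (hα : 0 ≤ α) (A : ℝ → ℝ≥0∞) {a b : ℝ} (ha : 0 ≤ a) (hab : a ≤ b) :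
    youngF α A a ≤ youngF α A b := by
  unfold youngF
  gcongr

lemma iUnion_Ioc_geometric {q T : ℝ} (hq0 : 0 < q) (hq1 : q < 1) (hT : 0 < T) :
    (⋃ j : ℕ, Ioc (T * q ^ (j + 1)) (T * q ^ j)) = Ioc 0 T := by
  ext x
  simp only [mem_iUnion, mem_Ioc]
  constructor
  · rintro ⟨j, h1, h2⟩
    refine ⟨lt_trans (by positivity) h1, h2.trans ?_⟩
    have := pow_le_one₀ (n := j) hq0.le hq1.le
    nlinarith
  · rintro ⟨h1, h2⟩
    obtain ⟨j, hj1, hj2⟩ := exists_nat_pow_near_of_lt_one (x := x / T) (by positivity)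
      ((div_le_one hT).2 h2) hq0 hq1
    refine ⟨j, ?_, ?_⟩
    · rwa [lt_div_iff₀ hT, mul_comm] at hj1
    · rwa [div_le_iff₀ hT, mul_comm] at hj2

lemma geometric_rpow_identity {q p α T : ℝ} (hq0 : 0 < q) (hT : 0 < T) (hp : p = q ^ (-α)) (j : ℕ) :
    T ^ α * (T * q ^ j) ^ (-1 - α) = p ^ j * (T * q ^ j)⁻¹ := by
  have hqj : (0 : ℝ) < q ^ j := by positivity
  have h1 : (T * q ^ j) ^ (-1 - α) = T ^ (-α) * p ^ j * (T * q ^ j)⁻¹ := by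
    rw [sub_eq_add_neg, add_comm, Real.rpow_add (by positivity), Real.rpow_neg_one,
      Real.mul_rpow hT.le hqj.le, hp, ← Real.rpow_natCast, ← Real.rpow_natCast, ← Real.rpow_mul hq0.le,
      ← Real.rpow_mul hq0.le, mul_comm (-α)]
  rw [h1, ← mul_assoc, ← mul_assoc, ← Real.rpow_add hT]
  simp

lemma tsum_le_youngF {q p α : ℝ} (hq0 : 0 < q) (hq1 : q < 1) (hα : 0 ≤ α) (hp : p = q ^ (-α))
    (A : ℝ → ℝ≥0∞) {T : ℝ} (hT : 0 < T) :
    ENNReal.ofReal ((1 - q) / p) *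
      ∑' j : ℕ, ENNReal.ofReal (p ^ (j + 1)) * youngConj A (T * q ^ (j + 1)) ≤ youngF α A T := by
  have hp0 : 0 < p := hp ▸ Real.rpow_pos_of_pos hq0 _
  have hanti : Antitone fun j : ℕ => T * q ^ j := fun i j hij =>
    mul_le_mul_of_nonneg_left (pow_le_pow_of_le_one hq0.le hq1.le hij) hT.le
  rw [youngF, ← iUnion_Ioc_geometric hq0 hq1 hT,
    lintegral_iUnion (fun _ => measurableSet_Ioc) (by simpa using hanti.pairwise_disjoint_on_Ioc_succ),
    ← ENNReal.tsum_mul_left, ← ENNReal.tsum_mul_left]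
  refine ENNReal.tsum_le_tsum fun j => ?_
  have hqj : (0 : ℝ) < q ^ j := by positivity
  have hlow : ∫⁻ τ in Ioc (T * q ^ (j + 1)) (T * q ^ j),
      youngConj A (T * q ^ (j + 1)) * ENNReal.ofReal ((T * q ^ j) ^ (-1 - α)) ≤
      ∫⁻ τ in Ioc (T * q ^ (j + 1)) (T * q ^ j),
        youngConj A τ * ENNReal.ofReal (τ ^ (-1 - α)) := by
    refine setLIntegral_mono' measurableSet_Ioc fun τ hτ => ?_
    have h0 : 0 < τ := lt_trans (by positivity) hτ.1
    refine mul_le_mul' (youngConj_mono A hτ.1.le) (ENNReal.ofReal_le_ofReal ?_)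
    exact Real.rpow_le_rpow_of_nonpos h0 hτ.2 (by linarith)
  refine le_trans (le_of_eq ?_) (mul_le_mul_right hlow _)
  rw [setLIntegral_const, Real.volume_Ioc]
  have : (1 - q) / p * p ^ (j + 1) =
      T ^ α * (T * q ^ j) ^ (-1 - α) * (T * q ^ j - T * q ^ (j + 1)) := by
    rw [geometric_rpow_identity hq0 hT hp]
    field_simp
    ring
  calc _ = ENNReal.ofReal ((1 - q) / p * p ^ (j + 1)) * youngConj A (T * q ^ (j + 1)) := by
        rw [ENNReal.ofReal_mul (div_nonneg (by linarith) hp0.le), mul_assoc]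
    _ = _ := by
        rw [this, ENNReal.ofReal_mul (by positivity), ENNReal.ofReal_mul (by positivity)]
        ring

lemma youngF_le_tsum {q p α : ℝ} (hq0 : 0 < q) (hq1 : q < 1) (hα : 0 ≤ α) (hp : p = q ^ (-α))
    (A : ℝ → ℝ≥0∞) {T : ℝ} (hT : 0 < T) :
    youngF α A T ≤ ENNReal.ofReal (p * (1 - q) / q) *
      ∑' j : ℕ, ENNReal.ofReal (p ^ j) * youngConj A (T * q ^ j) := by
  have hp0 : 0 < p := hp ▸ Real.rpow_pos_of_pos hq0 _
  rw [youngF, ← iUnion_Ioc_geometric hq0 hq1 hT, ← ENNReal.tsum_mul_left]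
  refine (mul_le_mul_right (lintegral_iUnion_le _ _) _).trans ?_
  rw [← ENNReal.tsum_mul_left]
  refine ENNReal.tsum_le_tsum fun j => ?_
  have hqj : (0 : ℝ) < q ^ j := by positivity
  have hup : ∫⁻ τ in Ioc (T * q ^ (j + 1)) (T * q ^ j),
        youngConj A τ * ENNReal.ofReal (τ ^ (-1 - α)) ≤
      ∫⁻ τ in Ioc (T * q ^ (j + 1)) (T * q ^ j),
      youngConj A (T * q ^ j) * ENNReal.ofReal ((T * q ^ (j + 1)) ^ (-1 - α)) := by
    refine setLIntegral_mono' measurableSet_Ioc fun τ hτ => ?_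
    refine mul_le_mul' (youngConj_mono A hτ.2) (ENNReal.ofReal_le_ofReal ?_)
    exact Real.rpow_le_rpow_of_nonpos (by positivity) hτ.1.le (by linarith)
  refine (mul_le_mul_right hup _).trans (le_of_eq ?_)
  rw [setLIntegral_const, Real.volume_Ioc]
  have : p * (1 - q) / q * p ^ j =
      T ^ α * (T * q ^ (j + 1)) ^ (-1 - α) * (T * q ^ j - T * q ^ (j + 1)) := by
    rw [geometric_rpow_identity hq0 hT hp]
    field_simp
    ring
  calc _ = ENNReal.ofReal (p * (1 - q) / q * p ^ j) * youngConj A (T * q ^ j) := by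
        rw [this, ENNReal.ofReal_mul (by positivity), ENNReal.ofReal_mul (by positivity)]
        ring
    _ = _ := by
        rw [ENNReal.ofReal_mul (div_nonneg (mul_nonneg hp0.le (by linarith)) hq0.le), mul_assoc]

/-! ### Geometric sums cut off at height one -/

lemma sum_geometric_cutoff_le {q : ℝ} (hq0 : 0 < q) (hq1 : q < 1) (N : ℕ) {b : ℝ} (hb : 0 ≤ b) :
    ∑ j ∈ Finset.range N, (if q ^ j * b ≤ 1 then q ^ j * b else 0) ≤ min 1 b * (1 - q)⁻¹ := by
  have hq : 0 < 1 - q := by linarith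
  induction N generalizing b with
  | zero => simp only [Finset.range_zero, Finset.sum_empty]; positivity
  | succ N ih =>
    rw [Finset.sum_range_succ']
    have h := ih (b := q * b) (by positivity)
    have e : ∀ j, q ^ (j + 1) * b = q ^ j * (q * b) := fun j => by ring
    simp only [e, pow_zero, one_mul]
    split_ifs with h1
    · rw [min_eq_right h1]
      have h2 : min 1 (q * b) * (1 - q)⁻¹ ≤ q * b * (1 - q)⁻¹ := by
        gcongr; exact min_le_right _ _
      have h3 : q * b * (1 - q)⁻¹ + b = b * (1 - q)⁻¹ := by field_simp; ring
      linarith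
    · rw [min_eq_left (not_le.1 h1).le, add_zero]
      refine h.trans ?_
      gcongr
      exact min_le_left _ _

lemma sum_geometric_cutoff_le' {p : ℝ} (hp : 1 < p) (N : ℕ) {b : ℝ} (hb : 0 ≤ b) :
    ∑ j ∈ Finset.range N, (if p ^ j * b ≤ 1 then p ^ j * b else 0) ≤ (1 - p⁻¹)⁻¹ := by
  have hp0 : 0 < p := by linarith
  have hp1 : p⁻¹ < 1 := inv_lt_one_of_one_lt₀ hp
  rw [← Finset.sum_range_reflect]
  refine le_trans (le_of_eq (Finset.sum_congr rfl fun j hj => ?_))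
    ((sum_geometric_cutoff_le (inv_pos.2 hp0) hp1 N (b := p ^ (N - 1) * b) (by positivity)).trans ?_)
  · have hj' : j ≤ N - 1 := by have := Finset.mem_range.1 hj; omega
    have : p ^ (N - 1 - j) * b = p⁻¹ ^ j * (p ^ (N - 1) * b) := by
      rw [pow_sub₀ _ hp0.ne' hj', inv_pow]; ring
    rw [this]
  · have : 0 < 1 - p⁻¹ := by linarith
    calc _ ≤ 1 * (1 - p⁻¹)⁻¹ := by gcongr; exact min_le_left _ _
      _ = _ := one_mul _

/-! ### Behaviour of `F` near zero and at infinity -/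

lemma IsYoung.pos_of_lintegral_lt_top {A : ℝ → ℝ≥0∞} (hA : IsYoung A) {θ ε : ℝ} (hθ : 0 < θ)
    (hε : 0 < ε) (h : ∫⁻ t in Ioc (0 : ℝ) ε, (ENNReal.ofReal t / A t) ^ θ < ⊤) {t : ℝ}
    (ht : 0 < t) : A t ≠ 0 := by
  intro h0
  refine h.ne (top_le_iff.1 ?_)
  have hm : 0 < min t ε := lt_min ht hε
  calc (⊤ : ℝ≥0∞) = ∫⁻ _ in Ioc (0 : ℝ) (min t ε), (⊤ : ℝ≥0∞) := by
        rw [setLIntegral_const, Real.volume_Ioc, ENNReal.top_mul]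
        simpa using hm
    _ ≤ ∫⁻ u in Ioc (0 : ℝ) (min t ε), (ENNReal.ofReal u / A u) ^ θ := by
        refine setLIntegral_mono' measurableSet_Ioc fun u hu => ?_
        have hA0 : A u = 0 := le_antisymm
          ((hA.mono hu.1.le (hu.2.trans (min_le_left _ _))).trans h0.le) bot_le
        rw [hA0, ENNReal.div_zero (by simpa using hu.1), ENNReal.top_rpow_of_pos hθ]
    _ ≤ _ := lintegral_mono_set (Ioc_subset_Ioc_right (min_le_right _ _))

lemma IsYoung.youngConj_le {A : ℝ → ℝ≥0∞} (hA : IsYoung A) {ε τ : ℝ} (hε : 0 < ε) (hτ : 0 < τ)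
    (hτε : ENNReal.ofReal (τ * ε) ≤ A ε) :
    youngConj A τ ≤ ENNReal.ofReal τ *
      ∫⁻ t in Ioc (0 : ℝ) ε, {t | A (max t 0) < ENNReal.ofReal (τ * t)}.indicator 1 t := by
  refine iSup₂_le fun t ht => ?_
  rcases le_or_gt (ENNReal.ofReal (t * τ)) (A t) with h | h
  · rw [tsub_eq_zero_of_le h]; exact bot_le
  have ht0 : 0 < t := by
    rcases eq_or_lt_of_le ht with h' | h'
    · simp [← h'] at h
    · exact h'
  have hlt : ∀ u, 0 < u → u ≤ t → A u < ENNReal.ofReal (τ * u) := by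
    intro u hu hut
    calc A u = A (u / t * t) := by rw [div_mul_cancel₀ _ ht0.ne']
      _ ≤ ENNReal.ofReal (u / t) * A t := hA.mul_le (by positivity) ((div_le_one ht0).2 hut) ht
      _ < ENNReal.ofReal (u / t) * ENNReal.ofReal (t * τ) :=
          ENNReal.mul_lt_mul_right (by simp; positivity) ENNReal.ofReal_ne_top h
      _ = ENNReal.ofReal (τ * u) := by
          rw [← ENNReal.ofReal_mul (by positivity)]
          congr 1
          field_simp
  have htε : t ≤ ε := by
    by_contra! hc
    exact (hlt ε hε hc.le).not_ge hτε
  calc ENNReal.ofReal (t * τ) - A t ≤ ENNReal.ofReal (t * τ) := tsub_le_self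
    _ = ENNReal.ofReal τ * ∫⁻ _ in Ioc (0 : ℝ) t, 1 := by
        rw [setLIntegral_const, Real.volume_Ioc, ENNReal.ofReal_mul ht, mul_comm]; simp
    _ ≤ ENNReal.ofReal τ *
        ∫⁻ u in Ioc (0 : ℝ) t, {t | A (max t 0) < ENNReal.ofReal (τ * t)}.indicator 1 u := by
        refine mul_le_mul_right (setLIntegral_mono' measurableSet_Ioc fun u hu => ?_) _
        rw [indicator_of_mem]
        · rfl
        · simpa [max_eq_left hu.1.le] using hlt u hu.1 hu.2
    _ ≤ _ := by
        gcongr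

lemma IsYoung.measurable_max {A : ℝ → ℝ≥0∞} (hA : IsYoung A) :
    Measurable fun t => A (max t 0) := by
  refine Monotone.measurable fun a b hab => hA.mono (le_max_right _ _) (max_le_max_right _ hab)

lemma lintegral_Ioi_rpow {θ a : ℝ} (hθ : 0 < θ) (ha : 0 < a) :
    ∫⁻ τ in Ioi a, ENNReal.ofReal (τ ^ (-1 - θ)) = ENNReal.ofReal (a ^ (-θ) / θ) := by
  rw [← ofReal_integral_eq_lintegral_ofReal (integrableOn_Ioi_rpow_of_lt (by linarith) ha)]
  · rw [integral_Ioi_rpow_of_lt (by linarith) ha]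
    congr 1
    rw [show -1 - θ + 1 = -θ by ring]
    field_simp
  · exact (ae_restrict_mem measurableSet_Ioi).mono fun x hx => Real.rpow_nonneg (ha.trans hx).le _

lemma IsYoung.exists_lintegral_youngConj_lt_top {A : ℝ → ℝ≥0∞} (hA : IsYoung A) {θ : ℝ}
    (hθ : 0 < θ)
    (h : ∃ ε : ℝ, 0 < ε ∧ ∫⁻ t in Ioc (0 : ℝ) ε, (ENNReal.ofReal t / A t) ^ θ < ⊤) :
    ∃ ε : ℝ, 0 < ε ∧
      ∫⁻ τ in Ioc (0 : ℝ) ε, youngConj A τ * ENNReal.ofReal (τ ^ (-1 - (1 + θ))) < ⊤ := by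
  obtain ⟨ε₀, hε₀, hint⟩ := h
  obtain ⟨t₀, ht₀, hAt₀⟩ := hA.exists_pos_ne_top
  set ε := min ε₀ t₀ with hεdef
  have hε : 0 < ε := lt_min hε₀ ht₀
  have hfin : ∀ t, 0 < t → t ≤ ε → A t ≠ ⊤ := fun t h0 h1 =>
    ne_top_of_le_ne_top hAt₀ (hA.mono h0.le (h1.trans (min_le_right _ _)))
  have hpos : ∀ t, 0 < t → A t ≠ 0 := fun t ht => hA.pos_of_lintegral_lt_top hθ hε₀ hint ht
  have hAε : 0 < (A ε).toReal := ENNReal.toReal_pos (hpos ε hε) (hfin ε hε le_rfl)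
  set b := (A ε).toReal / ε with hb
  have hb0 : 0 < b := by positivity
  refine ⟨b, hb0, ?_⟩
  set S : Set (ℝ × ℝ) := {z | A (max z.2 0) < ENNReal.ofReal (z.1 * z.2)} with hS
  have hSm : MeasurableSet S := measurableSet_lt (hA.measurable_max.comp measurable_snd)
    (measurable_fst.mul measurable_snd).ennreal_ofReal
  have hw : Measurable fun τ : ℝ => ENNReal.ofReal (τ ^ (-1 - θ)) := by fun_prop
  calc ∫⁻ τ in Ioc (0 : ℝ) b, youngConj A τ * ENNReal.ofReal (τ ^ (-1 - (1 + θ)))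
      ≤ ∫⁻ τ in Ioc (0 : ℝ) b, ∫⁻ t in Ioc (0 : ℝ) ε,
          S.indicator (fun z => ENNReal.ofReal (z.1 ^ (-1 - θ))) (τ, t) := by
        refine setLIntegral_mono' measurableSet_Ioc fun τ hτ => ?_
        have h1 : ENNReal.ofReal (τ * ε) ≤ A ε := by
          refine ENNReal.ofReal_le_of_le_toReal ?_
          have := (le_div_iff₀ hε).1 hτ.2
          exact this
        refine (mul_le_mul_left (hA.youngConj_le hε hτ.1 h1) _).trans (le_of_eq ?_)
        rw [mul_right_comm, ← ENNReal.ofReal_mul hτ.1.le, ← lintegral_const_mul']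
        · refine lintegral_congr fun t => ?_
          have e : τ * τ ^ (-1 - (1 + θ)) = τ ^ (-1 - θ) := by
            rw [← Real.rpow_one_add' hτ.1.le (by linarith)]
            congr 1; ring
          rw [e]
          by_cases ht : A (max t 0) < ENNReal.ofReal (τ * t)
          · rw [indicator_of_mem (by exact ht), indicator_of_mem (by exact ht)]; simp
          · rw [indicator_of_notMem (by exact ht), indicator_of_notMem (by exact ht)]; simp
        · exact ENNReal.ofReal_ne_top
    _ = ∫⁻ t in Ioc (0 : ℝ) ε, ∫⁻ τ in Ioc (0 : ℝ) b,
          S.indicator (fun z => ENNReal.ofReal (z.1 ^ (-1 - θ))) (τ, t) := by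
        refine lintegral_lintegral_swap ?_
        exact ((hw.comp measurable_fst).indicator hSm).aemeasurable
    _ ≤ ∫⁻ t in Ioc (0 : ℝ) ε, ENNReal.ofReal θ⁻¹ * (ENNReal.ofReal t / A t) ^ θ := by
        refine setLIntegral_mono' measurableSet_Ioc fun t ht => ?_
        have hA0 := ENNReal.toReal_pos (hpos t ht.1) (hfin t ht.1 ht.2)
        set a := (A t).toReal / t with ha
        have ha0 : 0 < a := div_pos hA0 ht.1
        have hval : (ENNReal.ofReal t / A t) ^ θ = ENNReal.ofReal (a ^ (-θ)) := by
          rw [← ENNReal.ofReal_toReal (hfin t ht.1 ht.2), ← ENNReal.ofReal_div_of_pos hA0,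
            ENNReal.ofReal_rpow_of_pos (div_pos ht.1 hA0), ← inv_div, Real.inv_rpow ha0.le,
            Real.rpow_neg ha0.le]
        rw [hval, ← ENNReal.ofReal_mul (by positivity),
          show θ⁻¹ * a ^ (-θ) = a ^ (-θ) / θ by ring, ← lintegral_Ioi_rpow hθ ha0,
          ← lintegral_indicator measurableSet_Ioi]
        refine (lintegral_mono fun τ => ?_).trans (setLIntegral_le_lintegral _ _)
        by_cases hτ : (τ, t) ∈ S
        · have : a < τ := by
            have h2 : A t < ENNReal.ofReal (τ * t) := by simpa [hS, max_eq_left ht.1.le] using hτ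
            rw [ha, div_lt_iff₀ ht.1]
            exact ((ENNReal.lt_ofReal_iff_toReal_lt (hfin t ht.1 ht.2)).1 h2)
          rw [indicator_of_mem hτ, indicator_of_mem (by exact this)]
        · rw [indicator_of_notMem hτ]; exact bot_le
    _ = ENNReal.ofReal θ⁻¹ * ∫⁻ t in Ioc (0 : ℝ) ε, (ENNReal.ofReal t / A t) ^ θ :=
        lintegral_const_mul' _ _ ENNReal.ofReal_ne_top
    _ < ⊤ := by
        refine ENNReal.mul_lt_top ENNReal.ofReal_lt_top (lt_of_le_of_lt ?_ hint)
        exact lintegral_mono_set (Ioc_subset_Ioc_right (min_le_left _ _))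

lemma IsYoung.exists_lt_youngF {A : ℝ → ℝ≥0∞} (hA : IsYoung A) {α : ℝ} (hα : 0 ≤ α)
    {v : ℝ≥0∞} (hv : v ≠ ⊤) : ∃ T, 0 < T ∧ v < youngF α A T := by
  obtain ⟨τ, hτ, hAτ⟩ := hA.exists_pos_ne_top
  set p : ℝ := (1 / 2 : ℝ) ^ (-α)
  set T : ℝ := ((A τ).toReal + 2 * (v.toReal + 1)) * 2 / τ with hTdef
  have hT : 0 < T := by positivity
  refine ⟨T, hT, ?_⟩
  have hp : 0 < p := by positivity
  have h := tsum_le_youngF (q := 1 / 2) (p := p) (by norm_num) (by norm_num) hα rfl A hT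
  refine lt_of_lt_of_le ?_ ((mul_le_mul_right (ENNReal.le_tsum 0) _).trans h)
  have hconj : ENNReal.ofReal (2 * (v.toReal + 1)) ≤ youngConj A (T * (1 / 2) ^ (0 + 1)) := by
    refine le_iSup₂_of_le τ hτ.le ?_
    rw [← ENNReal.ofReal_toReal hAτ, ← ENNReal.ofReal_sub _ ENNReal.toReal_nonneg]
    apply le_of_eq
    congr 1
    rw [hTdef]
    field_simp
    ring
  refine lt_of_lt_of_le ?_ (mul_le_mul_right (mul_le_mul_right hconj _) _)
  rw [← ENNReal.ofReal_mul (by positivity), ← ENNReal.ofReal_mul (by positivity),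
    ENNReal.lt_ofReal_iff_toReal_lt hv]
  have : (1 - 1 / 2) / p * (p ^ (0 + 1) * (2 * (v.toReal + 1))) = v.toReal + 1 := by
    field_simp; ring
  linarith

/-- The right-continuous inverse of `F` at a positive finite level is positive, and `F` crosses the
level between half and twice its value. -/
lemma IsYoung.rcInv_youngF {A : ℝ → ℝ≥0∞} (hA : IsYoung A) {α : ℝ} (hα : 0 < α)
    (hfin : ∃ ε : ℝ, 0 < ε ∧
      ∫⁻ τ in Ioc (0 : ℝ) ε, youngConj A τ * ENNReal.ofReal (τ ^ (-1 - α)) < ⊤)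
    {v : ℝ≥0∞} (hv0 : v ≠ 0) (hv : v ≠ ⊤) :
    0 < rcInv (youngF α A) v ∧ youngF α A (rcInv (youngF α A) v / 2) ≤ v ∧
      v < youngF α A (2 * rcInv (youngF α A) v) := by
  obtain ⟨T, hT, hvT⟩ := hA.exists_lt_youngF hα.le hv
  have hne : {τ : ℝ | 0 ≤ τ ∧ v < youngF α A τ}.Nonempty := ⟨T, hT.le, hvT⟩
  have hbdd : BddBelow {τ : ℝ | 0 ≤ τ ∧ v < youngF α A τ} := ⟨0, fun τ hτ => hτ.1⟩
  have hpos : 0 < rcInv (youngF α A) v := by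
    obtain ⟨ε, hε, hK⟩ := hfin
    set K := ∫⁻ τ in Ioc (0 : ℝ) ε, youngConj A τ * ENNReal.ofReal (τ ^ (-1 - α))
    set δ := min ε ((v.toReal / (K.toReal + 1)) ^ α⁻¹) with hδ
    have hv' : 0 < v.toReal := ENNReal.toReal_pos hv0 hv
    have hK0 : 0 ≤ K.toReal := ENNReal.toReal_nonneg
    have hδ0 : 0 < δ := lt_min hε (by positivity)
    refine lt_of_lt_of_le hδ0 (le_csInf hne fun τ hτ => ?_)
    by_contra! hlt
    refine hτ.2.not_ge ((youngF_mono hα.le A hτ.1 hlt.le).trans ?_)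
    have h1 : δ ^ α ≤ v.toReal / (K.toReal + 1) := by
      calc δ ^ α ≤ ((v.toReal / (K.toReal + 1)) ^ α⁻¹) ^ α := by
            gcongr; exact min_le_right _ _
        _ = _ := Real.rpow_inv_rpow (by positivity) hα.ne'
    calc youngF α A δ ≤ ENNReal.ofReal (v.toReal / (K.toReal + 1)) * K := by
          refine mul_le_mul' (ENNReal.ofReal_le_ofReal h1) (lintegral_mono_set ?_)
          exact Ioc_subset_Ioc_right (min_le_left _ _)
      _ = ENNReal.ofReal (v.toReal / (K.toReal + 1) * K.toReal) := by
          rw [ENNReal.ofReal_mul (by positivity), ENNReal.ofReal_toReal hK.ne]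
      _ ≤ v := by
          refine ENNReal.ofReal_le_of_le_toReal ?_
          rw [div_mul_eq_mul_div, div_le_iff₀ (by positivity)]
          nlinarith
  refine ⟨hpos, ?_, ?_⟩
  · by_contra! h
    have : rcInv (youngF α A) v ≤ rcInv (youngF α A) v / 2 :=
      csInf_le hbdd ⟨by positivity, h⟩
    linarith
  · obtain ⟨τ, hτ, hτlt⟩ := exists_lt_of_csInf_lt hne
      (show rcInv (youngF α A) v < 2 * rcInv (youngF α A) v by linarith)
    exact hτ.2.trans_le (youngF_mono hα.le A hτ.1 hτlt.le)

section

/-! ### A Poincaré inequality for weakly differentiable functions -/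

/-- The functions `g i` are the weak first-order partial derivatives of `f`. -/
def HasWeakGrad {n : ℕ} (f : Euc n → ℝ) (g : Fin n → Euc n → ℝ) : Prop :=
  LocallyIntegrable f volume ∧ (∀ i, LocallyIntegrable (g i) volume) ∧
  ∀ φ : Euc n → ℝ, ContDiff ℝ (⊤ : ℕ∞) φ → HasCompactSupport φ → ∀ i,
    ∫ x, f x * fderiv ℝ φ x (EuclideanSpace.single i 1) = -∫ x, g i x * φ x

lemma HasWeakDerivs.hasWeakGrad {n m : ℕ} {u : Euc n → ℝ}
    {D : (h : ℕ) → Euc n → (Fin h → Fin n) → ℝ} (hD : HasWeakDerivs n m u D) {h : ℕ} (hm : h < m)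
    (d : Fin h → Fin n) :
    HasWeakGrad (fun x => D h x d) fun i x => D (h + 1) x (Fin.snoc d i) := by
  refine ⟨(hD.2 h hm.le d).1, fun i => (hD.2 (h + 1) hm _).1, fun φ hφ hc i => ?_⟩
  have hdφ : ContDiff ℝ (⊤ : ℕ∞) fun x => fderiv ℝ φ x (EuclideanSpace.single i 1) :=
    (hφ.fderiv_right (m := (⊤ : ℕ∞)) (by simp)).clm_apply contDiff_const
  have h1 := (hD.2 h hm.le d).2 _ hdφ (hc.fderiv_apply (𝕜 := ℝ) _)
  have h2 := (hD.2 (h + 1) hm (Fin.snoc d i)).2 φ hφ hc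
  have h3 : ∀ x, iteratedFDeriv ℝ h (fun x => fderiv ℝ φ x (EuclideanSpace.single i 1)) x
        (fun j => EuclideanSpace.single (d j) (1 : ℝ)) =
      iteratedFDeriv ℝ (h + 1) φ x
        (fun j => EuclideanSpace.single (Fin.snoc (α := fun _ => Fin n) d i j) (1 : ℝ)) := by
    intro x
    rw [iteratedFDeriv_succ_apply_right]
    have e : (fun x => fderiv ℝ φ x (EuclideanSpace.single i 1)) =
        (ContinuousLinearMap.apply ℝ ℝ (EuclideanSpace.single i (1 : ℝ))) ∘ fderiv ℝ φ := rfl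
    rw [e, ContinuousLinearMap.iteratedFDeriv_comp_left _
      (hφ.fderiv_right (m := (⊤ : ℕ∞)) (by simp)).contDiffAt (by exact_mod_cast le_top)]
    simp [Fin.init_def]
  simp only [h3] at h1
  rw [h2, pow_succ] at h1
  have hne : ((-1 : ℝ) ^ h) ≠ 0 := by positivity
  have h4 : (-1 : ℝ) ^ h * (∫ x, D h x d * fderiv ℝ φ x (EuclideanSpace.single i 1)) =
      (-1 : ℝ) ^ h * (-∫ x, D (h + 1) x (Fin.snoc d i) * φ x) := by
    rw [← h1]; ring
  exact mul_left_cancel₀ hne h4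

lemma lintegral_translate_sub_le {n : ℕ} {f : Euc n → ℝ} (hf : ContDiff ℝ 1 f) (a : Euc n) (r : ℝ)
    (h : Euc n) :
    ∫⁻ x in ball a r, ‖f (x + h) - f x‖ₑ ≤
      ‖h‖ₑ * ∫⁻ x in ball a (r + ‖h‖), ‖fderiv ℝ f x‖ₑ := by
  have hc : Continuous (fderiv ℝ f) := hf.continuous_fderiv (by simp)
  have hpt : ∀ x, ‖f (x + h) - f x‖ₑ ≤ ∫⁻ t in Ioc (0 : ℝ) 1, ‖fderiv ℝ f (x + t • h)‖ₑ * ‖h‖ₑ := by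
    intro x
    have hd : ∀ t ∈ uIcc (0 : ℝ) 1,
        HasDerivAt (fun t : ℝ => f (x + t • h)) (fderiv ℝ f (x + t • h) h) t := by
      intro t _
      have h1 : HasDerivAt (fun t : ℝ => x + t • h) h t := by
        simpa using ((hasDerivAt_id t).smul_const h).const_add x
      exact ((hf.differentiable (by simp)) _).hasFDerivAt.comp_hasDerivAt t h1
    have hcont : Continuous fun t : ℝ => fderiv ℝ f (x + t • h) h :=
      (hc.comp (by fun_prop)).clm_apply continuous_const
    have := intervalIntegral.integral_eq_sub_of_hasDerivAt hd (hcont.intervalIntegrable _ _)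
    simp only [one_smul, zero_smul, add_zero] at this
    rw [← this, intervalIntegral.integral_of_le zero_le_one]
    refine (enorm_integral_le_lintegral_enorm _).trans (lintegral_mono fun t => ?_)
    exact ContinuousLinearMap.le_opENorm _ _
  calc ∫⁻ x in ball a r, ‖f (x + h) - f x‖ₑ
      ≤ ∫⁻ x in ball a r, ∫⁻ t in Ioc (0 : ℝ) 1, ‖fderiv ℝ f (x + t • h)‖ₑ * ‖h‖ₑ :=
        lintegral_mono hpt
    _ = ∫⁻ t in Ioc (0 : ℝ) 1, ∫⁻ x in ball a r, ‖fderiv ℝ f (x + t • h)‖ₑ * ‖h‖ₑ := by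
        refine lintegral_lintegral_swap (Continuous.aemeasurable ?_)
        have : Continuous fun z : Euc n × ℝ => fderiv ℝ f (z.1 + z.2 • h) := hc.comp (by fun_prop)
        exact (ENNReal.continuous_mul_const (by simp)).comp this.enorm
    _ ≤ ∫⁻ t in Ioc (0 : ℝ) 1, ‖h‖ₑ * ∫⁻ x in ball a (r + ‖h‖), ‖fderiv ℝ f x‖ₑ := by
        refine setLIntegral_mono' measurableSet_Ioc fun t ht => ?_
        rw [lintegral_mul_const' _ _ (by simp), mul_comm]
        refine mul_le_mul_right ?_ _
        rw [← lintegral_indicator measurableSet_ball, ← lintegral_indicator measurableSet_ball]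
        rw [← lintegral_add_right_eq_self (μ := volume)
          ((ball a (r + ‖h‖)).indicator fun x => ‖fderiv ℝ f x‖ₑ) (t • h)]
        refine lintegral_mono fun x => ?_
        by_cases hx : x ∈ ball a r
        · have : x + t • h ∈ ball a (r + ‖h‖) := by
            rw [mem_ball, dist_eq_norm] at hx ⊢
            have h2 : ‖t • h‖ ≤ ‖h‖ := by
              rw [norm_smul, Real.norm_of_nonneg ht.1.le]
              exact mul_le_of_le_one_left (norm_nonneg _) ht.2
            calc ‖x + t • h - a‖ = ‖(x - a) + t • h‖ := by congr 1; abel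
              _ ≤ ‖x - a‖ + ‖t • h‖ := norm_add_le _ _
              _ < _ := by linarith
          rw [indicator_of_mem hx, indicator_of_mem this]
        · rw [indicator_of_notMem hx]; exact bot_le
    _ = _ := by simp

lemma lintegral_lintegral_sub_le_of_contDiff {n : ℕ} {f : Euc n → ℝ} (hf : ContDiff ℝ 1 f)
    (a : Euc n) (r : ℝ) :
    ∫⁻ x in ball a r, ∫⁻ y in ball a r, ‖f x - f y‖ₑ ≤
      volume (ball (0 : Euc n) (2 * r)) *
        (ENNReal.ofReal (2 * r) * ∫⁻ x in ball a (3 * r), ‖fderiv ℝ f x‖ₑ) := by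
  have hfc := hf.continuous
  calc ∫⁻ x in ball a r, ∫⁻ y in ball a r, ‖f x - f y‖ₑ
      ≤ ∫⁻ x in ball a r, ∫⁻ h in ball (0 : Euc n) (2 * r), ‖f (x + h) - f x‖ₑ := by
        refine setLIntegral_mono' measurableSet_ball fun x hx => ?_
        rw [← lintegral_indicator measurableSet_ball, ← lintegral_indicator measurableSet_ball,
          ← lintegral_add_left_eq_self (μ := volume) _ x]
        refine lintegral_mono fun h => ?_
        by_cases hh : x + h ∈ ball a r
        · have : h ∈ ball (0 : Euc n) (2 * r) := by
            rw [mem_ball_zero_iff]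
            rw [mem_ball, dist_eq_norm] at hx hh
            calc ‖h‖ = ‖(x + h - a) - (x - a)‖ := by congr 1; abel
              _ ≤ _ := norm_sub_le _ _
              _ < _ := by linarith
          rw [indicator_of_mem hh, indicator_of_mem this, ← enorm_neg, neg_sub]
        · rw [indicator_of_notMem hh]; exact bot_le
    _ = ∫⁻ h in ball (0 : Euc n) (2 * r), ∫⁻ x in ball a r, ‖f (x + h) - f x‖ₑ := by
        refine lintegral_lintegral_swap (Continuous.aemeasurable ?_)
        have : Continuous fun z : Euc n × Euc n => f (z.1 + z.2) - f z.1 := by fun_prop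
        exact this.enorm
    _ ≤ ∫⁻ h in ball (0 : Euc n) (2 * r),
          ENNReal.ofReal (2 * r) * ∫⁻ x in ball a (3 * r), ‖fderiv ℝ f x‖ₑ := by
        refine setLIntegral_mono' measurableSet_ball fun h hh => ?_
        rw [mem_ball_zero_iff] at hh
        refine (lintegral_translate_sub_le hf a r h).trans (mul_le_mul' ?_ ?_)
        · rw [← ofReal_norm]; exact ENNReal.ofReal_le_ofReal hh.le
        · exact lintegral_mono_set (ball_subset_ball (by linarith))
    _ = _ := by rw [setLIntegral_const, mul_comm]

open scoped Convolution

/-- Mollification of `f` by a bump function. -/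
noncomputable def mollify {n : ℕ} (ρ : ContDiffBump (0 : Euc n)) (f : Euc n → ℝ) : Euc n → ℝ :=
  (ρ.normed volume ⋆[ContinuousLinearMap.lsmul ℝ ℝ, volume] f)

lemma contDiff_mollify {n : ℕ} (ρ : ContDiffBump (0 : Euc n)) {f : Euc n → ℝ}
    (hf : LocallyIntegrable f volume) : ContDiff ℝ 1 (mollify ρ f) :=
  HasCompactSupport.contDiff_convolution_left (n := 1) _ ρ.hasCompactSupport_normed
    (ρ.contDiff_normed (n := 1)) hf

lemma fderiv_mollify {n : ℕ} (ρ : ContDiffBump (0 : Euc n)) {f : Euc n → ℝ}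
    {g : Fin n → Euc n → ℝ} (hfg : HasWeakGrad f g) (x : Euc n) (i : Fin n) :
    fderiv ℝ (mollify ρ f) x (EuclideanSpace.single i 1) = mollify ρ (g i) x := by
  have hρ1 : ContDiff ℝ 1 (ρ.normed (volume : Measure (Euc n))) := ρ.contDiff_normed (n := 1)
  have hρ : ContDiff ℝ (⊤ : ℕ∞) (ρ.normed (volume : Measure (Euc n))) := ρ.contDiff_normed
  have hρc : HasCompactSupport (ρ.normed (volume : Measure (Euc n))) := ρ.hasCompactSupport_normed
  unfold mollify
  rw [(hρc.hasFDerivAt_convolution_left (ContinuousLinearMap.lsmul ℝ ℝ) hρ1 hfg.1 x).fderiv]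
  have hint := (hρc.fderiv (𝕜 := ℝ)).convolutionExists_left
    ((ContinuousLinearMap.lsmul ℝ ℝ).precompL (Euc n)) (hρ1.continuous_fderiv (by simp)) hfg.1 x
  rw [convolution_def, ContinuousLinearMap.integral_apply hint]
  have hψ : ContDiff ℝ (⊤ : ℕ∞) fun y : Euc n => ρ.normed volume (x - y) :=
    hρ.comp (contDiff_const.sub contDiff_id)
  have hψc : HasCompactSupport fun y : Euc n => ρ.normed volume (x - y) :=
    hρc.comp_homeomorph (Homeomorph.subLeft x)
  have h := hfg.2.2 _ hψ hψc i
  have hd : ∀ y, fderiv ℝ (fun y : Euc n => ρ.normed volume (x - y)) y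
      (EuclideanSpace.single i 1) =
      -fderiv ℝ (ρ.normed volume) (x - y) (EuclideanSpace.single i 1) := by
    intro y
    have h1 : HasFDerivAt (fun y : Euc n => x - y) (-ContinuousLinearMap.id ℝ (Euc n)) y :=
      (hasFDerivAt_id y).const_sub x
    have h2 := ((hρ1.differentiable (by simp)) (x - y)).hasFDerivAt.comp y h1
    have h3 : fderiv ℝ (fun y : Euc n => ρ.normed volume (x - y)) y = _ := h2.fderiv
    rw [h3]; simp
  simp only [hd, mul_neg, integral_neg, neg_inj] at h
  rw [convolution_def]
  calc _ = ∫ t, f (x - t) * fderiv ℝ (ρ.normed volume) t (EuclideanSpace.single i 1) := by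
        refine integral_congr_ae (Eventually.of_forall fun t => ?_)
        simp [ContinuousLinearMap.precompL_apply, mul_comm]
    _ = ∫ y, f y * fderiv ℝ (ρ.normed volume) (x - y) (EuclideanSpace.single i 1) := by
        rw [← integral_sub_left_eq_self _ volume x]; simp
    _ = ∫ y, g i y * ρ.normed volume (x - y) := h
    _ = _ := by
        rw [← integral_sub_left_eq_self _ volume x]; simp [mul_comm]

lemma lintegral_mollify_le {n : ℕ} (ρ : ContDiffBump (0 : Euc n)) {g : Euc n → ℝ}
    (hg : LocallyIntegrable g volume) (a : Euc n) (r : ℝ) :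
    ∫⁻ x in ball a r, ‖mollify ρ g x‖ₑ ≤ ∫⁻ x in ball a (r + ρ.rOut), ‖g x‖ₑ := by
  have hρ0 := ρ.nonneg_normed (μ := (volume : Measure (Euc n)))
  have hρc : Continuous (ρ.normed (volume : Measure (Euc n))) := ρ.continuous_normed
  have hone : ∫⁻ t, ENNReal.ofReal (ρ.normed (volume : Measure (Euc n)) t) = 1 := by
    rw [← ofReal_integral_eq_lintegral_ofReal ρ.integrable_normed (Eventually.of_forall hρ0),
      ρ.integral_normed, ENNReal.ofReal_one]
  calc ∫⁻ x in ball a r, ‖mollify ρ g x‖ₑ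
      ≤ ∫⁻ x in ball a r, ∫⁻ t, ENNReal.ofReal (ρ.normed volume t) * ‖g (x - t)‖ₑ := by
        refine lintegral_mono fun x => ?_
        refine (enorm_integral_le_lintegral_enorm _).trans (le_of_eq (lintegral_congr fun t => ?_))
        simp [enorm_mul, Real.enorm_eq_ofReal (hρ0 t)]
    _ = ∫⁻ t, ∫⁻ x in ball a r, ENNReal.ofReal (ρ.normed volume t) * ‖g (x - t)‖ₑ := by
        refine lintegral_lintegral_swap ?_
        have h1 : AEMeasurable (fun z : Euc n × Euc n => g (z.1 - z.2)) (volume.prod volume) :=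
          hg.aestronglyMeasurable.aemeasurable.comp_quasiMeasurePreserving
            (quasiMeasurePreserving_sub volume volume)
        have h2 : AEMeasurable (fun z : Euc n × Euc n => g (z.1 - z.2))
            ((volume.restrict (ball a r)).prod volume) :=
          h1.mono_ac (Measure.AbsolutelyContinuous.prod Measure.absolutelyContinuous_restrict
            Measure.AbsolutelyContinuous.rfl)
        exact ((hρc.measurable.comp measurable_snd).ennreal_ofReal.aemeasurable).mul h2.enorm
    _ ≤ ∫⁻ t, ENNReal.ofReal (ρ.normed volume t) * ∫⁻ x in ball a (r + ρ.rOut), ‖g x‖ₑ := by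
        refine lintegral_mono fun t => ?_
        rw [lintegral_const_mul' _ _ ENNReal.ofReal_ne_top]
        by_cases ht : t ∈ ball (0 : Euc n) ρ.rOut
        · refine mul_le_mul_right ?_ _
          rw [← lintegral_indicator measurableSet_ball, ← lintegral_indicator measurableSet_ball,
            ← lintegral_sub_right_eq_self (μ := volume)
              ((ball a (r + ρ.rOut)).indicator fun x => ‖g x‖ₑ) t]
          refine lintegral_mono fun x => ?_
          by_cases hx : x ∈ ball a r
          · have : x - t ∈ ball a (r + ρ.rOut) := by
              rw [mem_ball, dist_eq_norm] at hx ⊢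
              rw [mem_ball_zero_iff] at ht
              calc ‖x - t - a‖ = ‖(x - a) - t‖ := by congr 1; abel
                _ ≤ ‖x - a‖ + ‖t‖ := norm_sub_le _ _
                _ < _ := by linarith
            rw [indicator_of_mem hx, indicator_of_mem this]
          · rw [indicator_of_notMem hx]; exact bot_le
        · have h0 : ρ.normed (volume : Measure (Euc n)) t = 0 := by
            rw [← ρ.support_normed_eq (μ := (volume : Measure (Euc n)))] at ht
            exact Function.notMem_support.1 ht
          simp [h0]
    _ = _ := by
        rw [lintegral_mul_const _ hρc.measurable.ennreal_ofReal, hone, one_mul]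

lemma enorm_le_sum_enorm_single {n : ℕ} (L : Euc n →L[ℝ] ℝ) :
    ‖L‖ₑ ≤ ∑ i, ‖L (EuclideanSpace.single i 1)‖ₑ := by
  have : ‖L‖ ≤ ∑ i, ‖L (EuclideanSpace.single i 1)‖ := by
    refine L.opNorm_le_bound (Finset.sum_nonneg fun i _ => norm_nonneg _) fun x => ?_
    have hx : x = ∑ i, x i • EuclideanSpace.single i (1 : ℝ) := by
      have := (EuclideanSpace.basisFun (Fin n) ℝ).sum_repr x
      simpa using this.symm
    calc ‖L x‖ = ‖∑ i, x i • L (EuclideanSpace.single i (1 : ℝ))‖ := by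
          conv_lhs => rw [hx, map_sum]
          simp
      _ ≤ ∑ i, ‖x i • L (EuclideanSpace.single i (1 : ℝ))‖ := norm_sum_le _ _
      _ ≤ ∑ i, ‖L (EuclideanSpace.single i (1 : ℝ))‖ * ‖x‖ := by
          refine Finset.sum_le_sum fun i _ => ?_
          rw [norm_smul, mul_comm]
          gcongr
          exact PiLp.norm_apply_le x i
      _ = _ := by rw [Finset.sum_mul]
  calc ‖L‖ₑ = ENNReal.ofReal ‖L‖ := (ofReal_norm _).symm
    _ ≤ ENNReal.ofReal (∑ i, ‖L (EuclideanSpace.single i 1)‖) := ENNReal.ofReal_le_ofReal this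
    _ = _ := by
      rw [ENNReal.ofReal_sum_of_nonneg fun i _ => norm_nonneg _]
      exact Finset.sum_congr rfl fun i _ => ofReal_norm _

lemma lintegral_lintegral_sub_le_of_tendsto {n : ℕ} {F : ℕ → Euc n → ℝ} {f : Euc n → ℝ}
    (hC : ∀ k, Continuous (F k)) (hae : ∀ᵐ x, Tendsto (fun k => F k x) atTop (𝓝 (f x)))
    (S : Set (Euc n)) {M : ℝ≥0∞} (hM : ∀ k, ∫⁻ x in S, ∫⁻ y in S, ‖F k x - F k y‖ₑ ≤ M) :
    ∫⁻ x in S, ∫⁻ y in S, ‖f x - f y‖ₑ ≤ M := by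
  have hm2 : ∀ k, Measurable fun z : Euc n × Euc n => ‖F k z.1 - F k z.2‖ₑ := fun k =>
    (((hC k).comp continuous_fst).sub ((hC k).comp continuous_snd)).enorm.measurable
  calc ∫⁻ x in S, ∫⁻ y in S, ‖f x - f y‖ₑ
      = ∫⁻ x in S, ∫⁻ y in S, liminf (fun k => ‖F k x - F k y‖ₑ) atTop := by
        refine lintegral_congr_ae ?_
        filter_upwards [ae_restrict_of_ae hae] with x hx
        refine lintegral_congr_ae ?_
        filter_upwards [ae_restrict_of_ae hae] with y hy
        exact ((hx.sub hy).enorm).liminf_eq.symm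
    _ ≤ ∫⁻ x in S, liminf (fun k => ∫⁻ y in S, ‖F k x - F k y‖ₑ) atTop :=
        lintegral_mono fun x => lintegral_liminf_le fun k => (hm2 k).comp measurable_prodMk_left
    _ ≤ liminf (fun k => ∫⁻ x in S, ∫⁻ y in S, ‖F k x - F k y‖ₑ) atTop :=
        lintegral_liminf_le fun k => (hm2 k).lintegral_prod_right'
    _ ≤ _ := by
        refine liminf_le_of_le (by isBoundedDefault) fun b hb => ?_
        obtain ⟨k, hk⟩ := hb.exists
        exact hk.trans (hM k)

/-- Poincaré inequality in double-integral form, with the gradient integrated over a larger ball. -/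
lemma HasWeakGrad.lintegral_sub_le {n : ℕ} {f : Euc n → ℝ} {g : Fin n → Euc n → ℝ}
    (hfg : HasWeakGrad f g) (a : Euc n) {r : ℝ} (hr : 0 < r) :
    ∫⁻ x in ball a r, ∫⁻ y in ball a r, ‖f x - f y‖ₑ ≤
      volume (ball (0 : Euc n) (2 * r)) *
        (ENNReal.ofReal (2 * r) * ∑ i, ∫⁻ x in ball a (4 * r), ‖g i x‖ₑ) := by
  set ρ : ℕ → ContDiffBump (0 : Euc n) := fun k =>
    ⟨r / (2 * (k + 1)), r / (k + 1), by positivity, by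
      apply div_lt_div_of_pos_left hr (by positivity); linarith [show (0 : ℝ) ≤ k by positivity]⟩
    with hρ
  have hle : ∀ k, (ρ k).rOut ≤ r := fun k => div_le_self hr.le (by
    linarith [show (0 : ℝ) ≤ k by positivity])
  have hlim : Tendsto (fun k => (ρ k).rOut) atTop (𝓝 0) := by
    have := (tendsto_one_div_add_atTop_nhds_zero_nat (𝕜 := ℝ)).const_mul r
    simpa [hρ, div_eq_mul_inv] using this
  have hK : ∀ᶠ k in atTop, (ρ k).rOut ≤ 2 * (ρ k).rIn := Eventually.of_forall fun k => by
    apply le_of_eq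
    simp only [hρ]
    field_simp
  have hae := ContDiffBump.ae_convolution_tendsto_right_of_locallyIntegrable hlim hK hfg.1
  have hC : ∀ k, Continuous (mollify (ρ k) f) := fun k => (contDiff_mollify (ρ k) hfg.1).continuous
  have hstep : ∀ k, ∫⁻ x in ball a r, ∫⁻ y in ball a r, ‖mollify (ρ k) f x - mollify (ρ k) f y‖ₑ ≤
      volume (ball (0 : Euc n) (2 * r)) *
        (ENNReal.ofReal (2 * r) * ∑ i, ∫⁻ x in ball a (4 * r), ‖g i x‖ₑ) := by
    intro k
    refine (lintegral_lintegral_sub_le_of_contDiff (contDiff_mollify (ρ k) hfg.1) a r).trans ?_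
    refine mul_le_mul_right (mul_le_mul_right ?_ _) _
    calc ∫⁻ x in ball a (3 * r), ‖fderiv ℝ (mollify (ρ k) f) x‖ₑ
        ≤ ∫⁻ x in ball a (3 * r), ∑ i, ‖mollify (ρ k) (g i) x‖ₑ := by
          refine lintegral_mono fun x => (enorm_le_sum_enorm_single _).trans ?_
          simp only [fderiv_mollify (ρ k) hfg x, le_refl]
      _ = ∑ i, ∫⁻ x in ball a (3 * r), ‖mollify (ρ k) (g i) x‖ₑ :=
          lintegral_finsetSum _ fun i _ =>
            ((contDiff_mollify (ρ k) (hfg.2.1 i)).continuous.enorm).measurable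
      _ ≤ _ := by
          refine Finset.sum_le_sum fun i _ => ?_
          refine (lintegral_mollify_le (ρ k) (hfg.2.1 i) a (3 * r)).trans ?_
          exact lintegral_mono_set (ball_subset_ball (by linarith [hle k]))
  exact lintegral_lintegral_sub_le_of_tendsto hC hae (ball a r) hstep

end

/-! ### Averages over dyadic balls -/

/-- The normalized double integral of `|f x - f y|` over `S × S`. -/
noncomputable def dblOsc {n : ℕ} (f : Euc n → ℝ) (S : Set (Euc n)) : ℝ≥0∞ :=
  (volume S)⁻¹ ^ 2 * ∫⁻ x in S, ∫⁻ y in S, ‖f x - f y‖ₑ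

/-- The average of `|f|` over `S`. -/
noncomputable def absAvg {n : ℕ} (f : Euc n → ℝ) (S : Set (Euc n)) : ℝ≥0∞ :=
  (volume S)⁻¹ * ∫⁻ x in S, ‖f x‖ₑ

lemma volume_ball_euc {n : ℕ} (a : Euc n) {r : ℝ} (hr : 0 < r) :
    volume (ball a r) = ENNReal.ofReal (r ^ n) * volume (ball (0 : Euc n) 1) := by
  rw [Measure.addHaar_ball_of_pos _ _ hr]; simp

lemma volume_ball_mul {n : ℕ} (a b : Euc n) {c r : ℝ} (hc : 0 < c) (hr : 0 < r) :
    volume (ball a (c * r)) = ENNReal.ofReal (c ^ n) * volume (ball b r) := by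
  rw [volume_ball_euc a (mul_pos hc hr), volume_ball_euc b hr, mul_pow,
    ENNReal.ofReal_mul (by positivity), mul_assoc]

lemma volume_ball_ne_zero {n : ℕ} (a : Euc n) {r : ℝ} (hr : 0 < r) : volume (ball a r) ≠ 0 :=
  (measure_ball_pos _ _ hr).ne'

lemma measure_mul_lintegral_enorm_le {n : ℕ} {f : Euc n → ℝ} (hf : AEMeasurable f volume)
    (S U : Set (Euc n)) :
    volume U * ∫⁻ x in S, ‖f x‖ₑ ≤
      (∫⁻ x in S, ∫⁻ y in U, ‖f x - f y‖ₑ) + volume S * ∫⁻ y in U, ‖f y‖ₑ := by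
  have hfe : AEMeasurable (fun x => ‖f x‖ₑ) volume := hf.enorm
  calc volume U * ∫⁻ x in S, ‖f x‖ₑ = ∫⁻ x in S, ∫⁻ y in U, ‖f x‖ₑ := by
        rw [← lintegral_const_mul'' _ hfe.restrict]
        simp [mul_comm]
    _ ≤ ∫⁻ x in S, ((∫⁻ y in U, ‖f x - f y‖ₑ) + ∫⁻ y in U, ‖f y‖ₑ) := by
        refine lintegral_mono fun x => ?_
        rw [← lintegral_add_right' _ hfe.restrict]
        refine lintegral_mono fun y => ?_
        calc ‖f x‖ₑ = ‖(f x - f y) + f y‖ₑ := by simp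
          _ ≤ _ := enorm_add_le _ _
    _ = _ := by
        rw [lintegral_add_right _ measurable_const]
        simp [mul_comm]

lemma absAvg_le_dblOsc_add {n : ℕ} {f : Euc n → ℝ} (hf : AEMeasurable f volume)
    (a : Euc n) {R : ℝ} (hR : 0 < R) :
    absAvg f (ball a R) ≤ ENNReal.ofReal (4 ^ n) * dblOsc f (ball a (4 * R)) +
      absAvg f (ball a (4 * R)) := by
  have h := measure_mul_lintegral_enorm_le hf (ball a R) (ball a (4 * R))
  have hV := volume_ball_mul a a (c := 4) (by norm_num) hR
  have h0 := volume_ball_ne_zero a hR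
  have h0' := volume_ball_ne_zero a (show 0 < 4 * R by positivity)
  have ht : volume (ball a R) ≠ ⊤ := measure_ball_lt_top.ne
  have ht' : volume (ball a (4 * R)) ≠ ⊤ := measure_ball_lt_top.ne
  have hsub : ball a R ⊆ ball a (4 * R) := ball_subset_ball (by linarith)
  have hD : ∫⁻ x in ball a R, ∫⁻ y in ball a (4 * R), ‖f x - f y‖ₑ ≤
      ∫⁻ x in ball a (4 * R), ∫⁻ y in ball a (4 * R), ‖f x - f y‖ₑ := lintegral_mono_set hsub
  have h1 := h.trans (add_le_add_left hD _)
  unfold absAvg dblOsc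
  set V := volume (ball a R)
  set W := volume (ball a (4 * R))
  set I := ∫⁻ x in ball a R, ‖f x‖ₑ
  set I' := ∫⁻ x in ball a (4 * R), ‖f x‖ₑ
  set O := ∫⁻ x in ball a (4 * R), ∫⁻ y in ball a (4 * R), ‖f x - f y‖ₑ
  have e : ENNReal.ofReal (4 ^ n) * W⁻¹ = V⁻¹ := by
    rw [hV, ENNReal.mul_inv (Or.inr ht) (Or.inr h0), ← mul_assoc, ENNReal.mul_inv_cancel, one_mul]
    · simp
    · exact ENNReal.ofReal_ne_top
  calc V⁻¹ * I = V⁻¹ * W⁻¹ * (W * I) := by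
        rw [mul_assoc, ← mul_assoc W⁻¹, ENNReal.inv_mul_cancel h0' ht', one_mul]
    _ ≤ V⁻¹ * W⁻¹ * (O + V * I') := mul_le_mul_right h1 _
    _ = ENNReal.ofReal (4 ^ n) * (W⁻¹ ^ 2 * O) + W⁻¹ * I' * (V⁻¹ * V) := by
        rw [mul_add]
        congr 1
        · rw [← e]; ring
        · ring
    _ = _ := by rw [ENNReal.inv_mul_cancel h0 ht, mul_one]

lemma absAvg_le_add_dblOsc {n : ℕ} {f : Euc n → ℝ} (hf : AEMeasurable f volume)
    (a : Euc n) {R t : ℝ} (hR : 0 < R) 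
    (hdec : 2 * volume {x | t < |f x|} ≤ volume (ball a R)) :
    absAvg f (ball a R) ≤ 2 * dblOsc f (ball a R) + ENNReal.ofReal t := by
  set U := ball a R ∩ {x | |f x| ≤ t} with hU
  have hUm : NullMeasurableSet U volume :=
    measurableSet_ball.nullMeasurableSet.inter
      (nullMeasurableSet_le hf.norm aemeasurable_const)
  have h := measure_mul_lintegral_enorm_le hf (ball a R) U
  have h0 := volume_ball_ne_zero a hR
  have ht : volume (ball a R) ≠ ⊤ := measure_ball_lt_top.ne
  have hUV : volume (ball a R) ≤ 2 * volume U := by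
    have h1 : volume (ball a R) ≤ volume U + volume {x | t < |f x|} := by
      refine (measure_mono fun x hx => ?_).trans (measure_union_le _ _)
      by_cases hxt : |f x| ≤ t
      · exact Or.inl ⟨hx, hxt⟩
      · exact Or.inr (not_le.1 hxt)
    have h2 : 2 * volume (ball a R) ≤ 2 * volume U + volume (ball a R) := by
      calc _ ≤ 2 * (volume U + volume {x | t < |f x|}) := mul_le_mul_right h1 _
        _ = 2 * volume U + 2 * volume {x | t < |f x|} := mul_add _ _ _
        _ ≤ _ := by gcongr
    rw [two_mul] at h2
    exact (ENNReal.add_le_add_iff_right ht).1 h2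
  have hU0 : volume U ≠ 0 := fun hz => h0 (by simpa [hz] using hUV)
  have hUt : volume U ≠ ⊤ := ((measure_mono inter_subset_left).trans_lt measure_ball_lt_top).ne
  have hI : ∫⁻ y in U, ‖f y‖ₑ ≤ ENNReal.ofReal t * volume U := by
    calc ∫⁻ y in U, ‖f y‖ₑ ≤ ∫⁻ y in U, ENNReal.ofReal t := by
          refine lintegral_mono_ae ?_
          filter_upwards [ae_restrict_mem₀ hUm] with y hy
          rw [Real.enorm_eq_ofReal_abs]
          exact ENNReal.ofReal_le_ofReal hy.2
      _ = _ := by simp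
  have hD : ∫⁻ x in ball a R, ∫⁻ y in U, ‖f x - f y‖ₑ ≤
      ∫⁻ x in ball a R, ∫⁻ y in ball a R, ‖f x - f y‖ₑ :=
    lintegral_mono fun x => lintegral_mono_set inter_subset_left
  have h1 := h.trans (add_le_add hD (mul_le_mul_right hI _))
  unfold absAvg dblOsc
  set V := volume (ball a R)
  set I := ∫⁻ x in ball a R, ‖f x‖ₑ
  set O := ∫⁻ x in ball a R, ∫⁻ y in ball a R, ‖f x - f y‖ₑ
  have hinv : (volume U)⁻¹ ≤ 2 * V⁻¹ := by
    rw [ENNReal.inv_le_iff_inv_le, ENNReal.mul_inv (by simp) (by simp), inv_inv]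
    calc 2⁻¹ * V ≤ 2⁻¹ * (2 * volume U) := mul_le_mul_right hUV _
      _ = _ := by rw [← mul_assoc, ENNReal.inv_mul_cancel (by simp) (by simp), one_mul]
  calc V⁻¹ * I = V⁻¹ * (volume U)⁻¹ * (volume U * I) := by
        rw [mul_assoc, ← mul_assoc (volume U)⁻¹, ENNReal.inv_mul_cancel hU0 hUt, one_mul]
    _ ≤ V⁻¹ * (volume U)⁻¹ * (O + V * (ENNReal.ofReal t * volume U)) := mul_le_mul_right h1 _
    _ = V⁻¹ * (volume U)⁻¹ * O +
          (V⁻¹ * V) * ((volume U)⁻¹ * volume U) * ENNReal.ofReal t := by ring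
    _ ≤ V⁻¹ * (2 * V⁻¹) * O + 1 * 1 * ENNReal.ofReal t := by
        rw [ENNReal.inv_mul_cancel h0 ht, ENNReal.inv_mul_cancel hU0 hUt]
        gcongr
    _ = _ := by ring

lemma absAvg_le_tsum {n : ℕ} (hn : 0 < n) {f : Euc n → ℝ} (hf : AEMeasurable f volume)
    (hdec : ∀ t : ℝ, 0 < t → volume {x | t < |f x|} < ⊤) (a : Euc n) {R : ℝ} (hR : 0 < R) :
    absAvg f (ball a R) ≤
      (ENNReal.ofReal (4 ^ n) + 2) * ∑' j : ℕ, dblOsc f (ball a (4 ^ j * R)) := by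
  have htel : ∀ K : ℕ, absAvg f (ball a R) ≤
      ENNReal.ofReal (4 ^ n) * ∑ j ∈ Finset.range K, dblOsc f (ball a (4 ^ (j + 1) * R)) +
        absAvg f (ball a (4 ^ K * R)) := by
    intro K
    induction K with
    | zero => simp
    | succ K ih =>
      have h := absAvg_le_dblOsc_add hf a (show 0 < 4 ^ K * R by positivity)
      rw [← mul_assoc, ← pow_succ'] at h
      refine (ih.trans (add_le_add_right h _)).trans (le_of_eq ?_)
      rw [Finset.sum_range_succ, mul_add, add_assoc]
  refine ENNReal.le_of_forall_pos_le_add fun ε hε _ => ?_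
  have hvol : Tendsto (fun K : ℕ => volume (ball a (4 ^ K * R))) atTop (𝓝 ⊤) := by
    have h1 : ∀ K : ℕ, volume (ball a (4 ^ K * R)) =
        ENNReal.ofReal ((4 ^ K) ^ n) * volume (ball a R) := fun K =>
      volume_ball_mul a a (by positivity) hR
    simp only [h1]
    have h2 : Tendsto (fun K : ℕ => ENNReal.ofReal (((4 : ℝ) ^ K) ^ n)) atTop (𝓝 ⊤) := by
      refine ENNReal.tendsto_ofReal_atTop.comp ?_
      exact (tendsto_pow_atTop hn.ne').comp (tendsto_pow_atTop_atTop_of_one_lt (by norm_num))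
    have h3 := ENNReal.Tendsto.mul_const (b := volume (ball a R)) h2
      (Or.inl (by simp))
    rwa [ENNReal.top_mul (volume_ball_ne_zero a hR)] at h3
  have hfin : 2 * volume {x | (ε : ℝ) < |f x|} < ⊤ :=
    ENNReal.mul_lt_top (by simp) (hdec ε hε)
  obtain ⟨K, hK⟩ := (hvol.eventually (lt_mem_nhds hfin)).exists
  have h2 := absAvg_le_add_dblOsc hf a (show 0 < 4 ^ K * R by positivity) hK.le
  rw [ENNReal.ofReal_coe_nnreal] at h2
  calc absAvg f (ball a R) ≤ _ := htel K
    _ ≤ ENNReal.ofReal (4 ^ n) * (∑' j : ℕ, dblOsc f (ball a (4 ^ j * R))) +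
        (2 * (∑' j : ℕ, dblOsc f (ball a (4 ^ j * R))) + ε) := by
        refine add_le_add (mul_le_mul_right ?_ _) (h2.trans (add_le_add_left
          (mul_le_mul_right (ENNReal.le_tsum K) _) _))
        refine (ENNReal.sum_le_tsum _).trans ?_
        exact ENNReal.tsum_comp_le_tsum_of_injective (add_left_injective 1)
          fun j => dblOsc f (ball a (4 ^ j * R))
    _ = _ := by ring

/-! ### Iterating over the order of differentiation -/

/-- Sum over multi-indices of the averages of the derivatives of order `h`. -/
noncomputable def derivAvg {n : ℕ} (D : (h : ℕ) → Euc n → (Fin h → Fin n) → ℝ) (h : ℕ)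
    (S : Set (Euc n)) : ℝ≥0∞ := ∑ d : Fin h → Fin n, absAvg (fun x => D h x d) S

/-- Sum over multi-indices of the oscillations of the derivatives of order `h`. -/
noncomputable def derivOsc {n : ℕ} (D : (h : ℕ) → Euc n → (Fin h → Fin n) → ℝ) (h : ℕ)
    (S : Set (Euc n)) : ℝ≥0∞ := ∑ d : Fin h → Fin n, dblOsc (fun x => D h x d) S

lemma derivAvg_le_tsum {n : ℕ} (hn : 0 < n) {m : ℕ} {u : Euc n → ℝ}
    {D : (h : ℕ) → Euc n → (Fin h → Fin n) → ℝ} (hD : HasWeakDerivs n m u D)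
    (hdec : DecayFrom n 1 m D) {h : ℕ} (h1 : 1 ≤ h) (hm : h ≤ m) (a : Euc n) {R : ℝ}
    (hR : 0 < R) :
    derivAvg D h (ball a R) ≤
      (ENNReal.ofReal (4 ^ n) + 2) * ∑' j : ℕ, derivOsc D h (ball a (4 ^ j * R)) := by
  unfold derivAvg derivOsc
  rw [Summable.tsum_finsetSum fun _ _ => ENNReal.summable, Finset.mul_sum]
  refine Finset.sum_le_sum fun d _ => absAvg_le_tsum hn
    (hD.2 h hm d).1.aestronglyMeasurable.aemeasurable (fun t ht => ?_) a hR
  refine (measure_mono fun x hx => ?_).trans_lt (hdec h h1 hm t ht)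
  refine lt_of_lt_of_le (show t < |D h x d| from hx) ?_
  unfold gradLen
  rw [← Real.sqrt_sq_eq_abs]
  exact Real.sqrt_le_sqrt (Finset.single_le_sum (f := fun d => D h x d ^ 2)
    (fun _ _ => sq_nonneg _) (Finset.mem_univ d))

lemma derivOsc_le_derivAvg {n m : ℕ} {u : Euc n → ℝ}
    {D : (h : ℕ) → Euc n → (Fin h → Fin n) → ℝ} (hD : HasWeakDerivs n m u D)
    {h : ℕ} (hm : h < m) (a : Euc n) {R : ℝ} (hR : 0 < R) :
    derivOsc D h (ball a R) ≤
      ENNReal.ofReal (2 ^ n * 4 ^ n * 2) *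
        (ENNReal.ofReal R * derivAvg D (h + 1) (ball a (4 * R))) := by
  have hV := volume_ball_mul a a (c := 4) (by norm_num) hR
  have hV2 := volume_ball_mul 0 a (c := 2) (by norm_num) hR
  have h0 := volume_ball_ne_zero a hR
  have ht : volume (ball a R) ≠ ⊤ := measure_ball_lt_top.ne
  have e : (volume (ball a R))⁻¹ = ENNReal.ofReal (4 ^ n) * (volume (ball a (4 * R)))⁻¹ := by
    rw [hV, ENNReal.mul_inv (Or.inr ht) (Or.inr h0), ← mul_assoc, ENNReal.mul_inv_cancel, one_mul]
    · simp
    · exact ENNReal.ofReal_ne_top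
  have hstep : ∀ d : Fin h → Fin n, dblOsc (fun x => D h x d) (ball a R) ≤
      ENNReal.ofReal (2 ^ n * 4 ^ n * 2) * (ENNReal.ofReal R *
        ∑ i, absAvg (fun x => D (h + 1) x (Fin.snoc d i)) (ball a (4 * R))) := by
    intro d
    have hp := (hD.hasWeakGrad hm d).lintegral_sub_le a hR
    unfold dblOsc absAvg
    refine (mul_le_mul_right hp _).trans (le_of_eq ?_)
    rw [hV2, ← Finset.mul_sum, pow_two]
    rw [ENNReal.ofReal_mul (p := 2) (by positivity),
      ENNReal.ofReal_mul (p := 2 ^ n * 4 ^ n) (by positivity),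
      ENNReal.ofReal_mul (p := 2 ^ n) (by positivity)]
    generalize (∑ i, ∫⁻ x in ball a (4 * R), ‖D (h + 1) x (Fin.snoc d i)‖ₑ) = W
    calc _ = ((volume (ball a R))⁻¹ * volume (ball a R)) * (volume (ball a R))⁻¹ *
          (ENNReal.ofReal (2 ^ n) * (ENNReal.ofReal 2 * ENNReal.ofReal R * W)) := by ring
      _ = _ := by rw [ENNReal.inv_mul_cancel h0 ht, one_mul, e]; ring
  unfold derivOsc derivAvg
  refine (Finset.sum_le_sum fun d _ => hstep d).trans (le_of_eq ?_)
  rw [← Finset.mul_sum, ← Finset.mul_sum, ← Fintype.sum_prod_type']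
  congr 2
  exact Fintype.sum_equiv ((Equiv.prodComm _ _).trans (Fin.snocEquiv fun _ => Fin n)) _ _
    fun p => rfl

lemma tsum_tsum_four_pow_le (G : ℕ → ℝ≥0∞) {R : ℝ} (hR : 0 ≤ R) :
    ∑' i : ℕ, ENNReal.ofReal (4 ^ i * R) * ∑' j : ℕ, G (j + (i + 1)) ≤
      ∑' k : ℕ, ENNReal.ofReal (4 ^ k * R) * G k := by
  calc ∑' i : ℕ, ENNReal.ofReal (4 ^ i * R) * ∑' j : ℕ, G (j + (i + 1))
      ≤ ∑' i : ℕ, ENNReal.ofReal (4 ^ i * R) * ∑' k : ℕ, if i < k then G k else 0 := by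
        refine ENNReal.tsum_le_tsum fun i => mul_le_mul_right ?_ _
        have := ENNReal.tsum_comp_le_tsum_of_injective (add_left_injective (i + 1))
          (fun k => if i < k then G k else 0)
        refine le_trans (le_of_eq (tsum_congr fun j => ?_)) this
        rw [if_pos (by omega)]
    _ = ∑' k : ℕ, ∑' i : ℕ, (if i < k then ENNReal.ofReal (4 ^ i * R) else 0) * G k := by
        rw [ENNReal.tsum_comm]
        refine tsum_congr fun i => ?_
        rw [← ENNReal.tsum_mul_left]
        refine tsum_congr fun k => ?_
        split_ifs <;> simp
    _ ≤ _ := by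
        refine ENNReal.tsum_le_tsum fun k => ?_
        rw [ENNReal.tsum_mul_right]
        refine mul_le_mul_left ?_ _
        rw [tsum_eq_sum (s := Finset.range k) fun i hi => by simp at hi; simp [hi]]
        rw [Finset.sum_congr rfl fun i hi => if_pos (Finset.mem_range.1 hi),
          ← ENNReal.ofReal_sum_of_nonneg fun i _ => by positivity]
        refine ENNReal.ofReal_le_ofReal ?_
        rw [← Finset.sum_mul]
        gcongr
        rw [geom_sum_eq (by norm_num)]
        have : (1 : ℝ) ≤ 4 ^ k := one_le_pow₀ (by norm_num)
        rw [div_le_iff₀ (by norm_num)]; linarith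

lemma exists_derivAvg_le_tsum {n : ℕ} (hn : 0 < n) (l : ℕ) :
    ∃ C : ℝ≥0∞, C ≠ ⊤ ∧ ∀ (m h : ℕ) (u : Euc n → ℝ) (D : (h : ℕ) → Euc n → (Fin h → Fin n) → ℝ),
      HasWeakDerivs n m u D → DecayFrom n 1 m D → 1 ≤ h → h + l = m →
      ∀ (a : Euc n) (R : ℝ), 0 < R →
        derivAvg D h (ball a R) ≤
          C * ∑' j : ℕ, ENNReal.ofReal ((4 ^ j * R) ^ l) * derivOsc D m (ball a (4 ^ j * R)) := by
  induction l with
  | zero =>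
    refine ⟨ENNReal.ofReal (4 ^ n) + 2, by simp, ?_⟩
    intro m h u D hD hdec h1 hm a R hR
    simp only [add_zero] at hm
    subst hm
    simpa using derivAvg_le_tsum hn hD hdec h1 le_rfl a hR
  | succ l ih =>
    obtain ⟨C, hC, ih⟩ := ih
    refine ⟨(ENNReal.ofReal (4 ^ n) + 2) * (ENNReal.ofReal (2 ^ n * 4 ^ n * 2) * C),
      by finiteness, ?_⟩
    intro m h u D hD hdec h1 hm a R hR
    refine (derivAvg_le_tsum hn hD hdec h1 (by omega) a hR).trans ?_
    rw [mul_assoc]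
    refine mul_le_mul_right ?_ _
    have hstep : ∀ i : ℕ, derivOsc D h (ball a (4 ^ i * R)) ≤
        ENNReal.ofReal (2 ^ n * 4 ^ n * 2) * C * (ENNReal.ofReal (4 ^ i * R) *
          ∑' j : ℕ, ENNReal.ofReal ((4 ^ (j + (i + 1)) * R) ^ l) *
            derivOsc D m (ball a (4 ^ (j + (i + 1)) * R))) := by
      intro i
      refine (derivOsc_le_derivAvg hD (by omega) a (by positivity)).trans ?_
      have := ih m (h + 1) u D hD hdec (by omega) (by omega) a (4 * (4 ^ i * R)) (by positivity)
      have e : ∀ j : ℕ, (4 : ℝ) ^ j * (4 * (4 ^ i * R)) = 4 ^ (j + (i + 1)) * R := by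
        intro j; ring
      simp only [e] at this
      rw [mul_assoc _ C, mul_left_comm C]
      exact mul_le_mul_right (mul_le_mul_right this _) _
    refine (ENNReal.tsum_le_tsum hstep).trans ?_
    rw [ENNReal.tsum_mul_left]
    refine mul_le_mul_right ((tsum_tsum_four_pow_le (fun k => ENNReal.ofReal ((4 ^ k * R) ^ l) *
      derivOsc D m (ball a (4 ^ k * R))) hR.le).trans (le_of_eq (tsum_congr fun k => ?_))) _
    rw [← mul_assoc, ← ENNReal.ofReal_mul (by positivity), pow_succ']

/-! ### Estimating dyadic oscillations by the modular -/

lemma sum_lintegral_le_lintegral_sum {α ι : Type*} [MeasurableSpace α] {μ : Measure α}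
    (J : Finset ι) (F : ι → α → ℝ≥0∞) :
    ∑ j ∈ J, ∫⁻ x, F j x ∂μ ≤ ∫⁻ x, ∑ j ∈ J, F j x ∂μ := by
  classical
  induction J using Finset.induction_on with
  | empty => simp
  | insert j J hj ih =>
    simp only [Finset.sum_insert hj]
    exact (add_le_add_right ih _).trans (le_lintegral_add _ _)

lemma sum_rpow_cutoff_le {e : ℝ} (he : 0 < e) :
    ∃ C : ℝ≥0∞, C ≠ ⊤ ∧ ∀ (N : ℕ) (R ρ : ℝ), 0 < R → 0 ≤ ρ →
      ∑ j ∈ Finset.range N, (if ρ < 2 * (4 ^ j * R) then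
        ENNReal.ofReal ((ρ / (4 ^ j * R)) ^ e) else 0) ≤ C := by
  set q : ℝ := 4 ^ (-e) with hq
  have hq0 : 0 < q := by positivity
  have hq1 : q < 1 := Real.rpow_lt_one_of_one_lt_of_neg (by norm_num) (by linarith)
  refine ⟨ENNReal.ofReal (2 ^ e * (1 - q)⁻¹), ENNReal.ofReal_ne_top, fun N R ρ hR hρ => ?_⟩
  set b : ℝ := (ρ / (2 * R)) ^ e with hb
  have hb0 : 0 ≤ b := by positivity
  have key : ∀ j : ℕ, (ρ / (4 ^ j * R)) ^ e = 2 ^ e * (q ^ j * b) := by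
    intro j
    have h1 : q ^ j = ((4 : ℝ) ^ j)⁻¹ ^ e := by
      rw [hq, ← Real.rpow_natCast, ← Real.rpow_natCast, ← Real.rpow_mul (by norm_num),
        ← Real.rpow_neg (by norm_num), ← Real.rpow_mul (by norm_num)]
      ring_nf
    rw [h1, hb, ← Real.mul_rpow (by positivity) (by positivity),
      ← Real.mul_rpow (by positivity) (by positivity)]
    congr 1
    field_simp
  have hterm : ∀ j : ℕ, (if ρ < 2 * (4 ^ j * R) then
        ENNReal.ofReal ((ρ / (4 ^ j * R)) ^ e) else 0) ≤
      ENNReal.ofReal (2 ^ e * (if q ^ j * b ≤ 1 then q ^ j * b else 0)) := by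
    intro j
    by_cases h : ρ < 2 * (4 ^ j * R)
    · have h1 : q ^ j * b ≤ 1 := by
        have h2 : (ρ / (4 ^ j * R)) ^ e ≤ 2 ^ e :=
          Real.rpow_le_rpow (by positivity) (by
            rw [div_le_iff₀ (by positivity)]; linarith) he.le
        rw [key] at h2
        have h3 : (0 : ℝ) < 2 ^ e := by positivity
        nlinarith
      rw [if_pos h, if_pos h1, key]
    · rw [if_neg h]; exact bot_le
  refine (Finset.sum_le_sum fun j _ => hterm j).trans ?_
  rw [← ENNReal.ofReal_sum_of_nonneg fun j _ => by split_ifs <;> positivity, ← Finset.mul_sum]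
  refine ENNReal.ofReal_le_ofReal (mul_le_mul_of_nonneg_left ?_ (by positivity))
  refine (sum_geometric_cutoff_le hq0 hq1 N hb0).trans ?_
  have : 0 ≤ (1 - q)⁻¹ := inv_nonneg.2 (by linarith)
  exact mul_le_of_le_one_left this (min_le_left _ _)

lemma sqrt_sum_div_sq {ι : Type} [Fintype ι] (a b : ι → ℝ) {c : ℝ} (hc : 0 < c) (i : ι) :
    |a i - b i| ≤ c * Real.sqrt (∑ i, (a i / c - b i / c) ^ 2) := by
  have h : |a i / c - b i / c| ≤ Real.sqrt (∑ i, (a i / c - b i / c) ^ 2) := by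
    rw [← Real.sqrt_sq_eq_abs]
    exact Real.sqrt_le_sqrt (Finset.single_le_sum (f := fun i => (a i / c - b i / c) ^ 2)
      (fun _ _ => sq_nonneg _) (Finset.mem_univ i))
  rw [← sub_div, abs_div, abs_of_pos hc, div_le_iff₀ hc] at h
  linarith

lemma young_pointwise (A : ℝ → ℝ≥0∞) {n : ℕ} {l : ℕ} {σ lam P ρ N : ℝ} (hσ : 0 < σ) (hσ1 : σ < 1)
    (hlam : 0 < lam) (hP : 0 < P) (hρ : 0 < ρ) (hρP : ρ < 2 * P) (hN : 0 ≤ N) :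
    ENNReal.ofReal (P ^ ((l : ℝ) - 2 * n) * N) ≤ ENNReal.ofReal lam *
      (ENNReal.ofReal ((ρ / P) ^ ((n : ℝ) + σ)) *
          (A (N / ρ ^ σ) / ENNReal.ofReal (ρ ^ (n : ℝ))) +
        ENNReal.ofReal (2 * P ^ (-(n : ℝ))) * youngConj A (P ^ ((l : ℝ) + σ - n) / lam)) := by
  set τ : ℝ := P ^ ((l : ℝ) + σ - n) / lam with hτ
  set w : ℝ := (ρ / P) ^ ((n : ℝ) + σ) with hw
  set Q : ℝ := N / ρ ^ σ with hQ
  have hQ0 : 0 ≤ Q := by positivity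
  have hτ0 : 0 ≤ τ := by positivity
  have hw0 : 0 ≤ w := by positivity
  have hρn : 0 < ρ ^ (n : ℝ) := by positivity
  have hwr : w / ρ ^ (n : ℝ) ≤ 2 * P ^ (-(n : ℝ)) := by
    have e1 : w / ρ ^ (n : ℝ) = (ρ / P) ^ σ * P ^ (-(n : ℝ)) := by
      rw [hw, Real.rpow_add (by positivity), Real.div_rpow hρ.le hP.le, Real.rpow_neg hP.le]
      field_simp
    rw [e1]
    refine mul_le_mul_of_nonneg_right ?_ (by positivity)
    calc (ρ / P) ^ σ ≤ 2 ^ σ := Real.rpow_le_rpow (by positivity) (by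
            rw [div_le_iff₀ (by positivity)]; linarith) hσ.le
      _ ≤ 2 ^ (1 : ℝ) := Real.rpow_le_rpow_of_exponent_le (by norm_num) hσ1.le
      _ = 2 := by simp
  have e : P ^ ((l : ℝ) - 2 * n) * N = lam * (w / ρ ^ (n : ℝ) * (Q * τ)) := by
    rw [hw, hQ, hτ, Real.div_rpow hρ.le hP.le, Real.rpow_add hρ, Real.rpow_add hP,
      Real.rpow_sub hP, Real.rpow_sub hP, Real.rpow_add hP, two_mul, Real.rpow_add hP]
    have h1 : 0 < ρ ^ σ := by positivity
    have h2 : 0 < P ^ σ := by positivity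
    have h3 : 0 < P ^ (n : ℝ) := by positivity
    have h4 : 0 < P ^ (l : ℝ) := by positivity
    field_simp
  rw [e, ENNReal.ofReal_mul hlam.le]
  refine mul_le_mul_right ?_ _
  rw [ENNReal.ofReal_mul (by positivity)]
  refine (mul_le_mul_right (ofReal_mul_le_add_youngConj A hQ0 τ) _).trans ?_
  rw [mul_add]
  refine add_le_add (le_of_eq ?_) (mul_le_mul_left (ENNReal.ofReal_le_ofReal hwr) _)
  rw [ENNReal.ofReal_div_of_pos hρn, div_eq_mul_inv, div_eq_mul_inv]
  ring

lemma exists_tsum_derivOsc_le {n : ℕ} (m l : ℕ) {σ : ℝ} (hσ : 0 < σ) (hσ1 : σ < 1) :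
    ∃ C : ℝ≥0∞, C ≠ ⊤ ∧ ∀ (A : ℝ → ℝ≥0∞) (D : (h : ℕ) → Euc n → (Fin h → Fin n) → ℝ)
      (a : Euc n) (R lam₀ lam : ℝ), 0 < R → 0 < lam₀ → 0 < lam →
      Jfun n σ A (fun x i => D m x i / lam₀) ≤ 1 →
      ∑' j : ℕ, ENNReal.ofReal ((4 ^ j * R) ^ l) * derivOsc D m (ball a (4 ^ j * R)) ≤
        C * ENNReal.ofReal (lam₀ * lam) * (1 + ∑' j : ℕ, ENNReal.ofReal ((4 ^ j * R) ^ n) *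
          youngConj A ((4 ^ j * R) ^ ((l : ℝ) + σ - n) / lam)) := by
  obtain ⟨Cw, hCw, hw⟩ := sum_rpow_cutoff_le (e := (n : ℝ) + σ) (by positivity)
  set ω : ℝ≥0∞ := volume (ball (0 : Euc n) 1) with hω
  have hω0 : ω ≠ 0 := volume_ball_ne_zero 0 one_pos
  have hωt : ω ≠ ⊤ := measure_ball_lt_top.ne
  set c : ℝ≥0∞ := (Fintype.card (Fin m → Fin n) : ℝ≥0∞) with hc
  refine ⟨c * (ω⁻¹ ^ 2 * Cw + 2), by finiteness, ?_⟩
  intro A D a R lam₀ lam hR hlam₀ hlam hJ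
  set K : Euc n → Euc n → ℝ≥0∞ := fun x y =>
    A (Real.sqrt (∑ i, (D m x i / lam₀ - D m y i / lam₀) ^ 2) / ‖x - y‖ ^ σ) /
      ENNReal.ofReal (‖x - y‖ ^ (n : ℝ)) with hK
  set W : ℕ → Euc n → Euc n → ℝ≥0∞ := fun j x y => if ‖x - y‖ < 2 * (4 ^ j * R) then
        ENNReal.ofReal ((‖x - y‖ / (4 ^ j * R)) ^ ((n : ℝ) + σ)) else 0 with hW
  set Y : ℕ → ℝ≥0∞ := fun j => youngConj A ((4 ^ j * R) ^ ((l : ℝ) + σ - n) / lam) with hY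
  have hpt : ∀ (j : ℕ) (d : Fin m → Fin n), ∀ x ∈ ball a (4 ^ j * R), ∀ y ∈ ball a (4 ^ j * R),
      ENNReal.ofReal ((4 ^ j * R) ^ ((l : ℝ) - 2 * n)) * ‖D m x d - D m y d‖ₑ ≤
        ENNReal.ofReal (lam₀ * lam) * (W j x y * K x y +
          ENNReal.ofReal (2 * (4 ^ j * R) ^ (-(n : ℝ))) * Y j) := by
    intro j d x hx y hy
    by_cases hxy : x = y
    · simp [hxy]
    have hρ : 0 < ‖x - y‖ := norm_pos_iff.2 (sub_ne_zero.2 hxy)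
    have hρP : ‖x - y‖ < 2 * (4 ^ j * R) := by
      rw [← dist_eq_norm]
      rw [mem_ball] at hx hy
      have := dist_triangle_right x y a
      linarith
    have hP : 0 < 4 ^ j * R := by positivity
    have h1 := young_pointwise A (n := n) (l := l) hσ hσ1 hlam hP hρ hρP (Real.sqrt_nonneg
      (∑ i, (D m x i / lam₀ - D m y i / lam₀) ^ 2))
    rw [Real.enorm_eq_ofReal_abs, ENNReal.ofReal_mul hlam₀.le, mul_assoc]
    calc _ ≤ ENNReal.ofReal ((4 ^ j * R) ^ ((l : ℝ) - 2 * n)) * ENNReal.ofReal (lam₀ *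
            Real.sqrt (∑ i, (D m x i / lam₀ - D m y i / lam₀) ^ 2)) :=
          mul_le_mul_right (ENNReal.ofReal_le_ofReal (sqrt_sum_div_sq _ _ hlam₀ d)) _
      _ = ENNReal.ofReal lam₀ * ENNReal.ofReal ((4 ^ j * R) ^ ((l : ℝ) - 2 * n) *
            Real.sqrt (∑ i, (D m x i / lam₀ - D m y i / lam₀) ^ 2)) := by
          rw [ENNReal.ofReal_mul hlam₀.le, ENNReal.ofReal_mul (by positivity)]; ring
      _ ≤ _ := by
          refine mul_le_mul_right (h1.trans (le_of_eq ?_)) _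
          simp only [hW, hK, hY, if_pos hρP]
  have hint : ∀ (j : ℕ) (d : Fin m → Fin n),
      ENNReal.ofReal ((4 ^ j * R) ^ l) * dblOsc (fun x => D m x d) (ball a (4 ^ j * R)) ≤
        ENNReal.ofReal (lam₀ * lam) * (ω⁻¹ ^ 2 * (∫⁻ x, ∫⁻ y, W j x y * K x y) +
          2 * (ENNReal.ofReal ((4 ^ j * R) ^ n) * Y j)) := by
    intro j d
    have hP : 0 < 4 ^ j * R := by positivity
    set P : ℝ := 4 ^ j * R with hPdef
    have hV := volume_ball_euc a hP
    rw [← hω] at hV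
    have hI : ENNReal.ofReal (P ^ ((l : ℝ) - 2 * n)) *
        ∫⁻ x in ball a P, ∫⁻ y in ball a P, ‖D m x d - D m y d‖ₑ ≤
        ENNReal.ofReal (lam₀ * lam) * ((∫⁻ x, ∫⁻ y, W j x y * K x y) +
          ENNReal.ofReal (2 * P ^ (-(n : ℝ))) * Y j * volume (ball a P) ^ 2) := by
      calc _ = ∫⁻ x in ball a P, ∫⁻ y in ball a P,
            ENNReal.ofReal (P ^ ((l : ℝ) - 2 * n)) * ‖D m x d - D m y d‖ₑ := by
            rw [← lintegral_const_mul' _ _ ENNReal.ofReal_ne_top]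
            refine lintegral_congr fun x => ?_
            rw [← lintegral_const_mul' _ _ ENNReal.ofReal_ne_top]
        _ ≤ ∫⁻ x in ball a P, ∫⁻ y in ball a P, ENNReal.ofReal (lam₀ * lam) * (W j x y * K x y +
              ENNReal.ofReal (2 * P ^ (-(n : ℝ))) * Y j) :=
            setLIntegral_mono' measurableSet_ball fun x hx =>
              setLIntegral_mono' measurableSet_ball fun y hy => hpt j d x hx y hy
        _ = ENNReal.ofReal (lam₀ * lam) * ((∫⁻ x in ball a P, ∫⁻ y in ball a P,
              W j x y * K x y) + ENNReal.ofReal (2 * P ^ (-(n : ℝ))) * Y j *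
                volume (ball a P) ^ 2) := by
            simp only [lintegral_const_mul' _ _ ENNReal.ofReal_ne_top]
            simp only [lintegral_add_right _ measurable_const, setLIntegral_const]
            ring
        _ ≤ _ := by
            refine mul_le_mul_right (add_le_add_left ?_ _) _
            refine (setLIntegral_le_lintegral _ _).trans (lintegral_mono fun x => ?_)
            exact setLIntegral_le_lintegral _ _
    have hPn : ENNReal.ofReal (P ^ n) ≠ 0 := by simp; positivity
    have hsplit : ENNReal.ofReal (P ^ l) * (volume (ball a P))⁻¹ ^ 2 =
        ω⁻¹ ^ 2 * ENNReal.ofReal (P ^ ((l : ℝ) - 2 * n)) := by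
      rw [hV, ENNReal.mul_inv (Or.inr hωt) (Or.inr hω0), mul_pow _ ω⁻¹,
        ← ENNReal.ofReal_inv_of_pos (by positivity), ← ENNReal.ofReal_pow (by positivity),
        ← mul_assoc, ← ENNReal.ofReal_mul (by positivity), mul_comm]
      congr 2
      rw [Real.rpow_sub hP, two_mul, Real.rpow_add hP, Real.rpow_natCast, Real.rpow_natCast]
      field_simp
    unfold dblOsc
    rw [← mul_assoc, hsplit, mul_assoc]
    refine (mul_le_mul_right hI _).trans (le_of_eq ?_)
    rw [hV]
    have e2 : ENNReal.ofReal (2 * P ^ (-(n : ℝ))) * ENNReal.ofReal (P ^ n) = 2 := by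
      rw [← ENNReal.ofReal_mul (by positivity), Real.rpow_neg hP.le, Real.rpow_natCast]
      rw [mul_assoc, inv_mul_cancel₀ (by positivity)]; simp
    calc _ = ENNReal.ofReal (lam₀ * lam) * (ω⁻¹ ^ 2 * (∫⁻ x, ∫⁻ y, W j x y * K x y) +
          (ω⁻¹ * ω) ^ 2 * (ENNReal.ofReal (2 * P ^ (-(n : ℝ))) * ENNReal.ofReal (P ^ n)) *
            (ENNReal.ofReal (P ^ n) * Y j)) := by ring
      _ = _ := by rw [e2, ENNReal.inv_mul_cancel hω0 hωt]; ring
  have hsumW : ∀ N : ℕ, ∑ j ∈ Finset.range N, ∫⁻ x, ∫⁻ y, W j x y * K x y ≤ Cw := by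
    intro N
    calc ∑ j ∈ Finset.range N, ∫⁻ x, ∫⁻ y, W j x y * K x y
        ≤ ∫⁻ x, ∫⁻ y, ∑ j ∈ Finset.range N, W j x y * K x y :=
          (sum_lintegral_le_lintegral_sum _ _).trans
            (lintegral_mono fun x => sum_lintegral_le_lintegral_sum _ _)
      _ ≤ ∫⁻ x, ∫⁻ y, Cw * K x y := by
          refine lintegral_mono fun x => lintegral_mono fun y => ?_
          rw [← Finset.sum_mul]
          exact mul_le_mul_left (hw N R _ hR (norm_nonneg _)) _
      _ = Cw * ∫⁻ x, ∫⁻ y, K x y := by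
          simp only [lintegral_const_mul' _ _ hCw]
      _ ≤ Cw * 1 := mul_le_mul_right hJ _
      _ = Cw := mul_one _
  refine ENNReal.tsum_le_of_sum_range_le fun N => ?_
  set S : ℝ≥0∞ := ∑' j : ℕ, ENNReal.ofReal ((4 ^ j * R) ^ n) * Y j with hS
  calc ∑ j ∈ Finset.range N, ENNReal.ofReal ((4 ^ j * R) ^ l) * derivOsc D m (ball a (4 ^ j * R))
      ≤ ∑ j ∈ Finset.range N, c * (ENNReal.ofReal (lam₀ * lam) *
          (ω⁻¹ ^ 2 * (∫⁻ x, ∫⁻ y, W j x y * K x y) +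
            2 * (ENNReal.ofReal ((4 ^ j * R) ^ n) * Y j))) := by
        refine Finset.sum_le_sum fun j _ => ?_
        unfold derivOsc
        rw [Finset.mul_sum]
        refine (Finset.sum_le_card_nsmul _ _ _ fun d _ => hint j d).trans (le_of_eq ?_)
        rw [nsmul_eq_mul, Finset.card_univ]
    _ = c * (ENNReal.ofReal (lam₀ * lam) * (ω⁻¹ ^ 2 *
          (∑ j ∈ Finset.range N, ∫⁻ x, ∫⁻ y, W j x y * K x y) +
            2 * ∑ j ∈ Finset.range N, ENNReal.ofReal ((4 ^ j * R) ^ n) * Y j)) := by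
        rw [← Finset.mul_sum, ← Finset.mul_sum, Finset.sum_add_distrib, ← Finset.mul_sum,
          ← Finset.mul_sum]
    _ ≤ c * (ENNReal.ofReal (lam₀ * lam) * (ω⁻¹ ^ 2 * Cw + 2 * S)) := by
        gcongr
        · exact hsumW N
        · exact ENNReal.sum_le_tsum _
    _ ≤ c * (ENNReal.ofReal (lam₀ * lam) * ((ω⁻¹ ^ 2 * Cw + 2) * (1 + S))) := by
        gcongr
        rw [mul_add, mul_one, add_mul]
        exact add_le_add le_self_add le_add_self
    _ = _ := by ring

/-! ### The upper bound for oscillations -/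

/-- The `n`-th root of the measure of the unit ball. -/
noncomputable def kappa (n : ℕ) : ℝ := (volume (ball (0 : Euc n) 1)).toReal ^ ((n : ℝ)⁻¹)

lemma kappa_pos (n : ℕ) : 0 < kappa n :=
  Real.rpow_pos_of_pos (ENNReal.toReal_pos (volume_ball_ne_zero 0 one_pos)
    measure_ball_lt_top.ne) _

lemma volume_ball_toReal_rpow {n : ℕ} (hn : 0 < n) (a : Euc n) {R : ℝ} (hR : 0 < R) :
    (volume (ball a R)).toReal ^ ((n : ℝ)⁻¹) = kappa n * R := by
  rw [volume_ball_euc a hR, ENNReal.toReal_mul, ENNReal.toReal_ofReal (by positivity),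
    Real.mul_rpow (by positivity) ENNReal.toReal_nonneg, ← Real.rpow_natCast,
    ← Real.rpow_mul hR.le, mul_inv_cancel₀ (by positivity), Real.rpow_one, mul_comm]
  rfl

lemma psiK_zero {n : ℕ} (s : ℝ) (A : ℝ → ℝ≥0∞) (r : ℝ) :
    psiK n s 0 A r = (r ^ ((n : ℝ) - s) * rcInv (youngF ((n : ℝ) / ((n : ℝ) - s + 1)) A)
      (ENNReal.ofReal (r ^ (-(n : ℝ)))))⁻¹ := by
  have : Fk n s 0 A = youngF ((n : ℝ) / ((n : ℝ) - s + 1)) A := by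
    funext t; simp [Fk, youngF]
  rw [psiK, this]; simp

lemma rcInv_youngF_of_intCond {n : ℕ} {s : ℝ} (hs : s ∈ Ioo (1 : ℝ) ((n : ℝ) + 1))
    {A : ℝ → ℝ≥0∞} (hA : IsYoung A) (hint : IntCondK n s 0 A) {r : ℝ} (hr : 0 < r) :
    let F := youngF ((n : ℝ) / ((n : ℝ) - s + 1)) A
    let v := ENNReal.ofReal (r ^ (-(n : ℝ)))
    0 < rcInv F v ∧ F (rcInv F v / 2) ≤ v ∧ v < F (2 * rcInv F v) := by
  have hβ : 0 < (n : ℝ) - s + 1 := by linarith [hs.2]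
  have hα : (n : ℝ) / ((n : ℝ) - s + 1) = 1 + (s - 1) / ((n : ℝ) - (s - 1)) := by
    rw [show (n : ℝ) - (s - 1) = n - s + 1 by ring]
    field_simp
    ring
  have hθ : 0 < (s - 1) / ((n : ℝ) - (s - 1)) :=
    div_pos (by linarith [hs.1]) (by linarith)
  have hv : 0 < r ^ (-(n : ℝ)) := by positivity
  intro F v
  refine hA.rcInv_youngF (by rw [hα]; positivity) ?_ (by simpa [v] using hv) ENNReal.ofReal_ne_top
  rw [hα]
  refine hA.exists_lintegral_youngConj_lt_top hθ ?_
  simpa [IntCondK] using hint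

lemma ofReal_average_le_dblOsc {n : ℕ} {f : Euc n → ℝ} (hf : LocallyIntegrable f volume)
    (a : Euc n) {R : ℝ} (hR : 0 < R) :
    ENNReal.ofReal (⨍ y in ball a R, |f y - ⨍ z in ball a R, f z|) ≤ dblOsc f (ball a R) := by
  have h0 := volume_ball_ne_zero a hR
  have ht : volume (ball a R) ≠ ⊤ := measure_ball_lt_top.ne
  have hfi : IntegrableOn f (ball a R) volume :=
    (hf.integrableOn_isCompact (isCompact_closedBall a R)).mono_set ball_subset_closedBall
  have : IsFiniteMeasure (volume.restrict (ball a R)) :=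
    ⟨by simpa using measure_ball_lt_top⟩
  have hVr : 0 < volume.real (ball a R) := ENNReal.toReal_pos h0 ht
  have hVi : ENNReal.ofReal (volume.real (ball a R))⁻¹ = (volume (ball a R))⁻¹ := by
    rw [ENNReal.ofReal_inv_of_pos hVr, measureReal_def, ENNReal.ofReal_toReal ht]
  set c := ⨍ z in ball a R, f z with hc
  have hpt : ∀ y, ‖f y - c‖ₑ ≤ (volume (ball a R))⁻¹ * ∫⁻ z in ball a R, ‖f y - f z‖ₑ := by
    intro y
    have e : f y - c = (volume.real (ball a R))⁻¹ * ∫ z in ball a R, (f y - f z) := by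
      rw [integral_sub (integrable_const _) hfi, hc, setAverage_eq, smul_eq_mul]
      simp
      field_simp
    rw [e, enorm_mul, Real.enorm_eq_ofReal (by positivity), hVi]
    exact mul_le_mul_right (enorm_integral_le_lintegral_enorm _) _
  rw [setAverage_eq, smul_eq_mul, ENNReal.ofReal_mul (by positivity), hVi]
  have hint : Integrable (fun y => |f y - c|) (volume.restrict (ball a R)) :=
    (hfi.sub (integrable_const c)).abs
  rw [ofReal_integral_eq_lintegral_ofReal hint (Eventually.of_forall fun _ => abs_nonneg _)]
  unfold dblOsc
  rw [pow_two, mul_assoc]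
  refine mul_le_mul_right ?_ _
  rw [← lintegral_const_mul' _ _ (ENNReal.inv_ne_top.2 h0)]
  refine lintegral_mono fun y => ?_
  rw [← Real.enorm_eq_ofReal_abs]
  exact hpt y

/-- The mean oscillation of `u` is controlled by `psiK n s 0 A` and the seminorm. -/
lemma exists_average_le {n : ℕ} (hn : 0 < n) {s : ℝ} (hs : s ∈ Ioo (1 : ℝ) ((n : ℝ) + 1))
    (hs2 : ∀ m : ℕ, s ≠ (m : ℝ)) {A : ℝ → ℝ≥0∞} (hA : IsYoung A) (hint : IntCondK n s 0 A) :
    ∃ C : ℝ, 0 < C ∧ ∀ (u : Euc n → ℝ) (D : (h : ℕ) → Euc n → (Fin h → Fin n) → ℝ) (lam₀ : ℝ),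
      HasWeakDerivs n ⌊s⌋₊ u D → DecayFrom n 1 ⌊s⌋₊ D → 0 < lam₀ →
      Jfun n (s - (⌊s⌋₊ : ℝ)) A (fun x i => D ⌊s⌋₊ x i / lam₀) ≤ 1 →
      ∀ (a : Euc n) (R : ℝ), 0 < R →
        (⨍ y in ball a R, |u y - ⨍ z in ball a R, u z|) ≤
          C * lam₀ * psiK n s 0 A (kappa n * R) := by
  have hs0 : 0 ≤ s := by linarith [hs.1]
  have hm1 : 1 ≤ ⌊s⌋₊ := (Nat.one_le_floor_iff _).2 hs.1.le
  have hml : (⌊s⌋₊ : ℝ) < s := lt_of_le_of_ne (Nat.floor_le hs0) (hs2 _).symm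
  have hmu : s < (⌊s⌋₊ : ℝ) + 1 := Nat.lt_floor_add_one s
  obtain ⟨l, hl⟩ : ∃ l, ⌊s⌋₊ = l + 1 := ⟨⌊s⌋₊ - 1, by omega⟩
  generalize ⌊s⌋₊ = m at *
  have hσ0 : 0 < s - m := by linarith
  have hσ1 : s - m < 1 := by linarith
  obtain ⟨C₂, hC₂, h₂⟩ := exists_derivAvg_le_tsum hn l
  obtain ⟨C₃, hC₃, h₃⟩ := exists_tsum_derivOsc_le (n := n) m l hσ0 hσ1
  set β : ℝ := (n : ℝ) - s + 1 with hβ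
  have hβ0 : 0 < β := by linarith [hs.2]
  set q : ℝ := 4 ^ (-β) with hq
  have hq0 : 0 < q := by positivity
  have hq1 : q < 1 := Real.rpow_lt_one_of_one_lt_of_neg (by norm_num) (by linarith)
  have hp : (4 : ℝ) ^ n = q ^ (-((n : ℝ) / β)) := by
    rw [hq, ← Real.rpow_mul (by norm_num), ← Real.rpow_natCast]
    congr 1
    field_simp
  have hκ := kappa_pos n
  set c₀ : ℝ≥0∞ := ENNReal.ofReal (2 ^ n * 4 ^ n * 2) * (C₂ * C₃) with hc₀
  have hc₀t : c₀ ≠ ⊤ := by finiteness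
  set c₁ : ℝ := c₀.toReal + 1 with hc₁
  have hc₁0 : 0 < c₁ := by positivity
  have hc₀₁ : c₀ ≤ ENNReal.ofReal c₁ := by
    rw [← ENNReal.ofReal_toReal hc₀t]; exact ENNReal.ofReal_le_ofReal (by linarith)
  set c₂ : ℝ := 1 + 4 ^ n / (1 - q) * kappa n ^ (-(n : ℝ)) with hc₂
  have h1q : 0 < 1 - q := by linarith
  have hc₂0 : 0 < c₂ := by positivity
  refine ⟨c₁ * c₂ * 2 * kappa n ^ ((n : ℝ) - s), by positivity, ?_⟩
  intro u D lam₀ hD hdec hlam₀ hJ a R hR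
  obtain ⟨hL0, hL1, -⟩ := rcInv_youngF_of_intCond hs hA hint (show 0 < kappa n * R by positivity)
  rw [psiK_zero]
  simp only [← hβ] at hL0 hL1 ⊢
  set F := youngF ((n : ℝ) / β) A
  set L := rcInv F (ENNReal.ofReal ((kappa n * R) ^ (-(n : ℝ))))
  set lam : ℝ := 2 * R ^ (-β) / L with hlam
  have hlam0 : 0 < lam := by positivity
  have hT : R ^ (-β) / lam = L / 2 := by rw [hlam]; field_simp
  have hu : LocallyIntegrable u volume := by
    have := (hD.2 0 (by omega) Fin.elim0).1
    simpa [hD.1] using this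
  have hosc : dblOsc u (ball a R) = derivOsc D 0 (ball a R) := by
    unfold derivOsc
    rw [Fintype.sum_unique]
    simp only [hD.1]
  have hsum : ∑' j : ℕ, ENNReal.ofReal ((4 ^ j * (4 * R)) ^ n) *
      youngConj A ((4 ^ j * (4 * R)) ^ ((l : ℝ) + (s - m) - n) / lam) ≤
      ENNReal.ofReal (4 ^ n / (1 - q) * kappa n ^ (-(n : ℝ))) := by
    have h := tsum_le_youngF hq0 hq1 (by positivity) hp A (T := L / 2) (by positivity)
    have hterm : ∀ j : ℕ, ENNReal.ofReal ((4 ^ j * (4 * R)) ^ n) *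
        youngConj A ((4 ^ j * (4 * R)) ^ ((l : ℝ) + (s - m) - n) / lam) =
        ENNReal.ofReal (R ^ n) * (ENNReal.ofReal (((4 : ℝ) ^ n) ^ (j + 1)) *
          youngConj A (L / 2 * q ^ (j + 1))) := by
      intro j
      rw [← mul_assoc (ENNReal.ofReal (R ^ n)), ← ENNReal.ofReal_mul (by positivity)]
      congr 2
      · ring
      · rw [← hT, hq, ← Real.rpow_natCast, ← Real.rpow_natCast, ← Real.rpow_mul (by norm_num),
          show (4 : ℝ) ^ (j : ℝ) * (4 * R) = 4 ^ ((j + 1 : ℕ) : ℝ) * R by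
            rw [Real.rpow_natCast, Real.rpow_natCast]; ring,
          Real.mul_rpow (by positivity) hR.le, ← Real.rpow_mul (by norm_num)]
        have e : (l : ℝ) + (s - m) - n = -β := by rw [hl, hβ]; push_cast; ring
        rw [e]
        ring_nf
    simp only [hterm]
    rw [ENNReal.tsum_mul_left]
    have h2 := h.trans hL1
    generalize (∑' j : ℕ, ENNReal.ofReal (((4 : ℝ) ^ n) ^ (j + 1)) *
          youngConj A (L / 2 * q ^ (j + 1))) = S at *
    have hx : 0 < (1 - q) / 4 ^ n := by positivity
    have h3 : S ≤ ENNReal.ofReal (4 ^ n / (1 - q)) * ENNReal.ofReal ((kappa n * R) ^ (-(n : ℝ))) := by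
      rw [show (4 : ℝ) ^ n / (1 - q) = ((1 - q) / 4 ^ n)⁻¹ by rw [inv_div],
        ENNReal.ofReal_inv_of_pos hx]
      rw [mul_comm, ← div_eq_mul_inv]
      rw [ENNReal.le_div_iff_mul_le (by left; simpa using hx) (by left; exact ENNReal.ofReal_ne_top)]
      rwa [mul_comm]
    refine (mul_le_mul_right h3 _).trans (le_of_eq ?_)
    rw [← ENNReal.ofReal_mul (by positivity), ← ENNReal.ofReal_mul (by positivity)]
    congr 1
    rw [Real.mul_rpow hκ.le hR.le, Real.rpow_neg hR.le, Real.rpow_natCast]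
    field_simp
  have hmain : ENNReal.ofReal (⨍ y in ball a R, |u y - ⨍ z in ball a R, u z|) ≤
      ENNReal.ofReal (c₁ * (R * (lam₀ * lam) * c₂)) := by
    refine (ofReal_average_le_dblOsc hu a hR).trans ?_
    rw [hosc]
    refine (derivOsc_le_derivAvg hD (by omega) a hR).trans ?_
    have hA2 := h₂ m 1 u D hD hdec le_rfl (by omega) a (4 * R) (by positivity)
    have hA3 := h₃ A D a (4 * R) lam₀ lam (by positivity) hlam₀ hlam0 hJ
    calc _ ≤ ENNReal.ofReal (2 ^ n * 4 ^ n * 2) * (ENNReal.ofReal R * (C₂ *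
          (C₃ * ENNReal.ofReal (lam₀ * lam) * (1 + ENNReal.ofReal
            (4 ^ n / (1 - q) * kappa n ^ (-(n : ℝ))))))) := by
          refine mul_le_mul_right (mul_le_mul_right (hA2.trans (mul_le_mul_right (hA3.trans ?_) _)) _) _
          exact mul_le_mul_right (add_le_add_right hsum _) _
      _ = c₀ * ENNReal.ofReal (R * (lam₀ * lam) * c₂) := by
          rw [hc₂, ENNReal.ofReal_mul (q := 1 + _) (by positivity),
            ENNReal.ofReal_mul hR.le, ENNReal.ofReal_add zero_le_one (by positivity), hc₀]
          simp only [ENNReal.ofReal_one]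
          ring
      _ ≤ _ := by
          rw [ENNReal.ofReal_mul hc₁0.le]
          exact mul_le_mul_left hc₀₁ _
  rw [ENNReal.ofReal_le_ofReal_iff (by positivity)] at hmain
  refine hmain.trans (le_of_eq ?_)
  rw [hlam, Real.mul_rpow hκ.le hR.le]
  have e : R ^ (-β) = (R ^ ((n : ℝ) - s))⁻¹ * R⁻¹ := by
    rw [hβ, Real.rpow_neg hR.le, Real.rpow_add hR, Real.rpow_one, mul_inv]
  rw [e]
  have h1 : 0 < R ^ ((n : ℝ) - s) := by positivity
  have h2 : 0 < kappa n ^ ((n : ℝ) - s) := by positivity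
  field_simp

/-! ### Almost optimal coefficients in the definition of the conjugate -/

lemma exists_lt_sum_of_lt_sum_iSup {ι κ : Type*} [Nonempty κ] (J : Finset ι) (w : ι → ℝ≥0∞)
    (hw : ∀ i, w i ≠ ⊤) (f : ι → κ → ℝ≥0∞) {c : ℝ≥0∞} (hc : c < ∑ i ∈ J, w i * ⨆ k, f i k) :
    ∃ k : ι → κ, c < ∑ i ∈ J, w i * f i (k i) := by
  have h : ∀ i, ∃ k : ℕ → κ, Tendsto (fun l => f i (k l)) atTop (𝓝 (⨆ k, f i k)) := by
    intro i
    obtain ⟨g, -, hg, hgr⟩ := exists_seq_tendsto_sSup (range_nonempty (f i)) (OrderTop.bddAbove _)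
    choose k hk using hgr
    exact ⟨k, by simpa only [hk, sSup_range] using hg⟩
  choose k hk using h
  have hlim : Tendsto (fun l => ∑ i ∈ J, w i * f i (k i l)) atTop
      (𝓝 (∑ i ∈ J, w i * ⨆ k, f i k)) :=
    tendsto_finsetSum _ fun i _ => ENNReal.Tendsto.const_mul (hk i) (Or.inr (hw i))
  obtain ⟨l, hl⟩ := (hlim.eventually (lt_mem_nhds hc)).exists
  exact ⟨fun i => k i l, hl⟩

lemma IsYoung.exists_coeff {A : ℝ → ℝ≥0∞} (hA : IsYoung A) {w b : ℕ → ℝ} (hw : ∀ j, 0 ≤ w j)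
    (hb : ∀ j, 0 ≤ b j) {c' c₀ : ℝ} (hc' : 0 < c') (hc₀ : 0 < c₀)
    (h : ENNReal.ofReal c' < ∑' j, ENNReal.ofReal (w j) * youngConj A (b j)) :
    ∃ (N : ℕ) (t : ℕ → ℝ), (∀ j, 0 ≤ t j) ∧
      ∑ j ∈ Finset.range N, ENNReal.ofReal (w j) * A (t j) ≤ ENNReal.ofReal c₀ ∧
      min c' c₀ ≤ ∑ j ∈ Finset.range N, w j * (t j * b j) := by
  rw [ENNReal.tsum_eq_iSup_nat, lt_iSup_iff] at h
  obtain ⟨N, hN⟩ := h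
  have hconj : ∀ j, youngConj A (b j) =
      ⨆ τ : {τ : ℝ // 0 ≤ τ}, ENNReal.ofReal (τ * b j) - A τ := fun j => by
    rw [youngConj, iSup_subtype]
  simp only [hconj] at hN
  have : Nonempty {τ : ℝ // 0 ≤ τ} := ⟨⟨0, le_rfl⟩⟩
  obtain ⟨k, hk⟩ := exists_lt_sum_of_lt_sum_iSup _ _ (fun _ => ENNReal.ofReal_ne_top) _ hN
  classical
  set t : ℕ → ℝ := fun j => if A (k j) ≤ ENNReal.ofReal (k j * b j) then (k j : ℝ) else 0 with ht
  have ht0 : ∀ j, 0 ≤ t j := fun j => by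
    simp only [ht]; split_ifs
    · exact (k j).2
    · exact le_rfl
  have htle : ∀ j, A (t j) ≤ ENNReal.ofReal (t j * b j) := fun j => by
    simp only [ht]; split_ifs with h
    · exact h
    · simp [hA.1]
  have hte : ∀ j, ENNReal.ofReal (k j * b j) - A (k j) + A (t j) =
      ENNReal.ofReal (t j * b j) := fun j => by
    by_cases h : A (k j) ≤ ENNReal.ofReal (k j * b j)
    · simp only [ht, if_pos h]; exact tsub_add_cancel_of_le h
    · simp only [ht, if_neg h, hA.1, tsub_eq_zero_of_le (not_le.1 h).le]; simp
  have hAt : ∀ j, A (t j) ≠ ⊤ := fun j => ((htle j).trans_lt ENNReal.ofReal_lt_top).ne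
  set X : ℝ := ∑ j ∈ Finset.range N, w j * (t j * b j) with hX
  set Y : ℝ := ∑ j ∈ Finset.range N, w j * (A (t j)).toReal with hY
  have hY0 : 0 ≤ Y := Finset.sum_nonneg fun j _ => mul_nonneg (hw j) ENNReal.toReal_nonneg
  have hYe : ∑ j ∈ Finset.range N, ENNReal.ofReal (w j) * A (t j) = ENNReal.ofReal Y := by
    rw [hY, ENNReal.ofReal_sum_of_nonneg fun j _ => mul_nonneg (hw j) ENNReal.toReal_nonneg]
    refine Finset.sum_congr rfl fun j _ => ?_
    rw [ENNReal.ofReal_mul (hw j), ENNReal.ofReal_toReal (hAt j)]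
  have hXe : ∑ j ∈ Finset.range N, ENNReal.ofReal (w j) * ENNReal.ofReal (t j * b j) =
      ENNReal.ofReal X := by
    rw [hX, ENNReal.ofReal_sum_of_nonneg fun j _ =>
      mul_nonneg (hw j) (mul_nonneg (ht0 j) (hb j))]
    exact Finset.sum_congr rfl fun j _ => (ENNReal.ofReal_mul (hw j)).symm
  have hX0 : 0 ≤ X := Finset.sum_nonneg fun j _ => mul_nonneg (hw j) (mul_nonneg (ht0 j) (hb j))
  have hXY : c' + Y ≤ X := by
    have h1 : ENNReal.ofReal c' + ENNReal.ofReal Y ≤ ENNReal.ofReal X := by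
      rw [← hYe, ← hXe]
      refine (add_le_add_left hk.le _).trans (le_of_eq ?_)
      rw [← Finset.sum_add_distrib]
      exact Finset.sum_congr rfl fun j _ => by rw [← mul_add, hte]
    rwa [← ENNReal.ofReal_add hc'.le hY0, ENNReal.ofReal_le_ofReal_iff hX0] at h1
  by_cases hYc : Y ≤ c₀
  · exact ⟨N, t, ht0, hYe ▸ ENNReal.ofReal_le_ofReal hYc, (min_le_left _ _).trans (by linarith)⟩
  · rw [not_le] at hYc
    have hYpos : 0 < Y := hc₀.trans hYc
    have hθ1 : c₀ / Y ≤ 1 := (div_le_one hYpos).2 hYc.le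
    refine ⟨N, fun j => c₀ / Y * t j, fun j => mul_nonneg (by positivity) (ht0 j), ?_, ?_⟩
    · calc _ ≤ ∑ j ∈ Finset.range N, ENNReal.ofReal (c₀ / Y) * (ENNReal.ofReal (w j) * A (t j)) := by
            refine Finset.sum_le_sum fun j _ => ?_
            rw [mul_left_comm]
            exact mul_le_mul_right (hA.mul_le (by positivity) hθ1 (ht0 j)) _
        _ = ENNReal.ofReal (c₀ / Y * Y) := by
            rw [← Finset.mul_sum, hYe, ENNReal.ofReal_mul (by positivity)]
        _ = _ := by rw [div_mul_cancel₀ _ hYpos.ne']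
    · refine (min_le_right _ _).trans ?_
      calc c₀ = c₀ / Y * Y := by rw [div_mul_cancel₀ _ hYpos.ne']
        _ ≤ c₀ / Y * X := mul_le_mul_of_nonneg_left (by linarith) (by positivity)
        _ = _ := by
            rw [hX, Finset.mul_sum]
            exact Finset.sum_congr rfl fun j _ => by ring

section

/-! ### Classical derivatives of compactly supported smooth functions -/

/-- The partial derivatives of a smooth function, as a family of candidate weak derivatives. -/
noncomputable def classicalDerivs {n : ℕ} (u : Euc n → ℝ) (h : ℕ) (x : Euc n)
    (d : Fin h → Fin n) : ℝ :=
  iteratedFDeriv ℝ h u x fun i => EuclideanSpace.single (d (Fin.rev i)) 1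

lemma iteratedFDeriv_fderiv_single {n : ℕ} {φ : Euc n → ℝ} (hφ : ContDiff ℝ (⊤ : ℕ∞) φ) {h : ℕ}
    (d : Fin (h + 1) → Fin n) (x : Euc n) :
    iteratedFDeriv ℝ h (fun x => fderiv ℝ φ x (EuclideanSpace.single (d (Fin.last h)) 1)) x
        (fun j => EuclideanSpace.single (d j.castSucc) (1 : ℝ)) =
      iteratedFDeriv ℝ (h + 1) φ x fun j => EuclideanSpace.single (d j) (1 : ℝ) := by
  rw [iteratedFDeriv_succ_apply_right]
  have e : (fun x => fderiv ℝ φ x (EuclideanSpace.single (d (Fin.last h)) 1)) =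
      (ContinuousLinearMap.apply ℝ ℝ (EuclideanSpace.single (d (Fin.last h)) (1 : ℝ))) ∘
        fderiv ℝ φ := rfl
  rw [e, ContinuousLinearMap.iteratedFDeriv_comp_left _
    (hφ.fderiv_right (m := (⊤ : ℕ∞)) (by simp)).contDiffAt (by exact_mod_cast le_top)]
  simp [Fin.init_def]

variable {n : ℕ} {u : Euc n → ℝ}

lemma contDiff_classicalDerivs (hu : ContDiff ℝ (⊤ : ℕ∞) u) (h : ℕ) (d : Fin h → Fin n) :
    ContDiff ℝ (⊤ : ℕ∞) fun x => classicalDerivs u h x d := by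
  have h1 : ContDiff ℝ (⊤ : ℕ∞) (iteratedFDeriv ℝ h u) :=
    hu.iteratedFDeriv_right (by exact_mod_cast le_top)
  exact (ContinuousMultilinearMap.apply ℝ (fun _ : Fin h => Euc n) ℝ _).contDiff.comp h1

lemma hasCompactSupport_classicalDerivs (hc : HasCompactSupport u) (h : ℕ) (d : Fin h → Fin n) :
    HasCompactSupport fun x => classicalDerivs u h x d :=
  (hc.iteratedFDeriv (𝕜 := ℝ) h).comp_left
    (g := fun F : ContinuousMultilinearMap ℝ (fun _ : Fin h => Euc n) ℝ =>
      F fun i => EuclideanSpace.single (d (Fin.rev i)) 1) rfl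

lemma fderiv_classicalDerivs (hu : ContDiff ℝ (⊤ : ℕ∞) u) {h : ℕ} (d : Fin (h + 1) → Fin n)
    (x : Euc n) :
    fderiv ℝ (fun x => classicalDerivs u h x fun i => d i.castSucc) x
        (EuclideanSpace.single (d (Fin.last h)) 1) = classicalDerivs u (h + 1) x d := by
  have h1 : ContDiff ℝ (⊤ : ℕ∞) (iteratedFDeriv ℝ h u) :=
    hu.iteratedFDeriv_right (by exact_mod_cast le_top)
  have h2 := (ContinuousMultilinearMap.apply ℝ (fun _ : Fin h => Euc n) ℝ
    (fun i => EuclideanSpace.single (d (Fin.rev i).castSucc) 1)).hasFDerivAt.comp x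
      ((h1.differentiable (by simp)) x).hasFDerivAt
  rw [show (fun x => classicalDerivs u h x fun i => d i.castSucc) =
    (ContinuousMultilinearMap.apply ℝ (fun _ : Fin h => Euc n) ℝ
    (fun i => EuclideanSpace.single (d (Fin.rev i).castSucc) 1)) ∘ iteratedFDeriv ℝ h u from rfl,
    h2.fderiv, classicalDerivs, iteratedFDeriv_succ_apply_left]
  simp [Fin.tail_def, Fin.rev_succ]

lemma hasWeakDerivs_classicalDerivs (hu : ContDiff ℝ (⊤ : ℕ∞) u) (hc : HasCompactSupport u)
    (m : ℕ) : HasWeakDerivs n m u (classicalDerivs u) := by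
  refine ⟨fun x d => by simp [classicalDerivs], fun h _ d =>
    ⟨(contDiff_classicalDerivs hu h d).continuous.locallyIntegrable, ?_⟩⟩
  clear * - hu hc
  induction h with
  | zero => intro φ _ _; simp [classicalDerivs]
  | succ h ih =>
    intro φ hφ hφc
    have hdφ : ContDiff ℝ (⊤ : ℕ∞)
        fun x => fderiv ℝ φ x (EuclideanSpace.single (d (Fin.last h)) 1) :=
      (hφ.fderiv_right (m := (⊤ : ℕ∞)) (by simp)).clm_apply contDiff_const
    have h1 := ih (fun i => d i.castSucc) _ hdφ (hφc.fderiv_apply (𝕜 := ℝ) _)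
    simp only [iteratedFDeriv_fderiv_single hφ d] at h1
    have hg := contDiff_classicalDerivs hu h fun i => d i.castSucc
    have hgc := hasCompactSupport_classicalDerivs hc h fun i => d i.castSucc
    have hdg : Continuous fun x => fderiv ℝ (fun x => classicalDerivs u h x fun i => d i.castSucc) x
        (EuclideanSpace.single (d (Fin.last h)) 1) :=
      (hg.continuous_fderiv (by simp)).clm_apply continuous_const
    rw [h1, integral_mul_fderiv_eq_neg_fderiv_mul_of_integrable
      ((hdg.mul hφ.continuous).integrable_of_hasCompactSupport hφc.mul_left)
      ((hg.continuous.mul hdφ.continuous).integrable_of_hasCompactSupport hgc.mul_right)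
      ((hg.continuous.mul hφ.continuous).integrable_of_hasCompactSupport hgc.mul_right)
      (fun x _ => hg.differentiable (by simp) x) (fun x _ => hφ.differentiable (by simp) x)]
    simp only [fderiv_classicalDerivs hu d]
    rw [pow_succ]; ring

lemma decayFrom_classicalDerivs (hc : HasCompactSupport u) (k m : ℕ) :
    DecayFrom n k m (classicalDerivs u) := by
  intro h _ _ t ht
  refine (measure_mono ?_).trans_lt (IsCompact.measure_lt_top (hc.iteratedFDeriv (𝕜 := ℝ) h))
  intro x hx
  by_contra hn
  have h0 : iteratedFDeriv ℝ h u x = 0 := image_eq_zero_of_notMem_tsupport hn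
  simp [gradLen, classicalDerivs, h0] at hx
  exact absurd hx (not_lt.2 ht.le)

end

/-! ### The dyadic kernels -/

/-- The weight `ω(b) = b^{-σ} min (1, b)`. -/
noncomputable def cutWeight (σ b : ℝ) : ℝ := b ^ (-σ) * min 1 b

lemma cutWeight_nonneg (σ : ℝ) {b : ℝ} (hb : 0 ≤ b) : 0 ≤ cutWeight σ b :=
  mul_nonneg (Real.rpow_nonneg hb _) (le_min zero_le_one hb)

@[fun_prop]
lemma measurable_cutWeight (σ : ℝ) : Measurable (cutWeight σ) := by
  unfold cutWeight; fun_prop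

/-- The kernel `ω(|z|/P) |z|^{-n}`. -/
noncomputable def cutKernel (n : ℕ) (σ P : ℝ) (z : Euc n) : ℝ≥0∞ :=
  ENNReal.ofReal (cutWeight σ (‖z‖ / P)) / ENNReal.ofReal (‖z‖ ^ (n : ℝ))

@[fun_prop]
lemma measurable_cutKernel (n : ℕ) (σ P : ℝ) : Measurable (cutKernel n σ P) := by
  unfold cutKernel; fun_prop

lemma integrableOn_cutWeight_div {σ : ℝ} (hσ : 0 < σ) (hσ1 : σ < 1) :
    IntegrableOn (fun y => cutWeight σ y / y) (Ioi 0) := by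
  rw [← Ioc_union_Ioi_eq_Ioi zero_le_one, integrableOn_union]
  constructor
  · have h : IntegrableOn (fun y : ℝ => y ^ (-σ)) (Ioc 0 1) :=
      (intervalIntegrable_iff_integrableOn_Ioc_of_le zero_le_one).1
        (intervalIntegral.intervalIntegrable_rpow' (by linarith))
    refine h.congr_fun (fun y hy => ?_) measurableSet_Ioc
    simp only [cutWeight, min_eq_right hy.2]
    rw [mul_div_cancel_right₀ _ hy.1.ne']
  · have h : IntegrableOn (fun y : ℝ => y ^ (-σ - 1)) (Ioi 1) :=
      integrableOn_Ioi_rpow_of_lt (by linarith) one_pos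
    refine h.congr_fun (fun y (hy : 1 < y) => ?_) measurableSet_Ioi
    simp only [cutWeight, min_eq_left hy.le]
    rw [Real.rpow_sub_one (by linarith), mul_one]

lemma lintegral_cutKernel_one_lt_top {n : ℕ} (hn : 0 < n) {σ : ℝ} (hσ : 0 < σ) (hσ1 : σ < 1) :
    ∫⁻ z, cutKernel n σ 1 z < ⊤ := by
  have : Nonempty (Fin n) := ⟨⟨0, hn⟩⟩
  have : Nontrivial (Euc n) := inferInstance
  have hi : Integrable (fun z : Euc n => (fun y : ℝ => cutWeight σ y / y ^ (n : ℝ)) ‖z‖) := by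
    refine (integrable_fun_norm_addHaar (volume : Measure (Euc n))
      (f := fun y : ℝ => cutWeight σ y / y ^ (n : ℝ))).2 ?_
    refine (integrableOn_cutWeight_div hσ hσ1).congr_fun (fun y (hy : 0 < y) => ?_)
      measurableSet_Ioi
    obtain ⟨k, rfl⟩ := Nat.exists_eq_succ_of_ne_zero hn.ne'
    simp only [finrank_euclideanSpace, Fintype.card_fin, smul_eq_mul, Real.rpow_natCast,
      Nat.succ_sub_one, pow_succ]
    field_simp
  refine lt_of_le_of_lt (le_of_eq (lintegral_congr_ae ?_)) hi.hasFiniteIntegral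
  have h0 : ∀ᵐ z : Euc n, z ≠ 0 := by simp [ae_iff]
  filter_upwards [h0] with z hz
  have hz' : 0 < ‖z‖ := norm_pos_iff.2 hz
  rw [cutKernel, div_one, Real.enorm_eq_ofReal, ENNReal.ofReal_div_of_pos (by positivity)]
  exact div_nonneg (cutWeight_nonneg _ hz'.le) (by positivity)

lemma lintegral_cutKernel (n : ℕ) (σ : ℝ) {P : ℝ} (hP : 0 < P) :
    ∫⁻ z, cutKernel n σ P z = ∫⁻ z, cutKernel n σ 1 z := by
  have h := (volume : Measure (Euc n)).map_addHaar_smul hP.ne'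
  have h2 : ∫⁻ z, cutKernel n σ P (P • z) =
      ENNReal.ofReal |(P ^ n)⁻¹| * ∫⁻ z, cutKernel n σ P z := by
    have := lintegral_map (μ := (volume : Measure (Euc n))) (measurable_cutKernel n σ P)
      (measurable_const_smul P)
    rw [h] at this
    rw [← this, lintegral_smul_measure]
    simp
  have h3 : ∀ z, cutKernel n σ P (P • z) = ENNReal.ofReal |(P ^ n)⁻¹| * cutKernel n σ 1 z := by
    intro z
    have hPn : 0 < P ^ n := by positivity
    simp only [cutKernel, norm_smul, Real.norm_of_nonneg hP.le, mul_div_cancel_left₀ _ hP.ne',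
      div_one]
    rw [Real.mul_rpow hP.le (norm_nonneg _), Real.rpow_natCast, ENNReal.ofReal_mul hPn.le,
      abs_of_nonneg (by positivity), ENNReal.ofReal_inv_of_pos hPn, div_eq_mul_inv, div_eq_mul_inv,
      ENNReal.mul_inv (Or.inl (by simpa using hPn)) (Or.inl ENNReal.ofReal_ne_top)]
    ring
  simp only [h3] at h2
  rw [lintegral_const_mul _ (measurable_cutKernel n σ 1)] at h2
  exact ((ENNReal.mul_right_inj (by simp [hP.ne']) ENNReal.ofReal_ne_top).1 h2).symm

lemma lintegral_lintegral_indicator_cutKernel {n : ℕ} (σ : ℝ) {P : ℝ} (hP : 0 < P) {E : Set (Euc n)}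
    (hE : MeasurableSet E) :
    ∫⁻ x, ∫⁻ y, (E.indicator 1 x + E.indicator 1 y) * cutKernel n σ P (x - y) =
      2 * (volume E * ∫⁻ z, cutKernel n σ 1 z) := by
  have hm : Measurable (E.indicator (1 : Euc n → ℝ≥0∞)) := measurable_one.indicator hE
  have h1 : ∀ x : Euc n, ∫⁻ y, cutKernel n σ P (x - y) = ∫⁻ z, cutKernel n σ 1 z := fun x => by
    rw [lintegral_sub_left_eq_self (cutKernel n σ P) x, lintegral_cutKernel n σ hP]
  have h2 : ∀ y : Euc n, ∫⁻ x, cutKernel n σ P (x - y) = ∫⁻ z, cutKernel n σ 1 z := fun y => by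
    rw [lintegral_sub_right_eq_self (cutKernel n σ P) y, lintegral_cutKernel n σ hP]
  have e1 : ∫⁻ x, ∫⁻ y, E.indicator 1 x * cutKernel n σ P (x - y) =
      volume E * ∫⁻ z, cutKernel n σ 1 z := by
    have h3 : ∀ x, ∫⁻ y, E.indicator 1 x * cutKernel n σ P (x - y) =
        E.indicator 1 x * ∫⁻ z, cutKernel n σ 1 z := fun x => by
      rw [lintegral_const_mul _ (by fun_prop), h1]
    simp_rw [h3]
    rw [lintegral_mul_const _ hm, lintegral_indicator_one hE]
  have e2 : ∫⁻ x, ∫⁻ y, E.indicator 1 y * cutKernel n σ P (x - y) =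
      volume E * ∫⁻ z, cutKernel n σ 1 z := by
    rw [lintegral_lintegral_swap]
    · have h3 : ∀ y, ∫⁻ x, E.indicator 1 y * cutKernel n σ P (x - y) =
          E.indicator 1 y * ∫⁻ z, cutKernel n σ 1 z := fun y => by
        rw [lintegral_const_mul _ (by fun_prop), h2]
      simp_rw [h3]
      rw [lintegral_mul_const _ hm, lintegral_indicator_one hE]
    · exact ((hm.comp measurable_snd).mul (by fun_prop)).aemeasurable
  have : ∀ x : Euc n, ∫⁻ y, (E.indicator 1 x + E.indicator 1 y) * cutKernel n σ P (x - y) =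
      (∫⁻ y, E.indicator 1 x * cutKernel n σ P (x - y)) +
        ∫⁻ y, E.indicator 1 y * cutKernel n σ P (x - y) := fun x => by
    simp_rw [add_mul]
    exact lintegral_add_left (by fun_prop) _
  simp_rw [this]
  rw [lintegral_add_left, e1, e2, two_mul]
  exact Measurable.lintegral_prod_right' (f := fun p : Euc n × Euc n =>
    E.indicator 1 p.1 * cutKernel n σ P (p.1 - p.2)) ((hm.comp measurable_fst).mul (by fun_prop))

section

/-! ### The energy of dyadic superpositions -/

lemma sum_cutWeight_le {σ : ℝ} (hσ : 0 < σ) (hσ1 : σ < 1) :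
    ∃ W : ℝ, 1 ≤ W ∧ ∀ (N : ℕ) (R ρ : ℝ), 0 < R → 0 < ρ →
      ∑ j ∈ Finset.range N, cutWeight σ (ρ / (4 ^ j * R)) ≤ W := by
  set p : ℝ := 4 ^ σ with hp
  set q : ℝ := 4 ^ (σ - 1) with hq
  have hp1 : 1 < p := Real.one_lt_rpow (by norm_num) hσ
  have hq0 : 0 < q := by positivity
  have hq1 : q < 1 := Real.rpow_lt_one_of_one_lt_of_neg (by norm_num) (by linarith)
  have hA : 1 ≤ (1 - p⁻¹)⁻¹ := by
    have h1 : p⁻¹ < 1 := inv_lt_one_of_one_lt₀ hp1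
    have h2 : 0 < p⁻¹ := by positivity
    exact (one_le_inv₀ (by linarith)).2 (by linarith)
  have hB : 0 ≤ (1 - q)⁻¹ := inv_nonneg.2 (by linarith)
  refine ⟨(1 - p⁻¹)⁻¹ + (1 - q)⁻¹, by linarith, fun N R ρ hR hρ => ?_⟩
  set b0 : ℝ := (R / ρ) ^ σ with hb0
  set b1 : ℝ := (ρ / R) ^ (1 - σ) with hb1
  have h1 := sum_geometric_cutoff_le' hp1 N (b := b0) (by positivity)
  have h2 := sum_geometric_cutoff_le hq0 hq1 N (b := b1) (by positivity)
  have h3 : min 1 b1 * (1 - q)⁻¹ ≤ (1 - q)⁻¹ := mul_le_of_le_one_left hB (min_le_left _ _)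
  refine le_trans ?_ (add_le_add h1 (h2.trans h3))
  rw [← Finset.sum_add_distrib]
  refine Finset.sum_le_sum fun j _ => ?_
  have hP : 0 < (4 : ℝ) ^ j * R := by positivity
  set b : ℝ := ρ / (4 ^ j * R) with hb
  have hbpos : 0 < b := by positivity
  have e0 : p ^ j * b0 = b ^ (-σ) := by
    rw [hp, ← Real.rpow_natCast (4 ^ σ) j, ← Real.rpow_mul (by norm_num), mul_comm σ,
      Real.rpow_mul (by norm_num), Real.rpow_natCast, hb0,
      ← Real.mul_rpow (by positivity) (by positivity), Real.rpow_neg hbpos.le,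
      ← Real.inv_rpow hbpos.le, hb]
    congr 1; field_simp
  have e1 : q ^ j * b1 = b ^ (1 - σ) := by
    rw [hq, ← Real.rpow_natCast (4 ^ (σ - 1)) j, ← Real.rpow_mul (by norm_num), mul_comm (σ - 1),
      Real.rpow_mul (by norm_num), Real.rpow_natCast, hb1, ← neg_sub 1 σ,
      Real.rpow_neg (by positivity), ← Real.inv_rpow (by positivity),
      ← Real.mul_rpow (by positivity) (by positivity), hb]
    congr 1; field_simp
  have n0 : 0 ≤ if p ^ j * b0 ≤ 1 then p ^ j * b0 else 0 := by
    split_ifs <;> positivity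
  have n1 : 0 ≤ if q ^ j * b1 ≤ 1 then q ^ j * b1 else 0 := by
    split_ifs <;> positivity
  rcases le_total 1 b with h | h
  · have : b ^ (-σ) ≤ 1 := Real.rpow_le_one_of_one_le_of_nonpos h (by linarith)
    rw [cutWeight, min_eq_left h, mul_one]
    rw [e0, if_pos this] at *
    linarith
  · have : b ^ (1 - σ) ≤ 1 := Real.rpow_le_one hbpos.le h (by linarith)
    rw [cutWeight, min_eq_right h]
    have e2 : b ^ (-σ) * b = b ^ (1 - σ) := by
      rw [← Real.rpow_add_one hbpos.ne']; congr 1; ring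
    rw [e2]
    rw [e1, if_pos this] at *
    linarith

lemma sqrt_sum_sq_le_sum_abs {ι : Type*} (J : Finset ι) (a : ι → ℝ) :
    Real.sqrt (∑ i ∈ J, a i ^ 2) ≤ ∑ i ∈ J, |a i| := by
  rw [Real.sqrt_le_left (Finset.sum_nonneg fun i _ => abs_nonneg _)]
  simpa only [sq_abs] using Finset.sum_sq_le_sq_sum_of_nonneg (s := J) (f := fun i => |a i|)
    (fun i _ => abs_nonneg _)

/-- A profile with bounded, Lipschitz components supported in `closedBall 0 2`. -/
structure IsProfile {n : ℕ} {ι : Type} [Fintype ι] (G : Euc n → ι → ℝ) (M : ℝ) : Prop where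
  pos : 0 < M
  sum_abs_le : ∀ x y, ∑ d, |G x d - G y d| ≤ M * min 1 ‖x - y‖
  eq_zero : ∀ x, 2 < ‖x‖ → G x = 0

variable {n : ℕ} {ι : Type} [Fintype ι] {G : Euc n → ι → ℝ} {M : ℝ}

open scoped Classical in
lemma IsProfile.scaled_diff_le (hG : IsProfile G M) {σ P : ℝ} (hP : 0 < P) (x y : Euc n)
    (hxy : x ≠ y) :
    P ^ σ * (∑ d, |G (P⁻¹ • x) d - G (P⁻¹ • y) d|) / ‖x - y‖ ^ σ ≤
      M * ((if x ∈ closedBall 0 (2 * P) ∨ y ∈ closedBall 0 (2 * P) then 1 else 0) *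
        cutWeight σ (‖x - y‖ / P)) := by
  have hρ : 0 < ‖x - y‖ := norm_pos_iff.2 (sub_ne_zero.2 hxy)
  have hz : ∀ x : Euc n, x ∉ closedBall 0 (2 * P) → G (P⁻¹ • x) = 0 := fun x hx => by
    refine hG.eq_zero _ ?_
    rw [mem_closedBall_zero_iff, not_le] at hx
    rw [norm_smul, norm_inv, Real.norm_of_nonneg hP.le, inv_mul_eq_div, lt_div_iff₀ hP]
    exact hx
  split_ifs with h
  · have h1 := hG.sum_abs_le (P⁻¹ • x) (P⁻¹ • y)
    rw [← smul_sub, norm_smul, norm_inv, Real.norm_of_nonneg hP.le, inv_mul_eq_div] at h1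
    have e : P ^ σ / ‖x - y‖ ^ σ = (‖x - y‖ / P) ^ (-σ) := by
      rw [Real.rpow_neg (by positivity), ← Real.inv_rpow (by positivity), inv_div,
        Real.div_rpow hP.le hρ.le]
    rw [mul_div_right_comm, e, one_mul, cutWeight, mul_left_comm]
    exact mul_le_mul_of_nonneg_left h1 (by positivity)
  · rw [not_or] at h
    simp [hz _ h.1, hz _ h.2]

/-- The energy of a dyadic superposition of rescaled copies of a profile. -/
lemma exists_Jfun_dyadic_le (hn : 0 < n) {σ : ℝ} (hσ : 0 < σ) (hσ1 : σ < 1) {A : ℝ → ℝ≥0∞}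
    (hA : IsYoung A) (hG : IsProfile G M) :
    ∃ C₃ C₄ : ℝ, 0 < C₃ ∧ 0 < C₄ ∧ ∀ (N : ℕ) (R : ℝ) (c : ℕ → ℝ), 0 < R → (∀ j, 0 ≤ c j) →
      Jfun n σ A (fun x d => ∑ j ∈ Finset.range N,
        c j * (4 ^ j * R) ^ σ * G ((4 ^ j * R)⁻¹ • x) d) ≤
      ENNReal.ofReal C₃ * ∑ j ∈ Finset.range N,
        ENNReal.ofReal ((4 ^ j * R) ^ n) * A (C₄ * c j) := by
  have : Nonempty (Fin n) := ⟨⟨0, hn⟩⟩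
  have : Nontrivial (Euc n) := inferInstance
  obtain ⟨W, hW1, hW⟩ := sum_cutWeight_le hσ hσ1
  have hW0 : 0 < W := by linarith
  set K := ∫⁻ z, cutKernel n σ 1 z with hK
  have hKt : K ≠ ⊤ := (lintegral_cutKernel_one_lt_top hn hσ hσ1).ne
  set V := volume (ball (0 : Euc n) 1) with hV
  have hVt : V ≠ ⊤ := measure_ball_lt_top.ne
  set Z : ℝ≥0∞ := 2 * (ENNReal.ofReal (2 ^ n) * V * K) with hZ
  have hZt : Z ≠ ⊤ := by finiteness
  refine ⟨Z.toReal + 1, M * W, by positivity, mul_pos hG.pos hW0, fun N R c hR hc => ?_⟩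
  set P : ℕ → ℝ := fun j => 4 ^ j * R with hPdef
  have hP : ∀ j, 0 < P j := fun j => by positivity
  set E : ℕ → Set (Euc n) := fun j => closedBall 0 (2 * P j) with hE
  have hEm : ∀ j, MeasurableSet (E j) := fun j => measurableSet_closedBall
  classical
  have hpt : ∀ x y : Euc n,
      A (Real.sqrt (∑ d, ((∑ j ∈ Finset.range N, c j * P j ^ σ * G ((P j)⁻¹ • x) d) -
        (∑ j ∈ Finset.range N, c j * P j ^ σ * G ((P j)⁻¹ • y) d)) ^ 2) / ‖x - y‖ ^ σ) /
        ENNReal.ofReal (‖x - y‖ ^ (n : ℝ)) ≤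
      ∑ j ∈ Finset.range N, A (M * W * c j) *
        (((E j).indicator 1 x + (E j).indicator 1 y) * cutKernel n σ (P j) (x - y)) := by
    intro x y
    rcases eq_or_ne x y with rfl | hxy
    · simp [hA.1]
    have hρ : 0 < ‖x - y‖ := norm_pos_iff.2 (sub_ne_zero.2 hxy)
    set w : ℕ → ℝ := fun j => (if x ∈ E j ∨ y ∈ E j then 1 else 0) *
      cutWeight σ (‖x - y‖ / P j) with hw
    have hw0 : ∀ j, 0 ≤ w j := fun j => by
      have := cutWeight_nonneg σ (b := ‖x - y‖ / P j) (div_nonneg hρ.le (hP j).le)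
      simp only [hw]; split_ifs <;> simp [this]
    have hwle : ∀ j, w j ≤ cutWeight σ (‖x - y‖ / P j) := fun j => by
      have := cutWeight_nonneg σ (b := ‖x - y‖ / P j) (div_nonneg hρ.le (hP j).le)
      simp only [hw]; split_ifs <;> simp [this]
    have hsum : ∑ j ∈ Finset.range N, w j / W ≤ 1 := by
      rw [← Finset.sum_div, div_le_one hW0]
      exact (Finset.sum_le_sum fun j _ => hwle j).trans (hW N R _ hR hρ)
    have hQ : Real.sqrt (∑ d, ((∑ j ∈ Finset.range N, c j * P j ^ σ * G ((P j)⁻¹ • x) d) -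
        (∑ j ∈ Finset.range N, c j * P j ^ σ * G ((P j)⁻¹ • y) d)) ^ 2) / ‖x - y‖ ^ σ ≤
        ∑ j ∈ Finset.range N, w j / W * (M * W * c j) := by
      calc _ ≤ (∑ d, |(∑ j ∈ Finset.range N, c j * P j ^ σ * G ((P j)⁻¹ • x) d) -
            (∑ j ∈ Finset.range N, c j * P j ^ σ * G ((P j)⁻¹ • y) d)|) / ‖x - y‖ ^ σ := by
            gcongr; exact sqrt_sum_sq_le_sum_abs _ _
        _ ≤ (∑ d, ∑ j ∈ Finset.range N, c j * P j ^ σ *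
              |G ((P j)⁻¹ • x) d - G ((P j)⁻¹ • y) d|) / ‖x - y‖ ^ σ := by
            gcongr with d
            rw [← Finset.sum_sub_distrib]
            refine (Finset.abs_sum_le_sum_abs _ _).trans (Finset.sum_le_sum fun j _ => le_of_eq ?_)
            rw [← mul_sub, abs_mul, abs_of_nonneg (mul_nonneg (hc j) (by have := hP j; positivity))]
        _ = ∑ j ∈ Finset.range N, c j * (P j ^ σ *
              (∑ d, |G ((P j)⁻¹ • x) d - G ((P j)⁻¹ • y) d|) / ‖x - y‖ ^ σ) := by
            rw [Finset.sum_comm, Finset.sum_div]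
            refine Finset.sum_congr rfl fun j _ => ?_
            rw [← Finset.mul_sum]; ring
        _ ≤ ∑ j ∈ Finset.range N, c j * (M * w j) := by
            gcongr with j
            · exact hc j
            · exact hG.scaled_diff_le (hP j) x y hxy
        _ = _ := Finset.sum_congr rfl fun j _ => by field_simp
    have hJ := hA.sum_le (Finset.range N) (fun j => M * W * c j)
      (fun j => mul_nonneg (mul_nonneg hG.pos.le hW0.le) (hc j)) (fun j => w j / W)
      (fun j => div_nonneg (hw0 j) hW0.le) hsum
    refine (ENNReal.div_le_div_right ((hA.mono (by positivity) hQ).trans hJ) _).trans ?_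
    rw [div_eq_mul_inv, Finset.sum_mul]
    refine Finset.sum_le_sum fun j _ => ?_
    rw [mul_comm (ENNReal.ofReal _), mul_assoc]
    refine mul_le_mul_right ?_ _
    rw [cutKernel, div_eq_mul_inv (ENNReal.ofReal (cutWeight _ _)), ← mul_assoc]
    refine mul_le_mul_left ?_ _
    have h1 : w j / W ≤ w j := div_le_self (hw0 j) hW1
    refine (ENNReal.ofReal_le_ofReal h1).trans ?_
    simp only [hw]
    split_ifs with h
    · rw [one_mul]
      refine le_mul_of_one_le_left zero_le ?_
      rcases h with h | h <;> simp [h]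
    · simp
  refine (lintegral_mono fun x => lintegral_mono fun y => hpt x y).trans ?_
  have hmeas : ∀ j, Measurable fun p : Euc n × Euc n =>
      A (M * W * c j) * (((E j).indicator 1 p.1 + (E j).indicator 1 p.2) *
        cutKernel n σ (P j) (p.1 - p.2)) := fun j => by
    have hm : Measurable ((E j).indicator (1 : Euc n → ℝ≥0∞)) := measurable_one.indicator (hEm j)
    exact (((hm.comp measurable_fst).add (hm.comp measurable_snd)).mul (by fun_prop)).const_mul _
  have hmeas2 : ∀ j, Measurable fun p : Euc n × Euc n =>
      (((E j).indicator 1 p.1 + (E j).indicator 1 p.2) *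
        cutKernel n σ (P j) (p.1 - p.2) : ℝ≥0∞) := fun j => by
    have hm : Measurable ((E j).indicator (1 : Euc n → ℝ≥0∞)) := measurable_one.indicator (hEm j)
    exact (((hm.comp measurable_fst).add (hm.comp measurable_snd)).mul (by fun_prop))
  have hstep : ∀ x : Euc n, ∫⁻ y, ∑ j ∈ Finset.range N, A (M * W * c j) *
        (((E j).indicator 1 x + (E j).indicator 1 y) * cutKernel n σ (P j) (x - y)) =
      ∑ j ∈ Finset.range N, A (M * W * c j) * ∫⁻ y,
        (((E j).indicator 1 x + (E j).indicator 1 y) * cutKernel n σ (P j) (x - y)) := fun x => by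
    refine (lintegral_finsetSum _ fun j _ => (hmeas j).comp measurable_prodMk_left).trans ?_
    exact Finset.sum_congr rfl fun j _ =>
      lintegral_const_mul _ ((hmeas2 j).comp measurable_prodMk_left)
  simp_rw [hstep]
  rw [lintegral_finsetSum _ fun j _ => ((hmeas2 j).lintegral_prod_right').const_mul _,
    Finset.mul_sum]
  refine Finset.sum_le_sum fun j _ => ?_
  rw [lintegral_const_mul _ (hmeas2 j).lintegral_prod_right',
    lintegral_lintegral_indicator_cutKernel σ (hP j) (hEm j), ← hK]
  have hvol : volume (E j) = ENNReal.ofReal (P j ^ n) * (ENNReal.ofReal (2 ^ n) * V) := by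
    simp only [hE]
    rw [Measure.addHaar_closedBall_eq_addHaar_ball, volume_ball_euc _ (by have := hP j; positivity),
      mul_pow, mul_comm, ENNReal.ofReal_mul (by positivity)]
    ring
  have hZle : Z ≤ ENNReal.ofReal (Z.toReal + 1) := by
    conv_lhs => rw [← ENNReal.ofReal_toReal hZt]
    exact ENNReal.ofReal_le_ofReal (by linarith)
  calc A (M * W * c j) * (2 * (volume (E j) * K))
      = Z * (ENNReal.ofReal (P j ^ n) * A (M * W * c j)) := by rw [hvol, hZ]; ring
    _ ≤ _ := mul_le_mul_left hZle _

end

section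

/-! ### The localized coordinate function -/

/-- The coordinate `x_i`, cut off smoothly outside the unit ball. -/
noncomputable def cutCoord {n : ℕ} (i : Fin n) (x : Euc n) : ℝ :=
  x i * (⟨1, 2, one_pos, one_lt_two⟩ : ContDiffBump (0 : Euc n)) x

variable {n : ℕ}

lemma contDiff_cutCoord (i : Fin n) : ContDiff ℝ (⊤ : ℕ∞) (cutCoord i) :=
  (EuclideanSpace.proj (𝕜 := ℝ) i).contDiff.mul (ContDiffBump.contDiff _)

lemma tsupport_cutCoord_subset (i : Fin n) : tsupport (cutCoord i) ⊆ closedBall 0 2 :=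
  (tsupport_mul_subset_right (f := fun x : Euc n => x i)).trans
    (ContDiffBump.tsupport_eq _).subset

lemma hasCompactSupport_cutCoord (i : Fin n) : HasCompactSupport (cutCoord i) :=
  (ContDiffBump.hasCompactSupport _).mul_left

lemma cutCoord_eq (i : Fin n) {x : Euc n} (hx : ‖x‖ ≤ 1) : cutCoord i x = x i := by
  rw [cutCoord, ContDiffBump.one_of_mem_closedBall _ (by simpa using hx), mul_one]

lemma exists_abs_sub_le_min {g : Euc n → ℝ} (hg : ContDiff ℝ (⊤ : ℕ∞) g)
    (hc : HasCompactSupport g) :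
    ∃ M : ℝ, 0 ≤ M ∧ ∀ x y, |g x - g y| ≤ M * min 1 ‖x - y‖ := by
  obtain ⟨C, hC⟩ := hc.exists_bound_of_continuous hg.continuous
  obtain ⟨L, hL⟩ := (hg.of_le (m := 1) (by simp)).lipschitzWith_of_hasCompactSupport hc (by simp)
  have hC0 : 0 ≤ C := (norm_nonneg _).trans (hC 0)
  refine ⟨2 * C + L, by positivity, fun x y => ?_⟩
  rcases le_total 1 ‖x - y‖ with h | h
  · rw [min_eq_left h, mul_one]
    have h1 := hC x; have h2 := hC y
    rw [Real.norm_eq_abs] at h1 h2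
    have := abs_sub (g x) (g y)
    have := L.2
    linarith
  · rw [min_eq_right h]
    have h1 := hL.dist_le_mul x y
    rw [Real.dist_eq, dist_eq_norm] at h1
    have := mul_nonneg hC0 (norm_nonneg (x - y))
    linarith

lemma exists_isProfile_cutCoord (i : Fin n) (m : ℕ) :
    ∃ M, IsProfile (classicalDerivs (cutCoord i) m) M := by
  choose M hM0 hM using fun d : Fin m → Fin n => exists_abs_sub_le_min
    (contDiff_classicalDerivs (contDiff_cutCoord i) m d)
    (hasCompactSupport_classicalDerivs (hasCompactSupport_cutCoord i) m d)
  have h0 : 0 ≤ ∑ d, M d := Finset.sum_nonneg fun d _ => hM0 d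
  refine ⟨1 + ∑ d, M d, by positivity, fun x y => ?_, fun x hx => ?_⟩
  · rw [add_mul, Finset.sum_mul]
    have h1 : 0 ≤ 1 * min 1 ‖x - y‖ := by positivity
    have := Finset.sum_le_sum fun d (_ : d ∈ Finset.univ) => hM d x y
    linarith
  · have h0 : iteratedFDeriv ℝ m (cutCoord i) x = 0 := by
      refine image_eq_zero_of_notMem_tsupport fun h => ?_
      have := tsupport_cutCoord_subset i (tsupport_iteratedFDeriv_subset m h)
      rw [mem_closedBall_zero_iff] at this
      linarith
    funext d
    simp [classicalDerivs, h0]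

lemma classicalDerivs_sum_smul {f : Euc n → ℝ} (hf : ContDiff ℝ (⊤ : ℕ∞) f) (N : ℕ) (a b : ℕ → ℝ)
    (m : ℕ) (x : Euc n) (d : Fin m → Fin n) :
    classicalDerivs (fun x => ∑ j ∈ Finset.range N, a j * f (b j • x)) m x d =
      ∑ j ∈ Finset.range N, a j * (b j ^ m * classicalDerivs f m (b j • x) d) := by
  have hf' : ContDiff ℝ m f := hf.of_le (by exact_mod_cast le_top)
  have hfj : ∀ j, ContDiff ℝ m fun x : Euc n => f (b j • x) := fun j =>
    hf'.comp (contDiff_const_smul (b j))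
  have hj : ∀ j, iteratedFDeriv ℝ m (fun x => a j * f (b j • x)) x =
      a j • b j ^ m • iteratedFDeriv ℝ m f (b j • x) := fun j => by
    have h1 := iteratedFDeriv_const_smul_apply' (a := a j) (hfj j).contDiffAt (x := x)
    have h2 := iteratedFDeriv_comp_const_smul (b j) hf'
    simp only [smul_eq_mul] at h1
    rw [h1, h2]
  rw [classicalDerivs, iteratedFDeriv_fun_sum_apply fun j _ =>
    ((contDiff_const.mul (hfj j)).contDiffAt), sum_apply]
  refine Finset.sum_congr rfl fun j _ => ?_
  rw [hj]
  simp [classicalDerivs]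

/-! ### Mean oscillation of the coordinate functions -/

lemma setAverage_ball_zero (f : Euc n → ℝ) {R : ℝ} (hR : 0 < R) :
    ⨍ x in ball 0 R, f x = ⨍ x in ball 0 1, f (R • x) := by
  have h := Measure.setIntegral_comp_smul_of_pos (volume : Measure (Euc n)) f (ball 0 1) hR
  rw [smul_unitBall_of_pos hR] at h
  rw [setAverage_eq, setAverage_eq, h]
  simp only [measureReal_def, volume_ball_euc (0 : Euc n) hR, ENNReal.toReal_mul,
    finrank_euclideanSpace, Fintype.card_fin, smul_eq_mul]
  rw [ENNReal.toReal_ofReal (by positivity)]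
  field_simp

/-- The mean oscillation of `x_i` over the unit ball. -/
noncomputable def coordOsc (i : Fin n) : ℝ :=
  ⨍ x : Euc n in ball 0 1, |x i - ⨍ z : Euc n in ball 0 1, z i|

lemma coordOsc_pos (i : Fin n) : 0 < coordOsc i := by
  have hcont : Continuous fun x : Euc n => |x i - ⨍ z : Euc n in ball 0 1, z i| := by fun_prop
  have hint : IntegrableOn (fun x : Euc n => |x i - ⨍ z : Euc n in ball 0 1, z i|) (ball 0 1) :=
    (hcont.continuousOn.integrableOn_compact (isCompact_closedBall 0 1)).mono_set
      ball_subset_closedBall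
  rw [coordOsc, setAverage_eq, smul_eq_mul]
  refine mul_pos (inv_pos.2 ?_) ?_
  · exact ENNReal.toReal_pos (measure_ball_pos _ _ one_pos).ne' measure_ball_lt_top.ne
  rw [setIntegral_pos_iff_support_of_nonneg_ae (Eventually.of_forall fun x => abs_nonneg _) hint]
  set c := ⨍ z : Euc n in ball 0 1, z i with hc
  have hopen : IsOpen (Function.support (fun x : Euc n => |x i - c|) ∩ ball 0 1) :=
    hcont.isOpen_support.inter isOpen_ball
  refine hopen.measure_pos _ ?_
  by_cases h : c = 0
  · refine ⟨EuclideanSpace.single i (1 / 2), ?_, ?_⟩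
    · simp [h]
    · rw [mem_ball_zero_iff, PiLp.norm_single]; norm_num
  · exact ⟨0, by simpa using h, by simp⟩

lemma average_linear_osc (i : Fin n) {S R : ℝ} (hS : 0 ≤ S) (hR : 0 < R) {u : Euc n → ℝ}
    (hu : ∀ x ∈ ball 0 R, u x = S * x i) :
    ⨍ x in ball 0 R, |u x - ⨍ z in ball 0 R, u z| = S * R * coordOsc i := by
  have hu' : ∀ x ∈ ball (0 : Euc n) 1, u (R • x) = S * R * x i := fun x hx => by
    rw [hu, PiLp.smul_apply, smul_eq_mul, mul_assoc]
    rw [mem_ball_zero_iff] at hx ⊢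
    rw [norm_smul, Real.norm_of_nonneg hR.le]
    exact mul_lt_of_lt_one_right hR hx
  have e1 : ⨍ z in ball 0 R, u z = S * R * ⨍ z : Euc n in ball 0 1, z i := by
    rw [setAverage_ball_zero u hR, setAverage_eq, setAverage_eq,
      setIntegral_congr_fun measurableSet_ball hu', integral_const_mul]
    simp only [smul_eq_mul]; ring
  rw [e1, setAverage_ball_zero _ hR, coordOsc]
  generalize (⨍ z : Euc n in ball 0 1, z i) = c
  rw [setAverage_eq, setAverage_eq, setIntegral_congr_fun measurableSet_ball
      (g := fun x : Euc n => S * R * |x i - c|), integral_const_mul]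
  · simp only [smul_eq_mul]; ring
  · intro x hx
    simp only
    rw [hu' x hx, ← mul_sub, abs_mul, abs_of_nonneg (mul_nonneg hS hR.le)]

end

/-! ### Sharpness of the oscillation estimate -/

lemma lt_tsum_youngConj_dyadic {n : ℕ} {s : ℝ} (hs : s ∈ Ioo (1 : ℝ) ((n : ℝ) + 1)) {κ : ℝ}
    (hκ : 0 < κ) :
    ∃ c : ℝ, 0 < c ∧ ∀ (A : ℝ → ℝ≥0∞) (R T : ℝ), 0 < R → 0 < T →
      ENNReal.ofReal ((κ * R) ^ (-(n : ℝ))) < youngF ((n : ℝ) / ((n : ℝ) - s + 1)) A T →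
      ENNReal.ofReal c < ∑' j : ℕ, ENNReal.ofReal ((4 ^ j * R) ^ n) *
        youngConj A (T * ((4 : ℝ) ^ (-((n : ℝ) - s + 1))) ^ j) := by
  have hn : (0 : ℝ) < n := by linarith [hs.1, hs.2]
  have hβ : 0 < (n : ℝ) - s + 1 := by linarith [hs.2]
  set q : ℝ := (4 : ℝ) ^ (-((n : ℝ) - s + 1)) with hq
  have hq0 : 0 < q := by positivity
  have hq1 : q < 1 := Real.rpow_lt_one_of_one_lt_of_neg (by norm_num) (by linarith)
  set p : ℝ := 4 ^ n with hpdef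
  have hp : p = q ^ (-((n : ℝ) / ((n : ℝ) - s + 1))) := by
    rw [hq, ← Real.rpow_mul (by norm_num), hpdef, ← Real.rpow_natCast]
    congr 1; field_simp
  have hp0 : 0 < p := by positivity
  set d : ℝ := p * (1 - q) / q with hd
  have hd0 : 0 < d := div_pos (mul_pos hp0 (by linarith)) hq0
  refine ⟨κ ^ (-(n : ℝ)) / d, by positivity, fun A R T hR hT hlt => ?_⟩
  by_contra hcon
  rw [not_lt] at hcon
  refine absurd hlt (not_lt.2 ?_)
  have hRn : 0 < R ^ n := by positivity
  have hsum : ∑' j : ℕ, ENNReal.ofReal (p ^ j) * youngConj A (T * q ^ j) =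
      ENNReal.ofReal (R ^ n)⁻¹ *
        ∑' j : ℕ, ENNReal.ofReal ((4 ^ j * R) ^ n) * youngConj A (T * q ^ j) := by
    rw [← ENNReal.tsum_mul_left]
    refine tsum_congr fun j => ?_
    rw [← mul_assoc, ← ENNReal.ofReal_mul (by positivity)]
    congr 2
    rw [hpdef, mul_pow, ← pow_mul, ← pow_mul, mul_comm n]
    field_simp
  calc youngF ((n : ℝ) / ((n : ℝ) - s + 1)) A T
      ≤ ENNReal.ofReal d * ∑' j : ℕ, ENNReal.ofReal (p ^ j) * youngConj A (T * q ^ j) :=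
        youngF_le_tsum hq0 hq1 (by positivity) hp A hT
    _ ≤ ENNReal.ofReal d * (ENNReal.ofReal (R ^ n)⁻¹ * ENNReal.ofReal (κ ^ (-(n : ℝ)) / d)) := by
        rw [hsum]; gcongr
    _ = ENNReal.ofReal ((κ * R) ^ (-(n : ℝ))) := by
        rw [← ENNReal.ofReal_mul (by positivity), ← ENNReal.ofReal_mul hd0.le,
          Real.mul_rpow hκ.le hR.le, Real.rpow_neg hR.le, Real.rpow_natCast]
        congr 1; field_simp

lemma exists_le_average {n : ℕ} (hn : 0 < n) {s : ℝ} (hs : s ∈ Ioo (1 : ℝ) ((n : ℝ) + 1))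
    (hs2 : ∀ m : ℕ, s ≠ (m : ℝ)) {A : ℝ → ℝ≥0∞} (hA : IsYoung A) (hint : IntCondK n s 0 A) :
    ∃ c : ℝ, 0 < c ∧ ∀ R : ℝ, 0 < R →
      ∃ (u : Euc n → ℝ) (D : (h : ℕ) → Euc n → (Fin h → Fin n) → ℝ),
        HasWeakDerivs n ⌊s⌋₊ u D ∧ DecayFrom n 1 ⌊s⌋₊ D ∧
        fracSem n (s - (⌊s⌋₊ : ℝ)) A (D ⌊s⌋₊) ≤ 1 ∧
        c * psiK n s 0 A (kappa n * R) ≤ ⨍ y in ball 0 R, |u y - ⨍ z in ball 0 R, u z| := by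
  have hs0 : 0 ≤ s := by linarith [hs.1]
  have hml : (⌊s⌋₊ : ℝ) < s := lt_of_le_of_ne (Nat.floor_le hs0) (hs2 _).symm
  have hmu : s < (⌊s⌋₊ : ℝ) + 1 := Nat.lt_floor_add_one s
  have hβ : 0 < (n : ℝ) - s + 1 := by linarith [hs.2]
  set m := ⌊s⌋₊ with hm
  set σ : ℝ := s - m with hσ
  let i : Fin n := ⟨0, hn⟩
  obtain ⟨M, hG⟩ := exists_isProfile_cutCoord i m
  obtain ⟨C₃, C₄, hC₃, hC₄, hJ⟩ := exists_Jfun_dyadic_le hn (σ := σ) (by linarith) (by linarith) hA hG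
  obtain ⟨c', hc', htsum⟩ := lt_tsum_youngConj_dyadic (n := n) hs (kappa_pos n)
  have hκ := kappa_pos n
  have hΩ := coordOsc_pos i
  set μ : ℝ := min c' C₃⁻¹ with hμ
  have hμ0 : 0 < μ := lt_min hc' (by positivity)
  refine ⟨C₄⁻¹ * μ * coordOsc i * kappa n ^ ((n : ℝ) - s) / 2, by positivity, fun R hR => ?_⟩
  obtain ⟨hL, -, hlt⟩ := rcInv_youngF_of_intCond hs hA hint (r := kappa n * R) (by positivity)
  rw [psiK_zero]
  set L := rcInv (youngF ((n : ℝ) / ((n : ℝ) - s + 1)) A)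
    (ENNReal.ofReal ((kappa n * R) ^ (-(n : ℝ)))) with hLdef
  set T : ℝ := 2 * L with hT
  have hT0 : 0 < T := by positivity
  set q : ℝ := (4 : ℝ) ^ (-((n : ℝ) - s + 1)) with hq
  have hq0 : 0 < q := by positivity
  obtain ⟨N, t, ht0, htA, hts⟩ := hA.exists_coeff (w := fun j : ℕ => (4 ^ j * R) ^ n)
    (b := fun j => T * q ^ j) (fun j => by positivity) (fun j => by positivity) hc'
    (inv_pos.2 hC₃) (htsum A R T hR hT0 hlt)
  set P : ℕ → ℝ := fun j => 4 ^ j * R with hPdef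
  have hP : ∀ j, 0 < P j := fun j => by positivity
  set c : ℕ → ℝ := fun j => t j / C₄ with hc
  have hc0 : ∀ j, 0 ≤ c j := fun j => div_nonneg (ht0 j) hC₄.le
  set u : Euc n → ℝ := fun x => ∑ j ∈ Finset.range N, c j * P j ^ s * cutCoord i ((P j)⁻¹ • x)
    with hu
  have hus : ContDiff ℝ (⊤ : ℕ∞) u := ContDiff.sum fun j _ =>
    contDiff_const.mul ((contDiff_cutCoord i).comp (contDiff_const_smul _))
  have huc : HasCompactSupport u := by
    refine HasCompactSupport.intro (isCompact_closedBall 0 (2 * (4 ^ N * R))) fun x hx => ?_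
    rw [mem_closedBall_zero_iff, not_le] at hx
    refine Finset.sum_eq_zero fun j hj => ?_
    have hPj : P j ≤ 4 ^ N * R := mul_le_mul_of_nonneg_right
      (pow_le_pow_right₀ (by norm_num) (Finset.mem_range.1 hj).le) hR.le
    refine mul_eq_zero_of_right _ (image_eq_zero_of_notMem_tsupport fun h => ?_)
    have h1 := tsupport_cutCoord_subset i h
    rw [mem_closedBall_zero_iff, norm_smul, norm_inv, Real.norm_of_nonneg (hP j).le,
      inv_mul_eq_div, div_le_iff₀ (hP j)] at h1
    linarith
  have hDm : classicalDerivs u m = fun x d => ∑ j ∈ Finset.range N,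
      c j * P j ^ σ * classicalDerivs (cutCoord i) m ((P j)⁻¹ • x) d := by
    funext x d
    rw [hu, classicalDerivs_sum_smul (contDiff_cutCoord i) N (fun j => c j * P j ^ s)]
    refine Finset.sum_congr rfl fun j _ => ?_
    rw [hσ, Real.rpow_sub_natCast (hP j).ne', inv_pow]
    ring
  refine ⟨u, classicalDerivs u, hasWeakDerivs_classicalDerivs hus huc m,
    decayFrom_classicalDerivs huc 1 m, ?_, ?_⟩
  · refine sInf_le ⟨1, ⟨one_pos, ?_⟩, by simp⟩
    simp only [div_one]
    rw [hDm]
    refine (hJ N R c hR hc0).trans ?_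
    have hcc : ∀ j, C₄ * c j = t j := fun j => by simp only [hc]; field_simp
    simp only [hcc]
    calc _ ≤ ENNReal.ofReal C₃ * ENNReal.ofReal C₃⁻¹ := mul_le_mul_right htA _
      _ = 1 := by rw [← ENNReal.ofReal_mul hC₃.le, mul_inv_cancel₀ hC₃.ne', ENNReal.ofReal_one]
  · set S : ℝ := ∑ j ∈ Finset.range N, c j * P j ^ (s - 1) with hS
    have hS0 : 0 ≤ S := Finset.sum_nonneg fun j _ => mul_nonneg (hc0 j)
      (Real.rpow_nonneg (hP j).le _)
    have hlin : ∀ x ∈ ball (0 : Euc n) R, u x = S * x i := fun x hx => by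
      rw [mem_ball_zero_iff] at hx
      rw [hu, hS, Finset.sum_mul]
      refine Finset.sum_congr rfl fun j _ => ?_
      have hRP : R ≤ P j := le_mul_of_one_le_left hR.le (one_le_pow₀ (by norm_num))
      rw [cutCoord_eq, PiLp.smul_apply, smul_eq_mul, Real.rpow_sub_one (hP j).ne']
      · ring
      · rw [norm_smul, norm_inv, Real.norm_of_nonneg (hP j).le, inv_mul_le_iff₀ (hP j), mul_one]
        linarith
    rw [average_linear_osc i hS0 hR hlin]
    have hsum : ∑ j ∈ Finset.range N, P j ^ n * (t j * (T * q ^ j)) =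
        T * R ^ ((n : ℝ) - s + 1) * (C₄ * S) := by
      rw [hS, Finset.mul_sum, Finset.mul_sum]
      refine Finset.sum_congr rfl fun j _ => ?_
      have e : P j ^ n * q ^ j = R ^ ((n : ℝ) - s + 1) * P j ^ (s - 1) := by
        have e1 : q ^ j = (4 ^ j) ^ (-((n : ℝ) - s + 1)) := by
          rw [hq, ← Real.rpow_natCast _ j, ← Real.rpow_natCast 4 j,
            ← Real.rpow_mul (by norm_num), ← Real.rpow_mul (by norm_num), mul_comm]
        have e2 : R ^ ((n : ℝ) - s + 1) = P j ^ ((n : ℝ) - s + 1) *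
            (4 ^ j) ^ (-((n : ℝ) - s + 1)) := by
          simp only [hPdef]
          rw [Real.mul_rpow (by positivity) hR.le, Real.rpow_neg (by positivity)]
          field_simp
        rw [e1, e2, mul_right_comm, ← Real.rpow_add (hP j), ← Real.rpow_natCast]
        congr 2; ring
      simp only [hc]
      calc P j ^ n * (t j * (T * q ^ j)) = t j * T * (P j ^ n * q ^ j) := by ring
        _ = _ := by rw [e]; field_simp
    have hmain : μ ≤ T * R ^ ((n : ℝ) - s + 1) * (C₄ * S) := hsum ▸ hts
    have hRβ : R ^ ((n : ℝ) - s + 1) = R ^ ((n : ℝ) - s) * R := Real.rpow_add_one hR.ne' _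
    rw [Real.mul_rpow hκ.le hR.le]
    rw [hRβ, hT] at hmain
    have hx : 0 < R ^ ((n : ℝ) - s) := by positivity
    have hy : 0 < kappa n ^ ((n : ℝ) - s) := by positivity
    calc C₄⁻¹ * μ * coordOsc i * kappa n ^ ((n : ℝ) - s) / 2 *
          (kappa n ^ ((n : ℝ) - s) * R ^ ((n : ℝ) - s) * L)⁻¹
        = μ * (coordOsc i / (2 * C₄ * R ^ ((n : ℝ) - s) * L)) := by field_simp
      _ ≤ 2 * L * (R ^ ((n : ℝ) - s) * R) * (C₄ * S) *
          (coordOsc i / (2 * C₄ * R ^ ((n : ℝ) - s) * L)) := by gcongr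
      _ = S * R * coordOsc i := by field_simp

/-! ### Passing between averages and Campanato seminorms -/

lemma psiK_zero_nonneg {n : ℕ} {s : ℝ} (hs : s ∈ Ioo (1 : ℝ) ((n : ℝ) + 1)) {A : ℝ → ℝ≥0∞}
    (hA : IsYoung A) (hint : IntCondK n s 0 A) {r : ℝ} (hr : 0 < r) : 0 ≤ psiK n s 0 A r := by
  obtain ⟨hL, -⟩ := rcInv_youngF_of_intCond hs hA hint hr
  rw [psiK_zero]
  positivity

lemma exists_oscQuot_le {n : ℕ} (hn : 0 < n) {s : ℝ} (hs : s ∈ Ioo (1 : ℝ) ((n : ℝ) + 1))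
    (hs2 : ∀ m : ℕ, s ≠ (m : ℝ)) {A : ℝ → ℝ≥0∞} (hA : IsYoung A) (hint : IntCondK n s 0 A)
    {φ : ℝ → ℝ} (hφ : ∀ r, 0 < r → 0 < φ r) :
    ∃ C : ℝ, 0 < C ∧ ∀ (u : Euc n → ℝ) (D : (h : ℕ) → Euc n → (Fin h → Fin n) → ℝ) (lam₀ : ℝ),
      HasWeakDerivs n ⌊s⌋₊ u D → DecayFrom n 1 ⌊s⌋₊ D → 0 < lam₀ →
      Jfun n (s - (⌊s⌋₊ : ℝ)) A (fun x i => D ⌊s⌋₊ x i / lam₀) ≤ 1 →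
      ∀ (a : Euc n) (R : ℝ), 0 < R →
        oscQuot n φ u a R ≤ C * lam₀ * (psiK n s 0 A (kappa n * R) / φ (kappa n * R)) := by
  obtain ⟨C, hC, h⟩ := exists_average_le hn hs hs2 hA hint
  refine ⟨C, hC, fun u D lam₀ h1 h2 h3 h4 a R hR => ?_⟩
  have hpos := hφ (kappa n * R) (mul_pos (kappa_pos n) hR)
  rw [oscQuot, volume_ball_toReal_rpow hn a hR, ← mul_div_assoc, inv_mul_eq_div]
  gcongr
  exact h u D lam₀ h1 h2 h3 h4 a R hR

lemma exists_le_oscQuot {n : ℕ} (hn : 0 < n) {s : ℝ} (hs : s ∈ Ioo (1 : ℝ) ((n : ℝ) + 1))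
    (hs2 : ∀ m : ℕ, s ≠ (m : ℝ)) {A : ℝ → ℝ≥0∞} (hA : IsYoung A) (hint : IntCondK n s 0 A)
    {φ : ℝ → ℝ} (hφ : ∀ r, 0 < r → 0 < φ r) :
    ∃ c : ℝ, 0 < c ∧ ∀ r : ℝ, 0 < r →
      ∃ (u : Euc n → ℝ) (D : (h : ℕ) → Euc n → (Fin h → Fin n) → ℝ) (R : ℝ),
        HasWeakDerivs n ⌊s⌋₊ u D ∧ DecayFrom n 1 ⌊s⌋₊ D ∧
        fracSem n (s - (⌊s⌋₊ : ℝ)) A (D ⌊s⌋₊) ≤ 1 ∧ 0 < R ∧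
        volume (ball (0 : Euc n) R) = ENNReal.ofReal (r ^ n) ∧
        c * (psiK n s 0 A r / φ r) ≤ oscQuot n φ u 0 R := by
  obtain ⟨c, hc, h⟩ := exists_le_average hn hs hs2 hA hint
  have hκ := kappa_pos n
  refine ⟨c, hc, fun r hr => ?_⟩
  have hR : 0 < r / kappa n := by positivity
  have hκR : kappa n * (r / kappa n) = r := by field_simp
  obtain ⟨u, D, h1, h2, h3, h4⟩ := h (r / kappa n) hR
  have hvol := volume_ball_toReal_rpow hn 0 hR
  rw [hκR] at hvol h4
  refine ⟨u, D, r / kappa n, h1, h2, h3, hR, ?_, ?_⟩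
  · have key : ∀ V : ℝ, 0 ≤ V → V ^ ((n : ℝ)⁻¹) = r → V = r ^ n := by
      rintro V hV rfl
      rw [← Real.rpow_natCast, ← Real.rpow_mul hV, inv_mul_cancel₀ (by positivity), Real.rpow_one]
    rw [← key _ ENNReal.toReal_nonneg hvol, ENNReal.ofReal_toReal measure_ball_lt_top.ne]
  · have hpos := hφ r hr
    rw [oscQuot, hvol, ← mul_div_assoc, inv_mul_eq_div]
    gcongr

lemma campSem_le_of_psiK_le {n : ℕ} (hn : 0 < n) {s : ℝ} (hs : s ∈ Ioo (1 : ℝ) ((n : ℝ) + 1))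
    (hs2 : ∀ m : ℕ, s ≠ (m : ℝ)) {A : ℝ → ℝ≥0∞} (hA : IsYoung A) (hint : IntCondK n s 0 A)
    {φ : ℝ → ℝ} (hφ : ∀ r, 0 < r → 0 < φ r) {c : ℝ} (hc : 0 < c)
    (h : ∀ r : ℝ, 0 < r → psiK n s 0 A r ≤ c * φ r) :
    ∃ c' : ℝ, 0 < c' ∧
      ∀ (u : Euc n → ℝ) (D : (h : ℕ) → Euc n → (Fin h → Fin n) → ℝ),
        HasWeakDerivs n ⌊s⌋₊ u D → DecayFrom n 1 ⌊s⌋₊ D →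
        campSem n φ u ≤ ENNReal.ofReal c' * fracSem n (s - (⌊s⌋₊ : ℝ)) A (D ⌊s⌋₊) := by
  obtain ⟨C, hC, hosc⟩ := exists_oscQuot_le hn hs hs2 hA hint hφ
  have hCc : 0 < C * c := by positivity
  refine ⟨C * c, hCc, fun u D h1 h2 => ?_⟩
  rw [mul_comm, ← ENNReal.div_le_iff_le_mul (Or.inl (by simpa using hCc))
    (Or.inl ENNReal.ofReal_ne_top)]
  refine le_sInf ?_
  rintro _ ⟨lam, ⟨hlam, hJ⟩, rfl⟩
  rw [ENNReal.div_le_iff_le_mul (Or.inl (by simpa using hCc)) (Or.inl ENNReal.ofReal_ne_top),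
    ← ENNReal.ofReal_mul hlam.le]
  refine iSup_le fun x => iSup_le fun R => iSup_le fun hR => ENNReal.ofReal_le_ofReal ?_
  have hκR : 0 < kappa n * R := mul_pos (kappa_pos n) hR
  have hq : psiK n s 0 A (kappa n * R) / φ (kappa n * R) ≤ c :=
    (div_le_iff₀ (hφ _ hκR)).2 (h _ hκR)
  calc _ ≤ _ := hosc u D lam h1 h2 hlam hJ x R hR
    _ ≤ C * lam * c := by gcongr
    _ = _ := by ring

lemma tendsto_campSemSmall {n : ℕ} (hn : 0 < n) {s : ℝ} (hs : s ∈ Ioo (1 : ℝ) ((n : ℝ) + 1))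
    (hs2 : ∀ m : ℕ, s ≠ (m : ℝ)) {A : ℝ → ℝ≥0∞} (hA : IsYoung A) (hint : IntCondK n s 0 A)
    {φ : ℝ → ℝ} (hφ : ∀ r, 0 < r → 0 < φ r)
    (h : Tendsto (fun r : ℝ => psiK n s 0 A r / φ r) (𝓝[>] (0 : ℝ)) (𝓝 0)) :
    Tendsto
      (fun r : ℝ =>
        ⨆ (u : Euc n → ℝ) (D : (h : ℕ) → Euc n → (Fin h → Fin n) → ℝ)
          (_ : HasWeakDerivs n ⌊s⌋₊ u D) (_ : DecayFrom n 1 ⌊s⌋₊ D)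
          (_ : fracSem n (s - (⌊s⌋₊ : ℝ)) A (D ⌊s⌋₊) ≤ 1),
          campSemSmall n φ u r)
      (𝓝[>] (0 : ℝ)) (𝓝 0) := by
  obtain ⟨C, hC, hosc⟩ := exists_oscQuot_le hn hs hs2 hA hint hφ
  rw [ENNReal.tendsto_nhds_zero]
  intro ε hε
  obtain ⟨e, he, heε⟩ : ∃ e : ℝ, 0 < e ∧ ENNReal.ofReal e ≤ ε := by
    rcases eq_or_ne ε ⊤ with rfl | hε'
    · exact ⟨1, one_pos, le_top⟩
    · exact ⟨ε.toReal, ENNReal.toReal_pos hε.ne' hε', ENNReal.ofReal_toReal_le⟩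
  have hev := h.eventually (gt_mem_nhds (show 0 < e / (2 * C) by positivity))
  obtain ⟨δ, hδ, hδe⟩ := mem_nhdsGT_iff_exists_Ioo_subset.1 hev
  have hδ : 0 < δ := hδ
  filter_upwards [Ioo_mem_nhdsGT (show 0 < δ ^ n by positivity)] with r hr
  refine iSup_le fun u => iSup_le fun D => iSup_le fun h1 => iSup_le fun h2 => iSup_le fun h3 =>
    iSup_le fun x => iSup_le fun ρ => iSup_le fun hρ => iSup_le fun hvol =>
    le_trans (ENNReal.ofReal_le_ofReal ?_) heε
  obtain ⟨_, ⟨lam, ⟨hlam, hJ⟩, rfl⟩, hlam2⟩ := sInf_lt_iff.1 (h3.trans_lt ENNReal.one_lt_two)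
  have hlam2' : lam < 2 := by
    rw [← ENNReal.ofReal_ofNat] at hlam2
    exact (ENNReal.ofReal_lt_ofReal_iff (by norm_num)).1 hlam2
  have hκρ : 0 < kappa n * ρ := mul_pos (kappa_pos n) hρ
  have hlt : kappa n * ρ < δ := by
    rw [← volume_ball_toReal_rpow hn x hρ]
    have h4 : (volume (ball x ρ)).toReal ≤ r := by
      have := ENNReal.toReal_mono ENNReal.ofReal_ne_top hvol
      rwa [ENNReal.toReal_ofReal hr.1.le] at this
    calc _ ≤ r ^ ((n : ℝ)⁻¹) := by gcongr
      _ < (δ ^ n) ^ ((n : ℝ)⁻¹) := Real.rpow_lt_rpow hr.1.le hr.2 (by positivity)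
      _ = δ := Real.pow_rpow_inv_natCast hδ.le hn.ne'
  have hq : psiK n s 0 A (kappa n * ρ) / φ (kappa n * ρ) < e / (2 * C) := hδe ⟨hκρ, hlt⟩
  calc _ ≤ _ := hosc u D lam h1 h2 hlam hJ x ρ hρ
    _ ≤ C * lam * (e / (2 * C)) := by gcongr
    _ ≤ C * 2 * (e / (2 * C)) := by gcongr
    _ = e := by field_simp

lemma exists_psiK_le {n : ℕ} (hn : 0 < n) {s : ℝ} (hs : s ∈ Ioo (1 : ℝ) ((n : ℝ) + 1))
    (hs2 : ∀ m : ℕ, s ≠ (m : ℝ)) {A : ℝ → ℝ≥0∞} (hA : IsYoung A) (hint : IntCondK n s 0 A)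
    {φ : ℝ → ℝ} (hφ : ∀ r, 0 < r → 0 < φ r) {c : ℝ} (hc : 0 < c)
    (h : ∀ (u : Euc n → ℝ) (D : (h : ℕ) → Euc n → (Fin h → Fin n) → ℝ),
      HasWeakDerivs n ⌊s⌋₊ u D → DecayFrom n 1 ⌊s⌋₊ D →
      fracSem n (s - (⌊s⌋₊ : ℝ)) A (D ⌊s⌋₊) < ⊤ →
      campSem n φ u ≤ ENNReal.ofReal c * fracSem n (s - (⌊s⌋₊ : ℝ)) A (D ⌊s⌋₊)) :
    ∃ c' : ℝ, 0 < c' ∧ ∀ r : ℝ, 0 < r → psiK n s 0 A r ≤ c' * φ r := by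
  obtain ⟨c₁, hc₁, hosc⟩ := exists_le_oscQuot hn hs hs2 hA hint hφ
  refine ⟨c / c₁, by positivity, fun r hr => ?_⟩
  obtain ⟨u, D, R, h1, h2, h3, hR, -, h4⟩ := hosc r hr
  have h5 : ENNReal.ofReal (oscQuot n φ u 0 R) ≤ campSem n φ u :=
    le_iSup_of_le 0 (le_iSup_of_le R (le_iSup_of_le hR le_rfl))
  have h6 : ENNReal.ofReal (oscQuot n φ u 0 R) ≤ ENNReal.ofReal c :=
    (h5.trans (h u D h1 h2 (h3.trans_lt ENNReal.one_lt_top))).trans (mul_le_of_le_one_right' h3)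
  have h7 := h4.trans ((ENNReal.ofReal_le_ofReal_iff hc.le).1 h6)
  rw [← le_div_iff₀' hc₁, div_le_iff₀ (hφ r hr)] at h7
  exact h7

lemma tendsto_psiK_div {n : ℕ} (hn : 0 < n) {s : ℝ} (hs : s ∈ Ioo (1 : ℝ) ((n : ℝ) + 1))
    (hs2 : ∀ m : ℕ, s ≠ (m : ℝ)) {A : ℝ → ℝ≥0∞} (hA : IsYoung A) (hint : IntCondK n s 0 A)
    {φ : ℝ → ℝ} (hφ : ∀ r, 0 < r → 0 < φ r)
    (h : Tendsto
      (fun r : ℝ =>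
        ⨆ (u : Euc n → ℝ) (D : (h : ℕ) → Euc n → (Fin h → Fin n) → ℝ)
          (_ : HasWeakDerivs n ⌊s⌋₊ u D) (_ : DecayFrom n 1 ⌊s⌋₊ D)
          (_ : fracSem n (s - (⌊s⌋₊ : ℝ)) A (D ⌊s⌋₊) ≤ 1),
          campSemSmall n φ u r)
      (𝓝[>] (0 : ℝ)) (𝓝 0)) :
    Tendsto (fun r : ℝ => psiK n s 0 A r / φ r) (𝓝[>] (0 : ℝ)) (𝓝 0) := by
  obtain ⟨c₁, hc₁, hosc⟩ := exists_le_oscQuot hn hs hs2 hA hint hφ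
  have hpow : Tendsto (fun r : ℝ => r ^ n) (𝓝[>] 0) (𝓝[>] 0) := by
    refine tendsto_nhdsWithin_iff.2 ⟨?_, ?_⟩
    · have : Tendsto (fun r : ℝ => r ^ n) (𝓝 0) (𝓝 (0 ^ n)) := (continuous_pow n).tendsto 0
      rw [zero_pow hn.ne'] at this
      exact this.mono_left nhdsWithin_le_nhds
    · filter_upwards [self_mem_nhdsWithin] with r (hr : 0 < r)
      exact pow_pos hr n
  rw [tendsto_order]
  refine ⟨fun a ha => ?_, fun a ha => ?_⟩
  · filter_upwards [self_mem_nhdsWithin] with r (hr : 0 < r)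
    exact ha.trans_le (div_nonneg (psiK_zero_nonneg hs hA hint hr) (hφ r hr).le)
  · have hca : 0 < c₁ * (a / 2) := by positivity
    have hev := ENNReal.tendsto_nhds_zero.1 (h.comp hpow) (ENNReal.ofReal (c₁ * (a / 2)))
      (by simpa using hca)
    filter_upwards [hev, self_mem_nhdsWithin] with r hr1 (hr : 0 < r)
    obtain ⟨u, D, R, h1, h2, h3, hR, hvol, h4⟩ := hosc r hr
    have h5 : ENNReal.ofReal (oscQuot n φ u 0 R) ≤ campSemSmall n φ u (r ^ n) :=
      le_iSup_of_le 0 (le_iSup_of_le R (le_iSup_of_le hR (le_iSup_of_le hvol.le le_rfl)))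
    simp only [Function.comp_apply] at hr1
    have h6 : campSemSmall n φ u (r ^ n) ≤ ENNReal.ofReal (c₁ * (a / 2)) :=
      le_trans (le_iSup_of_le u (le_iSup_of_le D (le_iSup_of_le h1 (le_iSup_of_le h2
        (le_iSup (fun _ : fracSem n (s - (⌊s⌋₊ : ℝ)) A (D ⌊s⌋₊) ≤ 1 =>
          campSemSmall n φ u (r ^ n)) h3))))) hr1
    have h7 := h4.trans ((ENNReal.ofReal_le_ofReal_iff hca.le).1 (h5.trans h6))
    have := le_of_mul_le_mul_left h7 hc₁
    linarith

/-- `V^{s,A}_{d,1}(ℝⁿ) → V𝓛^{φ}(ℝⁿ)` uniformly if and only if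
`ψ_{s,A} ≤ c φ` and `ψ_{s,A}(r)/φ(r) → 0` as `r → 0⁺`. -/
theorem stmt8 (n : ℕ) (hn : 0 < n) (s : ℝ) (hs : s ∈ Set.Ioo (1 : ℝ) ((n : ℝ) + 1))
    (hs2 : ∀ m : ℕ, s ≠ (m : ℝ)) (A : ℝ → ℝ≥0∞) (hA : IsYoung A)
    (hint : IntCondK n s 0 A) (φ : ℝ → ℝ) (hφ : Admissible φ) :
    ((∃ c : ℝ, 0 < c ∧
        ∀ (u : Euc n → ℝ) (D : (h : ℕ) → Euc n → (Fin h → Fin n) → ℝ),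
          HasWeakDerivs n ⌊s⌋₊ u D → DecayFrom n 1 ⌊s⌋₊ D →
          fracSem n (s - (⌊s⌋₊ : ℝ)) A (D ⌊s⌋₊) < ⊤ →
          campSem n φ u ≤ ENNReal.ofReal c * fracSem n (s - (⌊s⌋₊ : ℝ)) A (D ⌊s⌋₊)) ∧
      Tendsto
        (fun r : ℝ =>
          ⨆ (u : Euc n → ℝ) (D : (h : ℕ) → Euc n → (Fin h → Fin n) → ℝ)
            (_ : HasWeakDerivs n ⌊s⌋₊ u D) (_ : DecayFrom n 1 ⌊s⌋₊ D)
            (_ : fracSem n (s - (⌊s⌋₊ : ℝ)) A (D ⌊s⌋₊) ≤ 1),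
            campSemSmall n φ u r)
        (𝓝[>] (0 : ℝ)) (𝓝 0)) ↔
    ((∃ c : ℝ, 0 < c ∧ ∀ r : ℝ, 0 < r → psiK n s 0 A r ≤ c * φ r) ∧
      Tendsto (fun r : ℝ => psiK n s 0 A r / φ r) (𝓝[>] (0 : ℝ)) (𝓝 0)) := by
  constructor
  · rintro ⟨⟨c, hc, h1⟩, h2⟩
    exact ⟨exists_psiK_le hn hs hs2 hA hint hφ.1 hc h1, tendsto_psiK_div hn hs hs2 hA hint hφ.1 h2⟩
  · rintro ⟨⟨c, hc, h1⟩, h2⟩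
    obtain ⟨c', hc', h3⟩ := campSem_le_of_psiK_le hn hs hs2 hA hint hφ.1 hc h1
    exact ⟨⟨c', hc', fun u D hu hD _ => h3 u D hu hD⟩,
      tendsto_campSemSmall hn hs hs2 hA hint hφ.1 h2⟩
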